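/- Let the multiset {v_1,…,v_m} be partitioned as S_1 ⊔ ⋯ ⊔ S_a, where v_j and v_k lie in the same part if and only if v_j = q^b v_k for some integer b. Then the category of finite-dimensional right H_n(v_1,…,v_m;q)-modules is k-linearly equivalent to the category of finite-dimensional right modules over the k-algebra ∏ H_{n_1}(S_1;q) ⊗_k H_{n_2}(S_2;q) ⊗_k ⋯ ⊗_k H_{n_a}(S_a;q), where the product is over all tuples (n_1,…,n_a) of nonnegative integers with n_1 + ⋯ + n_a = n, H_{n_i}(S_i;q) denotes the cyclotomic Hecke algebra of type G(|S_i|,1,n_i) whose first-generator parameters are the elements of S_i (with multiplicity) and whose quadratic parameter is q, and H_0 = k. -/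

import Mathlib

noncomputable section
open scoped Classical
open scoped Fin.NatCast

namespace Cyclo

/-- The defining relations of the cyclotomic Hecke algebra of type `G(m,1,n)`.
Generator `i : Fin n` corresponds to `a_{i+1}` of the paper. -/
inductive Rel (k : Type) [Field k] (m n : ℕ) (v : Fin m → k) (q : k) :
    FreeAlgebra k (Fin n) → FreeAlgebra k (Fin n) → Prop
  | cyclo (i : Fin n) (hi : i.1 = 0) :
      Rel k m n v q
        ((List.ofFn fun j : Fin m =>
          (FreeAlgebra.ι k i - algebraMap k (FreeAlgebra k (Fin n)) (v j))).prod) 0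
  | quad (i : Fin n) (hi : 1 ≤ i.1) :
      Rel k m n v q
        ((FreeAlgebra.ι k i - algebraMap k (FreeAlgebra k (Fin n)) q) * (FreeAlgebra.ι k i + 1)) 0
  | braid0 (i j : Fin n) (hi : i.1 = 0) (hj : j.1 = 1) :
      Rel k m n v q
        (FreeAlgebra.ι k i * FreeAlgebra.ι k j * FreeAlgebra.ι k i * FreeAlgebra.ι k j)
        (FreeAlgebra.ι k j * FreeAlgebra.ι k i * FreeAlgebra.ι k j * FreeAlgebra.ι k i)
  | comm (i j : Fin n) (h : i.1 + 2 ≤ j.1) :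
      Rel k m n v q (FreeAlgebra.ι k i * FreeAlgebra.ι k j)
        (FreeAlgebra.ι k j * FreeAlgebra.ι k i)
  | braid (i j : Fin n) (hi : 1 ≤ i.1) (hj : j.1 = i.1 + 1) :
      Rel k m n v q
        (FreeAlgebra.ι k j * FreeAlgebra.ι k i * FreeAlgebra.ι k j)
        (FreeAlgebra.ι k i * FreeAlgebra.ι k j * FreeAlgebra.ι k i)

/-- The cyclotomic Hecke algebra `H_n(v_1,…,v_m;q)` of type `G(m,1,n)`. -/
def CH (k : Type) [Field k] (m n : ℕ) (v : Fin m → k) (q : k) : Type :=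
  RingQuot (Rel k m n v q)

instance (k : Type) [Field k] (m n : ℕ) (v : Fin m → k) (q : k) : Ring (CH k m n v q) :=
  inferInstanceAs (Ring (RingQuot (Rel k m n v q)))

instance (k : Type) [Field k] (m n : ℕ) (v : Fin m → k) (q : k) : Algebra k (CH k m n v q) :=
  inferInstanceAs (Algebra k (RingQuot (Rel k m n v q)))

variable (k : Type) [Field k] (m n : ℕ) (v : Fin m → k) (q : k)

/-- `gen k m n v q t` is the generator `a_{t+1}` (so `gen 0 = a_1`, …, `gen (n-1) = a_n`). -/
def gen [NeZero n] (t : ℕ) : CH k m n v q :=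
  RingQuot.mkAlgHom k (Rel k m n v q) (FreeAlgebra.ι k ((t : Fin n)))

/-- `murphyAux k m n v q t` is the Murphy element `L_{t+1}`. -/
def murphyAux [NeZero n] : ℕ → CH k m n v q
  | 0 => gen k m n v q 0
  | t + 1 => q⁻¹ • (gen k m n v q (t + 1) * murphyAux t * gen k m n v q (t + 1))

/-- The Murphy element `L_{i+1}`, for `i : Fin n`. -/
def murphy [NeZero n] (i : Fin n) : CH k m n v q := murphyAux k m n v q i.1

/-- The product of adjacent transpositions encoded by a list of `0`-based indices:
`t` encodes the transposition `(t, t+1)` (in `0`-based labels), i.e. `s_{t+1}` of the paper. -/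
def swapProd [NeZero n] (l : List ℕ) : Equiv.Perm (Fin n) :=
  (l.map fun t => Equiv.swap ((t : Fin n)) (((t + 1 : ℕ) : Fin n))).prod

/-- The corresponding product of generators of the Hecke algebra: the index `t`
(encoding `s_{t+1}`) contributes the generator `a_{t+2} = gen (t+1)`. -/
def genProd [NeZero n] (l : List ℕ) : CH k m n v q :=
  (l.map fun t => gen k m n v q (t + 1)).prod

/-- `l` is a reduced word for the permutation `w`. -/
def IsReducedWord [NeZero n] (l : List ℕ) (w : Equiv.Perm (Fin n)) : Prop :=
  (∀ t ∈ l, t + 1 < n) ∧ swapProd n l = w ∧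
    ∀ l' : List ℕ, (∀ t ∈ l', t + 1 < n) → swapProd n l' = w → l.length ≤ l'.length

/-- `aw` assigns to each permutation `w` the element `a_w` computed from a(ny) reduced word. -/
def IsAW [NeZero n] (aw : Equiv.Perm (Fin n) → CH k m n v q) : Prop :=
  ∀ (w : Equiv.Perm (Fin n)) (l : List ℕ), IsReducedWord n l w → aw w = genProd k m n v q l



/-- An `m`-multipartition of `n`:  `part c` is the partition `λ^{(c+1)}`
(so `c = m-1` corresponds to the component `λ^{(m)}` of the paper), given by its
(weakly decreasing) list of row lengths `part c 0, part c 1, …`. -/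
structure Multipartition (m n : ℕ) where
  part : Fin m → ℕ → ℕ
  mono : ∀ c i, part c (i + 1) ≤ part c i
  bound : ∀ c i, n ≤ i → part c i = 0
  total : (∑ c : Fin m, ∑ i ∈ Finset.range n, part c i) = n

namespace Multipartition

variable {m n : ℕ}

/-- The size `|λ^{(c+1)}|` of a component. -/
def compSize (Λ : Multipartition m n) (c : Fin m) : ℕ :=
  ∑ i ∈ Finset.range n, Λ.part c i

/-- `|λ^{(1)}| + ⋯ + |λ^{(kk)}|`. -/
def compSizeUpto (Λ : Multipartition m n) (kk : ℕ) : ℕ :=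
  ∑ c ∈ Finset.range kk, (if h : c < m then Λ.compSize ⟨c, h⟩ else 0)

/-- The statistic `Σ_{j>k}|λ^{(j)}| + Σ_{j=1}^{l} λ^{(k)}_j` of the dominance order,
where the component `k` (`1`-based) is `c.1 + 1`. -/
def domStat (Λ : Multipartition m n) (c : Fin m) (l : ℕ) : ℕ :=
  (∑ c' ∈ Finset.univ.filter (fun c' : Fin m => c.1 < c'.1), Λ.compSize c') +
    ∑ j ∈ Finset.range l, Λ.part c j

/-- The dominance order `Λ ⊵ M`. -/
def Dominates (Λ M : Multipartition m n) : Prop :=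
  ∀ (c : Fin m) (l : ℕ), M.domStat c l ≤ Λ.domStat c l

/-- Strict dominance `Λ ▷ M`. -/
def StrictDom (Λ M : Multipartition m n) : Prop :=
  Λ.Dominates M ∧ Λ ≠ M

/-- The (0-based) entry of the canonical tableau `t^Λ` in the box in row `i`, column `j`
of component `c`: the boxes are filled row by row, starting with the rows of `λ^{(m)}`,
then those of `λ^{(m-1)}`, and so on. -/
def canonEntry (Λ : Multipartition m n) (c : Fin m) (i j : ℕ) : ℕ :=
  (∑ c' ∈ Finset.univ.filter (fun c' : Fin m => c.1 < c'.1), Λ.compSize c') +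
    (∑ i' ∈ Finset.range i, Λ.part c i') + j

end Multipartition

/-- A standard tableau of shape `Λ`, with (0-based) entries `0, …, n-1`:
`entry c i j` is the entry in the box in row `i`, column `j` of component `c`
(and is normalised to `0` outside the boxes of `Λ`). -/
structure StdTableau {m n : ℕ} (Λ : Multipartition m n) where
  entry : Fin m → ℕ → ℕ → ℕ
  lt_n : ∀ c i j, j < Λ.part c i → entry c i j < n
  inj : ∀ c i j c' i' j', j < Λ.part c i → j' < Λ.part c' i' →
    entry c i j = entry c' i' j' → (c, i, j) = (c', i', j')
  surj : ∀ x, x < n → ∃ c i j, j < Λ.part c i ∧ entry c i j = x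
  row : ∀ c i j, j + 1 < Λ.part c i → entry c i j < entry c i (j + 1)
  col : ∀ c i j, j < Λ.part c (i + 1) → entry c i j < entry c (i + 1) j
  outside : ∀ c i j, ¬ j < Λ.part c i → entry c i j = 0

variable (k : Type) [Field k] (m n : ℕ)

/-- `d` assigns to each standard tableau `T` of each shape `Λ` the permutation `d(T)`
sending, box by box, the entry of the canonical tableau `t^Λ` to the entry of `T`. -/
def IsD [NeZero n] (d : ∀ Λ : Multipartition m n, StdTableau Λ → Equiv.Perm (Fin n)) : Prop :=
  ∀ (Λ : Multipartition m n) (T : StdTableau Λ) (c : Fin m) (i j : ℕ), j < Λ.part c i →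
    d Λ T ((Λ.canonEntry c i j : ℕ) : Fin n) = ((T.entry c i j : ℕ) : Fin n)

/-- Membership in the row stabiliser `S_Λ` of the canonical tableau `t^Λ`. -/
def InRowStab [NeZero n] (Λ : Multipartition m n) (w : Equiv.Perm (Fin n)) : Prop :=
  ∀ (c : Fin m) (i j : ℕ), j < Λ.part c i →
    ∃ j', j' < Λ.part c i ∧
      w ((Λ.canonEntry c i j : ℕ) : Fin n) = ((Λ.canonEntry c i j' : ℕ) : Fin n)


variable (k : Type) [Field k] (m n : ℕ) (v : Fin m → k) (q : k)

open Multipartition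

/-- The element `x_Λ = Σ_{w ∈ S_Λ} a_w`, where `aw` computes the elements `a_w`. -/
def xlam [NeZero n] (aw : Equiv.Perm (Fin n) → CH k m n v q) (Λ : Multipartition m n) :
    CH k m n v q :=
  ∑ w : Equiv.Perm (Fin n), if InRowStab m n Λ w then aw w else 0

/-- `a_kk = n − |λ^{(1)}| − ⋯ − |λ^{(kk)}|`. -/
def aVal (Λ : Multipartition m n) (kk : ℕ) : ℕ := n - Λ.compSizeUpto kk

/-- The element `u_a = ∏_{kk} (L_1 − v_kk)(L_2 − v_kk)⋯(L_{a_kk} − v_kk)`. -/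
def ua [NeZero n] (Λ : Multipartition m n) : CH k m n v q :=
  (List.ofFn fun kk : Fin m =>
    (List.ofFn fun ii : Fin n =>
      if ii.1 < aVal m n Λ (kk.1 + 1) then
        murphy k m n v q ii - algebraMap k (CH k m n v q) (v kk)
      else 1).prod).prod

/-- The element `m_Λ = x_Λ u_a`. -/
def mlam [NeZero n] (aw : Equiv.Perm (Fin n) → CH k m n v q) (Λ : Multipartition m n) :
    CH k m n v q :=
  xlam k m n v q aw Λ * ua k m n v q Λ

/-- The element `m_{st} = a_{d(s)}^* ⬝ m_Λ ⬝ a_{d(t)}`;  here `aw` computes the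
elements `a_w`, `σ` is the `*` anti-involution and `d` computes the permutations `d(t)`. -/
def mst [NeZero n] (aw : Equiv.Perm (Fin n) → CH k m n v q) (σ : CH k m n v q →ₗ[k] CH k m n v q)
    (d : ∀ Λ : Multipartition m n, StdTableau Λ → Equiv.Perm (Fin n))
    {Λ : Multipartition m n} (s t : StdTableau Λ) : CH k m n v q :=
  σ (aw (d Λ s)) * mlam k m n v q aw Λ * aw (d Λ t)

/-- `σ` is the `*` anti-involution: the `k`-linear anti-automorphism fixing the generators. -/
def IsStar [NeZero n] (σ : CH k m n v q →ₗ[k] CH k m n v q) : Prop :=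
  σ 1 = 1 ∧ (∀ x y, σ (x * y) = σ y * σ x) ∧ ∀ t, t < n → σ (gen k m n v q t) = gen k m n v q t

/-- The set of elements `m_{uv}`, for `u, v` standard tableaux of a common shape `M ▷ Λ`. -/
def IsetSet [NeZero n] (aw : Equiv.Perm (Fin n) → CH k m n v q)
    (σ : CH k m n v q →ₗ[k] CH k m n v q)
    (d : ∀ Λ : Multipartition m n, StdTableau Λ → Equiv.Perm (Fin n))
    (Λ : Multipartition m n) : Set (CH k m n v q) :=
  {x | ∃ (M : Multipartition m n) (_ : M.StrictDom Λ) (u v' : StdTableau M),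
    x = mst k m n v q aw σ d u v'}

/-- `I_Λ`, the `k`-span of the `m_{uv}` with shape strictly dominating `Λ`. -/
def Ilam [NeZero n] (aw : Equiv.Perm (Fin n) → CH k m n v q)
    (σ : CH k m n v q →ₗ[k] CH k m n v q)
    (d : ∀ Λ : Multipartition m n, StdTableau Λ → Equiv.Perm (Fin n))
    (Λ : Multipartition m n) : Submodule k (CH k m n v q) :=
  Submodule.span k (IsetSet k m n v q aw σ d Λ)

/-- The image `z_Λ h` of `m_Λ h` in the quotient `H_n / I_Λ`. -/
def zh [NeZero n] (aw : Equiv.Perm (Fin n) → CH k m n v q)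
    (σ : CH k m n v q →ₗ[k] CH k m n v q)
    (d : ∀ Λ : Multipartition m n, StdTableau Λ → Equiv.Perm (Fin n))
    (Λ : Multipartition m n) (h : CH k m n v q) :
    CH k m n v q ⧸ Ilam k m n v q aw σ d Λ :=
  Submodule.Quotient.mk (mlam k m n v q aw Λ * h)

/-- The Specht module `S^Λ = z_Λ ⬝ (H_n/I_Λ)`, as a `k`-submodule of `H_n / I_Λ`. -/
def Specht [NeZero n] (aw : Equiv.Perm (Fin n) → CH k m n v q)
    (σ : CH k m n v q →ₗ[k] CH k m n v q)
    (d : ∀ Λ : Multipartition m n, StdTableau Λ → Equiv.Perm (Fin n))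
    (Λ : Multipartition m n) :
    Submodule k (CH k m n v q ⧸ Ilam k m n v q aw σ d Λ) :=
  Submodule.span k (Set.range (zh k m n v q aw σ d Λ))

/-- The generator `z_Λ h` as an element of the Specht module. -/
def zhS [NeZero n] (aw : Equiv.Perm (Fin n) → CH k m n v q)
    (σ : CH k m n v q →ₗ[k] CH k m n v q)
    (d : ∀ Λ : Multipartition m n, StdTableau Λ → Equiv.Perm (Fin n))
    (Λ : Multipartition m n) (h : CH k m n v q) :
    Specht k m n v q aw σ d Λ :=
  ⟨zh k m n v q aw σ d Λ h, Submodule.subset_span ⟨h, rfl⟩⟩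


open CategoryTheory
open scoped TensorProduct PiTensorProduct

variable (a : ℕ) (p : Fin m → Fin a)

/-- The number of elements of the part `S_{i+1}` of the partition of the multiset
`{v_1,…,v_m}` encoded by `p`. -/
def partCard (i : Fin a) : ℕ := (Finset.univ.filter (fun j : Fin m => p j = i)).card

/-- The parameters (with multiplicity) lying in the part `S_{i+1}`. -/
def partParams (i : Fin a) : Fin (partCard m a p i) → k := fun t =>
  v (((Finset.univ.filter (fun j : Fin m => p j = i)).orderIsoOfFin rfl t : Fin m))

/-- The tuples `(n_1, …, n_a)` of nonnegative integers with `n_1 + ⋯ + n_a = n`. -/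
def Tuples : Type := {t : Fin a → ℕ // ∑ i, t i = n}

/-- The algebra `∏_{n_1+⋯+n_a=n} H_{n_1}(S_1;q) ⊗_k ⋯ ⊗_k H_{n_a}(S_a;q)`. -/
def TargetAlg : Type :=
  Π t : Tuples n a, ⨂[k] i : Fin a, CH k (partCard m a p i) (t.1 i) (partParams k m v a p i) q

instance : Ring (TargetAlg k m n v q a p) :=
  inferInstanceAs (Ring (Π t : Tuples n a,
    ⨂[k] i : Fin a, CH k (partCard m a p i) (t.1 i) (partParams k m v a p i) q))

instance : Algebra k (TargetAlg k m n v q a p) :=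
  inferInstanceAs (Algebra k (Π t : Tuples n a,
    ⨂[k] i : Fin a, CH k (partCard m a p i) (t.1 i) (partParams k m v a p i) q))

/-- The category of finite-dimensional right `A`-modules (as left modules over `Aᵐᵒᵖ`). -/
abbrev FDM (A : Type) [Ring A] [Algebra k A] :=
  ObjectProperty.FullSubcategory (fun M : ModuleCat Aᵐᵒᵖ => @FiniteDimensional k (RestrictScalars k Aᵐᵒᵖ M) _ _
    (RestrictScalars.module k Aᵐᵒᵖ M))

/-- Scalar multiplication by `c ∈ k` (via the central image of `k`) as an endomorphism of
a module `M`;  a functor is `k`-linear precisely when it intertwines these morphisms. -/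
def cmul {A : Type} [Ring A] [Algebra k A] (c : k) (M : ModuleCat A) : M ⟶ M := ModuleCat.ofHom {
  toFun x := algebraMap k A c • x
  map_add' x y := smul_add _ _ _
  map_smul' b x := by
    simp only [RingHom.id_apply]
    rw [← mul_smul, ← mul_smul, Algebra.commutes] }

set_option linter.all false

section Morita

universe uu ww

/-- Finite-dimensionality over `F` of an `R`-module. -/
abbrev FDp (F : Type) [Field F] (R : Type) [Ring R] [Algebra F R] (M : Type uu)
    [AddCommGroup M] [Module R M] : Prop :=
  @FiniteDimensional F (RestrictScalars F R M) _ _ (RestrictScalars.module F R M)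

/-- Finite-dimensional left modules. -/
abbrev FL (F : Type) [Field F] (R : Type) [Ring R] [Algebra F R] :=
  ObjectProperty.FullSubcategory (fun M : ModuleCat.{uu} R =>
    @FiniteDimensional F (RestrictScalars F R M) _ _ (RestrictScalars.module F R M))

variable {F : Type} [Field F] {R S : Type} [Ring R] [Algebra F R] [Ring S] [Algebra F S]

/-- The `F`-module structure on an `R`-module. -/
abbrev fmod (F : Type) [Field F] (R : Type) [Ring R] [Algebra F R] (M : Type uu)
    [AddCommGroup M] [Module R M] : Module F M := Module.compHom M (algebraMap F R)

theorem fdp_iff (M : Type uu) [AddCommGroup M] [Module R M] :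
    FDp F R M ↔ @FiniteDimensional F M _ _ (fmod F R M) := Iff.rfl

theorem fd_of_inj {ι : Type} [Finite ι] {M : Type uu} [AddCommGroup M] [Module R M]
    {N : Type ww} [AddCommGroup N] [Module S N]
    (hN : FDp F S N)
    (f : M →+ (ι → N)) (hf : Function.Injective f)
    (hc : ∀ (c : F) (x : M) (i : ι), f (algebraMap F R c • x) i = algebraMap F S c • f x i) :
    FDp F R M := by
  rw [fdp_iff] at *
  let i1 := fmod F R M
  let i2 := fmod F S N
  let g : M →ₗ[F] (ι → N) :=
    { toFun := fun x => f x
      map_add' := fun x y => f.map_add x y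
      map_smul' := fun c x => by
        funext i
        exact hc c x i }
  exact FiniteDimensional.of_injective g hf

theorem small_of_fd (M : Type uu) [AddCommGroup M] [Module R M]
    (hM : FDp F R M) : Small.{ww} M := by
  rw [fdp_iff] at *
  let i1 := fmod F R M
  let e := (Module.finBasis F M).equivFun.toEquiv
  have h0 : Small.{ww} (Fin (Module.finrank F M) → F) := inferInstance
  exact (small_congr e).2 h0

variable (ψ : S →ₙₐ[F] R)

/-- The fixed points of the idempotent. -/
def Cor (M : Type uu) [AddCommGroup M] [Module R M] : AddSubgroup M where
  carrier := {x | ψ 1 • x = x}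
  add_mem' := by
    intro a b ha hb
    simp only [Set.mem_ofPred_eq] at *
    rw [smul_add, ha, hb]
  zero_mem' := smul_zero _
  neg_mem' := by
    intro a ha
    simp only [Set.mem_ofPred_eq] at *
    rw [smul_neg, ha]

theorem psi_one_mul (s : S) : ψ 1 * ψ s = ψ s := by rw [← map_mul, one_mul]
theorem psi_mul_one (s : S) : ψ s * ψ 1 = ψ s := by rw [← map_mul, mul_one]

instance corModule (M : Type uu) [AddCommGroup M] [Module R M] : Module S (Cor ψ M) where
  smul s x := ⟨ψ s • x.1, by
    change ψ 1 • ψ s • x.1 = ψ s • x.1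
    rw [← mul_smul, psi_one_mul]⟩
  one_smul x := Subtype.ext x.2
  mul_smul s t x := Subtype.ext (by
    change ψ (s * t) • x.1 = ψ s • ψ t • x.1
    rw [map_mul, mul_smul])
  smul_zero s := Subtype.ext (smul_zero _)
  smul_add s x y := Subtype.ext (smul_add _ _ _)
  add_smul s t x := Subtype.ext (by
    change ψ (s + t) • x.1 = ψ s • x.1 + ψ t • x.1
    rw [map_add, add_smul])
  zero_smul x := Subtype.ext (by
    change ψ 0 • x.1 = 0
    rw [map_zero, zero_smul])

theorem cor_smul_val (M : Type uu) [AddCommGroup M] [Module R M] (s : S) (x : Cor ψ M) :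
    ((s • x : Cor ψ M) : M) = ψ s • (x : M) := rfl

theorem psi_algebraMap_smul (M : Type uu) [AddCommGroup M] [Module R M] (c : F) (x : Cor ψ M) :
    ψ (algebraMap F S c) • (x : M) = algebraMap F R c • (x : M) := by
  have : ψ (algebraMap F S c) = algebraMap F R c * ψ 1 := by
    rw [Algebra.algebraMap_eq_smul_one, map_smul, Algebra.smul_def]
  rw [this, mul_smul]
  congr 1
  exact x.2

theorem cor_fd (M : Type uu) [AddCommGroup M] [Module R M]
    (hM : FDp F R M) :
    FDp F S (Cor ψ M) := by
  refine fd_of_inj (ι := Unit) (S := R) (N := M) hM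
    { toFun := fun x _ => x.1, map_zero' := rfl, map_add' := fun _ _ => rfl } ?_ ?_
  · intro x y h
    exact Subtype.ext (congrFun h ())
  · intro c x _
    exact psi_algebraMap_smul ψ M c x

/-- Restriction of a linear map to fixed points. -/
def corMap {M N : Type uu} [AddCommGroup M] [Module R M] [AddCommGroup N] [Module R N]
    (f : M →ₗ[R] N) : Cor ψ M →ₗ[S] Cor ψ N where
  toFun x := ⟨f x.1, by
    change ψ 1 • f x.1 = f x.1
    rw [← map_smul]
    congr 1
    exact x.2⟩
  map_add' x y := Subtype.ext (map_add f _ _)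
  map_smul' s x := Subtype.ext (map_smul f _ _)

/-- A fully faithful functor `M ↦ e M`, with universe change. -/
def corFunctor : FL.{uu} F R ⥤ FL.{ww} F S where
  obj X :=
    haveI : Small.{ww} (Cor ψ X.obj) := small_of_fd (F := F) (R := S) _ (cor_fd ψ X.obj X.property)
    ⟨ModuleCat.of S (Shrink.{ww} (Cor ψ X.obj)), by
      refine fd_of_inj (ι := Unit) (S := S) (N := Cor ψ X.obj) (cor_fd ψ X.obj X.property)
        { toFun := fun x _ => Shrink.linearEquiv S _ x, map_zero' := by simp; rfl, map_add' := fun _ _ => by simp; rfl } ?_ ?_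
      · intro x y h
        exact (Shrink.linearEquiv S _).injective (congrFun h ())
      · intro c x _
        exact map_smul (Shrink.linearEquiv S (Cor ψ X.obj)) _ _⟩
  map {X Y} f :=
    haveI : Small.{ww} (Cor ψ X.obj) := small_of_fd (F := F) (R := S) _ (cor_fd ψ X.obj X.property)
    haveI : Small.{ww} (Cor ψ Y.obj) := small_of_fd (F := F) (R := S) _ (cor_fd ψ Y.obj Y.property)
    ObjectProperty.homMk (ModuleCat.ofHom
      ((Shrink.linearEquiv S (Cor ψ Y.obj)).symm.toLinearMap ∘ₗ corMap ψ f.hom.hom ∘ₗ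
        (Shrink.linearEquiv S (Cor ψ X.obj)).toLinearMap))
  map_id X := by
    ext x
    simp [corMap]
  map_comp f g := by
    ext x
    simp [corMap]

end Morita

section Morita2

universe uu ww

variable {F : Type} [Field F] {R S : Type} [Ring R] [Algebra F R] [Ring S] [Algebra F S]
variable (ψ : S →ₙₐ[F] R)

/-- `ψ` identifies `S` with the corner ring of a full idempotent of `R`. -/
structure IsFullCorner : Prop where
  inj : Function.Injective ψ
  surj : ∀ r : R, ∃ s : S, ψ s = ψ 1 * r * ψ 1
  full : ∃ (ι : Type) (_ : Fintype ι) (u v : ι → R), ∑ i, u i * ψ 1 * v i = 1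

variable {ψ}

/-- Element of the corner -/
def toCor {M : Type uu} [AddCommGroup M] [Module R M] (r : R) (x : M) : Cor ψ M :=
  ⟨ψ 1 • r • x, by
    change ψ 1 • ψ 1 • r • x = ψ 1 • r • x
    rw [← mul_smul, psi_one_mul]⟩

theorem cor_sum {ι : Type} [Fintype ι] {u v : ι → R} (huv : ∑ i, u i * ψ 1 * v i = 1)
    {M : Type uu} [AddCommGroup M] [Module R M] (x : M) :
    x = ∑ i, u i • (toCor (ψ := ψ) (v i) x : M) := by
  conv_lhs => rw [← one_smul R x, ← huv, Finset.sum_smul]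
  refine Finset.sum_congr rfl fun i _ => ?_
  simp only [toCor, mul_smul]

theorem corMap_inj (h : IsFullCorner ψ) {M N : Type uu} [AddCommGroup M] [Module R M]
    [AddCommGroup N] [Module R N] (f g : M →ₗ[R] N) (hfg : corMap ψ f = corMap ψ g) : f = g := by
  obtain ⟨ι, _, u, v, huv⟩ := h.full
  ext x
  rw [cor_sum huv x, map_sum, map_sum]
  refine Finset.sum_congr rfl fun i _ => ?_
  rw [map_smul, map_smul]
  congr 1
  exact congrArg Subtype.val (LinearMap.congr_fun hfg (toCor (v i) x))

theorem corMap_surj (h : IsFullCorner ψ) {M N : Type uu} [AddCommGroup M] [Module R M]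
    [AddCommGroup N] [Module R N] (g : Cor ψ M →ₗ[S] Cor ψ N) :
    ∃ f : M →ₗ[R] N, corMap ψ f = g := by
  obtain ⟨ι, _, u, v, huv⟩ := h.full
  have key : ∀ (r : R) (x : Cor ψ M), (g (toCor r (x : M)) : N) = ψ 1 • r • (g x : N) := by
    intro r x
    obtain ⟨s, hs⟩ := h.surj r
    have h1 : toCor r (x : M) = s • x := by
      apply Subtype.ext
      rw [cor_smul_val, hs]
      simp only [toCor, mul_smul]
      congr 2
      exact x.2.symm
    rw [h1, map_smul, cor_smul_val, hs]
    simp only [mul_smul]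
    congr 2
    exact (g x).2
  let f : M →ₗ[R] N :=
    { toFun := fun x => ∑ i, u i • (g (toCor (v i) x) : N)
      map_add' := by
        intro x y
        rw [← Finset.sum_add_distrib]
        refine Finset.sum_congr rfl fun i _ => ?_
        rw [← smul_add]
        congr 1
        rw [← AddSubgroup.coe_add, ← map_add]
        congr 2
        apply Subtype.ext
        simp [toCor]
      map_smul' := by
        intro r x
        simp only [RingHom.id_apply]
        have h1 : ∀ i, toCor (ψ := ψ) (v i) (r • x) =
            ∑ j, toCor (ψ := ψ) (v i * r * u j) (toCor (ψ := ψ) (v j) x : M) := by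
          intro i
          apply Subtype.ext
          rw [AddSubgroup.val_finsetSum]
          conv_lhs => rw [cor_sum huv x]
          simp only [toCor, Finset.smul_sum, mul_smul]
        simp only [h1, map_sum, AddSubgroup.val_finsetSum, key]
        simp only [Finset.smul_sum]
        rw [Finset.sum_comm]
        refine Finset.sum_congr rfl fun j _ => ?_
        conv_rhs => rw [cor_sum huv (r • u j • (g (toCor (v j) x) : N))]
        refine Finset.sum_congr rfl fun i _ => ?_
        simp only [toCor, mul_smul] }
  refine ⟨f, ?_⟩
  ext x
  change ∑ i, u i • (g (toCor (v i) (x : M)) : N) = (g x : N)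
  conv_rhs => rw [cor_sum huv (g x : N)]
  refine Finset.sum_congr rfl fun i _ => ?_
  rw [key]
  rfl

variable (ψ) in
/-- Coinduced module -/
def Coind (N : Type uu) [AddCommGroup N] [Module S N] : Type uu := Cor ψ R →ₗ[S] N

instance (N : Type uu) [AddCommGroup N] [Module S N] : AddCommGroup (Coind ψ N) :=
  inferInstanceAs (AddCommGroup (Cor ψ R →ₗ[S] N))

/-- underlying linear map -/
def clin {N : Type uu} [AddCommGroup N] [Module S N] (f : Coind ψ N) : Cor ψ R →ₗ[S] N := f

variable (ψ) in
/-- right multiplication on `eR`. -/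
def corR (r : R) : Cor ψ R →ₗ[S] Cor ψ R where
  toFun y := ⟨(y : R) * r, by
    change ψ 1 * (y.1 * r) = y.1 * r
    rw [← mul_assoc]
    congr 1
    exact y.2⟩
  map_add' x y := Subtype.ext (add_mul _ _ _)
  map_smul' s x := Subtype.ext (mul_assoc _ _ _)

theorem corR_mul (r s : R) (y : Cor ψ R) : corR ψ (r * s) y = corR ψ s (corR ψ r y) :=
  Subtype.ext (mul_assoc _ _ _).symm

instance (N : Type uu) [AddCommGroup N] [Module S N] : Module R (Coind ψ N) where
  smul r f := LinearMap.comp (clin f) (corR ψ r)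
  one_smul f := by
    apply LinearMap.ext
    intro y
    have h : corR ψ 1 y = y := Subtype.ext (mul_one _)
    exact (congrArg (clin f) h :)
  mul_smul r s f := by
    apply LinearMap.ext
    intro y
    exact (congrArg (clin f) (corR_mul r s y) :)
  smul_zero r := rfl
  smul_add r f g := rfl
  add_smul r s f := by
    apply LinearMap.ext
    intro y
    refine Eq.trans ?_ (map_add (clin f) _ _)
    exact congrArg (clin f) (Subtype.ext (mul_add _ _ _))
  zero_smul f := by
    apply LinearMap.ext
    intro y
    refine Eq.trans ?_ (map_zero (clin f))
    exact congrArg (clin f) (Subtype.ext (mul_zero _))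

/-- evaluation -/
def cev {N : Type uu} [AddCommGroup N] [Module S N] (f : Coind ψ N) (y : Cor ψ R) : N :=
  clin f y

theorem cev_smul {N : Type uu} [AddCommGroup N] [Module S N] (r : R) (f : Coind ψ N)
    (y : Cor ψ R) : cev (r • f) y = cev f (corR ψ r y) := rfl

theorem cev_map_smul {N : Type uu} [AddCommGroup N] [Module S N] (s : S) (f : Coind ψ N)
    (y : Cor ψ R) : cev f (s • y) = s • cev f y := map_smul (clin f) _ _

theorem cev_ext {N : Type uu} [AddCommGroup N] [Module S N] (f g : Coind ψ N)
    (h : ∀ y, cev f y = cev g y) : f = g := LinearMap.ext h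

theorem cev_eq {N : Type uu} [AddCommGroup N] [Module S N] (f : Coind ψ N) {y z : Cor ψ R}
    (h : (y : R) = z) : cev f y = cev f z := by
  rw [Subtype.ext h]

theorem cev_algebraMap {N : Type uu} [AddCommGroup N] [Module S N] (c : F) (f : Coind ψ N)
    (y : Cor ψ R) : cev (algebraMap F R c • f) y = algebraMap F S c • cev f y := by
  rw [cev_smul, ← cev_map_smul]
  apply cev_eq
  change (y : R) * algebraMap F R c = ψ (algebraMap F S c) • (y : R)
  rw [psi_algebraMap_smul ψ R c y, smul_eq_mul, Algebra.commutes]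

theorem coind_fd (h : IsFullCorner ψ) (N : Type uu) [AddCommGroup N] [Module S N]
    (hN : FDp F S N) : FDp F R (Coind ψ N) := by
  obtain ⟨ι, _, u, v, huv⟩ := h.full
  refine fd_of_inj (ι := ι) (S := S) (N := N) hN
    { toFun := fun f i => cev f (toCor (v i) (1 : R)), map_zero' := rfl,
      map_add' := fun _ _ => rfl } ?_ ?_
  · intro f g hfg
    apply cev_ext
    intro y
    have hy : y = ∑ i, (h.surj ((y : R) * u i)).choose • toCor (ψ := ψ) (v i) (1 : R) := by
      apply Subtype.ext
      rw [AddSubgroup.val_finsetSum]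
      have : ∀ i, (((h.surj ((y : R) * u i)).choose • toCor (ψ := ψ) (v i) (1 : R) : Cor ψ R) : R)
          = (y : R) * (u i * ψ 1 * v i) := by
        intro i
        rw [cor_smul_val, (h.surj ((y : R) * u i)).choose_spec]
        have hy : ψ 1 * (y : R) = y := y.2
        simp only [toCor, smul_eq_mul, mul_one]
        rw [← mul_assoc (ψ 1) (y : R), hy]
        have h1 : ψ 1 * ψ 1 = ψ 1 := psi_one_mul ψ 1
        simp only [mul_assoc]
        rw [← mul_assoc (ψ 1) (ψ 1), h1]
      simp only [this]
      rw [← Finset.mul_sum, huv, mul_one]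
    rw [hy]
    have hs : ∀ f : Coind ψ N, cev f (∑ i, (h.surj ((y : R) * u i)).choose •
        toCor (ψ := ψ) (v i) (1 : R)) = ∑ i, (h.surj ((y : R) * u i)).choose • cev f
        (toCor (ψ := ψ) (v i) (1 : R)) := by
      intro f
      refine (map_sum (clin f) _ _).trans ?_
      refine Finset.sum_congr rfl fun i _ => cev_map_smul _ _ _
    rw [hs, hs]
    refine Finset.sum_congr rfl fun i _ => ?_
    congr 1
    exact congrFun hfg i
  · intro c f i
    exact cev_algebraMap c f _

/-- The unit in the corner. -/
def corOne : Cor ψ R := ⟨ψ 1, psi_one_mul ψ 1⟩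

theorem exists_corEquiv (h : IsFullCorner ψ) (N : Type uu) [AddCommGroup N] [Module S N] :
    Nonempty (Cor ψ (Coind ψ N) ≃ₗ[S] N) := by
  choose σ hσ using h.surj
  have hσ' : ∀ s, σ (ψ s) = s := by
    intro s
    apply h.inj
    rw [hσ, psi_one_mul, psi_mul_one]
  let g : Cor ψ (Coind ψ N) →ₗ[S] N :=
    { toFun := fun f => cev (f : Coind ψ N) corOne
      map_add' := fun _ _ => rfl
      map_smul' := by
        intro s f
        change cev (ψ s • (f : Coind ψ N)) corOne = s • cev (f : Coind ψ N) corOne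
        rw [cev_smul, ← cev_map_smul]
        apply cev_eq
        change ψ 1 * ψ s = ψ s * ψ 1
        rw [psi_one_mul, psi_mul_one] }
  refine ⟨LinearEquiv.ofBijective g ⟨?_, ?_⟩⟩
  · intro f f' hff
    apply Subtype.ext
    apply cev_ext
    intro y
    have hf : ∀ f : Cor ψ (Coind ψ N), cev (f : Coind ψ N) y = σ y • g f := by
      intro f
      change _ = σ y • cev (f : Coind ψ N) corOne
      rw [← cev_map_smul]
      have h1 : (f : Coind ψ N) = ψ 1 • (f : Coind ψ N) := f.2.symm
      rw [h1, cev_smul, cev_smul]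
      apply cev_eq
      change (y : R) * ψ 1 = (ψ (σ y) * ψ 1) * ψ 1
      rw [hσ]
      have h1 : ψ 1 * ψ 1 = ψ 1 := psi_one_mul ψ 1
      have hy : ψ 1 * (y : R) = y := y.2
      rw [hy, mul_assoc, mul_assoc, h1, h1]
    rw [hf, hf, hff]
  · intro x
    let f : Cor ψ R →ₗ[S] N :=
      { toFun := fun y => σ y • x
        map_add' := by
          intro y z
          rw [← add_smul]
          congr 1
          apply h.inj
          rw [map_add, hσ, hσ, hσ, AddSubgroup.coe_add, mul_add, add_mul]
        map_smul' := by
          intro s y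
          simp only [RingHom.id_apply]
          rw [← mul_smul]
          congr 1
          apply h.inj
          rw [map_mul, hσ, hσ, cor_smul_val, smul_eq_mul]
          have h1 : ∀ s, ψ 1 * ψ s = ψ s := psi_one_mul ψ
          have h2 : ∀ s, ψ s * ψ 1 = ψ s := psi_mul_one ψ
          rw [← mul_assoc, ← mul_assoc, ← mul_assoc, h1, h2] }
    refine ⟨⟨f, ?_⟩, ?_⟩
    · let f' : Coind ψ N := f
      change ψ 1 • f' = f'
      apply cev_ext
      intro y
      rw [cev_smul]
      change σ ((y : R) * ψ 1) • x = σ y • x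
      congr 1
      apply h.inj
      have h1 : ψ 1 * ψ 1 = ψ 1 := psi_one_mul ψ 1
      rw [hσ, hσ, mul_assoc, mul_assoc, h1, mul_assoc]
    · change σ (ψ 1) • x = x
      rw [hσ', one_smul]

theorem corFunctor_faithful (h : IsFullCorner ψ) :
    (corFunctor.{uu, ww} ψ).Faithful where
  map_injective {X Y f g} hfg := by
    have i1 : Small.{ww} (Cor ψ X.obj) :=
      small_of_fd (F := F) (R := S) _ (cor_fd ψ X.obj X.property)
    have i2 : Small.{ww} (Cor ψ Y.obj) :=
      small_of_fd (F := F) (R := S) _ (cor_fd ψ Y.obj Y.property)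
    have h1 : corMap ψ f.hom.hom = corMap ψ g.hom.hom := by
      ext1 x
      have h2 := congrArg (fun t => t.hom.hom ((Shrink.linearEquiv S (Cor ψ X.obj)).symm x)) hfg
      have h4 : (Shrink.linearEquiv S (Cor ψ Y.obj)).symm (corMap ψ f.hom.hom
          (Shrink.linearEquiv S (Cor ψ X.obj) ((Shrink.linearEquiv S (Cor ψ X.obj)).symm x))) =
          (Shrink.linearEquiv S (Cor ψ Y.obj)).symm (corMap ψ g.hom.hom
          (Shrink.linearEquiv S (Cor ψ X.obj) ((Shrink.linearEquiv S (Cor ψ X.obj)).symm x))) := h2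
      rw [LinearEquiv.apply_symm_apply] at h4
      exact (Shrink.linearEquiv S (Cor ψ Y.obj)).symm.injective h4
    have h3 := corMap_inj h _ _ h1
    ext x
    rw [h3]

theorem corFunctor_full (h : IsFullCorner ψ) :
    (corFunctor.{uu, ww} ψ).Full where
  map_surjective {X Y} g := by
    have i1 : Small.{ww} (Cor ψ X.obj) :=
      small_of_fd (F := F) (R := S) _ (cor_fd ψ X.obj X.property)
    have i2 : Small.{ww} (Cor ψ Y.obj) :=
      small_of_fd (F := F) (R := S) _ (cor_fd ψ Y.obj Y.property)
    let g' : Shrink.{ww} (Cor ψ X.obj) →ₗ[S] Shrink.{ww} (Cor ψ Y.obj) := g.hom.hom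
    obtain ⟨f, hf⟩ := corMap_surj h ((Shrink.linearEquiv S (Cor ψ Y.obj)).toLinearMap ∘ₗ g' ∘ₗ
      (Shrink.linearEquiv S (Cor ψ X.obj)).symm.toLinearMap)
    refine ⟨ObjectProperty.homMk (ModuleCat.ofHom f), ?_⟩
    ext x
    change (Shrink.linearEquiv S (Cor ψ Y.obj)).symm (corMap ψ f
      (Shrink.linearEquiv S (Cor ψ X.obj) x)) = g' x
    rw [hf]
    simp only [LinearMap.comp_apply, LinearEquiv.coe_coe]
    rw [LinearEquiv.symm_apply_apply]
    exact congrArg g' (LinearEquiv.symm_apply_apply (Shrink.linearEquiv S (Cor ψ X.obj)) x)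

theorem corFunctor_essSurj (h : IsFullCorner ψ) :
    (corFunctor.{uu, ww} ψ).EssSurj where
  mem_essImage Y := by
    have hfd : FDp F R (Coind ψ Y.obj) := coind_fd h Y.obj Y.property
    have i1 : Small.{uu} (Coind ψ Y.obj) := small_of_fd (F := F) (R := R) _ hfd
    have hfd2 : FDp F R (Shrink.{uu} (Coind ψ Y.obj)) := by
      refine fd_of_inj (ι := Unit) (S := R) (N := Coind ψ Y.obj) hfd
        { toFun := fun x _ => Shrink.linearEquiv R _ x, map_zero' := by simp; rfl,
          map_add' := fun _ _ => by simp; rfl } ?_ ?_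
      · intro x y h
        exact (Shrink.linearEquiv R _).injective (congrFun h ())
      · intro c x _
        exact map_smul (Shrink.linearEquiv R (Coind ψ Y.obj)) _ _
    let X : FL.{uu} F R := ⟨ModuleCat.of R (Shrink.{uu} (Coind ψ Y.obj)), hfd2⟩
    have i2 : Small.{ww} (Cor ψ X.obj) :=
      small_of_fd (F := F) (R := S) _ (cor_fd ψ X.obj X.property)
    obtain ⟨e⟩ := exists_corEquiv h Y.obj
    let e1 : Cor ψ X.obj ≃ₗ[S] Cor ψ (Coind ψ Y.obj) :=
      { toFun := fun x => ⟨Shrink.linearEquiv R (Coind ψ Y.obj) x.1, by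
          change ψ 1 • (Shrink.linearEquiv R (Coind ψ Y.obj) x.1) = _
          rw [← map_smul]
          congr 1
          exact x.2⟩
        map_add' := fun x y => Subtype.ext (map_add (Shrink.linearEquiv R (Coind ψ Y.obj)) x.1 y.1)
        map_smul' := fun s x => Subtype.ext
          (map_smul (Shrink.linearEquiv R (Coind ψ Y.obj)) (ψ s) x.1)
        invFun := fun x => ⟨(Shrink.linearEquiv R (Coind ψ Y.obj)).symm x.1, by
          change ψ 1 • ((Shrink.linearEquiv R (Coind ψ Y.obj)).symm x.1) = _
          rw [← map_smul]
          congr 1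
          exact x.2⟩
        left_inv := fun x => Subtype.ext ((Shrink.linearEquiv R (Coind ψ Y.obj)).left_inv x.1)
        right_inv := fun x => Subtype.ext ((Shrink.linearEquiv R (Coind ψ Y.obj)).right_inv x.1) }
    let e2 : Shrink.{ww} (Cor ψ X.obj) ≃ₗ[S] Y.obj :=
      (Shrink.linearEquiv S (Cor ψ X.obj)).trans (e1.trans e)
    exact ⟨X, ⟨(ObjectProperty.isoMk _ e2.toModuleIso : (corFunctor.{uu, ww} ψ).obj X ≅ Y)⟩⟩

theorem morita_left (h : IsFullCorner ψ) :
    ∃ e : FL.{uu} F R ≌ FL.{ww} F S,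
      (∀ (X Y : FL.{uu} F R) (f g : X ⟶ Y),
        e.functor.map (f + g) = e.functor.map f + e.functor.map g) ∧
      (∀ (c : F) (X : FL.{uu} F R),
        e.functor.map (ObjectProperty.homMk (cmul F c X.obj)) =
          ObjectProperty.homMk (cmul F c (e.functor.obj X).obj)) := by
  have i1 := corFunctor_faithful.{uu, ww} h
  have i2 := corFunctor_full.{uu, ww} h
  have i3 := corFunctor_essSurj.{uu, ww} h
  have i4 : (corFunctor.{uu, ww} ψ).IsEquivalence := {}
  refine ⟨(corFunctor.{uu, ww} ψ).asEquivalence, ?_, ?_⟩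
  · intro X Y f g
    have i1 : Small.{ww} (Cor ψ X.obj) :=
      small_of_fd (F := F) (R := S) _ (cor_fd ψ X.obj X.property)
    have i2 : Small.{ww} (Cor ψ Y.obj) :=
      small_of_fd (F := F) (R := S) _ (cor_fd ψ Y.obj Y.property)
    ext x
    change (Shrink.linearEquiv S (Cor ψ Y.obj)).symm (corMap ψ (f.hom.hom + g.hom.hom)
      (Shrink.linearEquiv S (Cor ψ X.obj) x)) =
      (Shrink.linearEquiv S (Cor ψ Y.obj)).symm (corMap ψ (f.hom.hom)
      (Shrink.linearEquiv S (Cor ψ X.obj) x)) + (Shrink.linearEquiv S (Cor ψ Y.obj)).symm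
      (corMap ψ (g.hom.hom) (Shrink.linearEquiv S (Cor ψ X.obj) x))
    rw [← map_add]
    rfl
  · intro c X
    have i1 : Small.{ww} (Cor ψ X.obj) :=
      small_of_fd (F := F) (R := S) _ (cor_fd ψ X.obj X.property)
    ext x
    change (Shrink.linearEquiv S (Cor ψ X.obj)).symm (corMap ψ (cmul F c X.obj).hom
      (Shrink.linearEquiv S (Cor ψ X.obj) x)) = algebraMap F S c • (show Shrink.{ww} (Cor ψ X.obj) from x)
    rw [LinearEquiv.symm_apply_eq, map_smul]
    apply Subtype.ext
    exact (psi_algebraMap_smul ψ X.obj c _).symm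

/-- opposite of a corner embedding -/
def opCorner (ψ : S →ₙₐ[F] R) : Sᵐᵒᵖ →ₙₐ[F] Rᵐᵒᵖ where
  toFun s := MulOpposite.op (ψ s.unop)
  map_smul' c s := by simp
  map_zero' := by simp
  map_add' s t := by simp
  map_mul' s t := by simp

theorem morita_right (h : IsFullCorner ψ) :
    ∃ e : FDM.{uu} F R ≌ FDM.{ww} F S,
      (∀ (X Y : FDM.{uu} F R) (f g : X ⟶ Y),
        e.functor.map (f + g) = e.functor.map f + e.functor.map g) ∧
      (∀ (c : F) (X : FDM.{uu} F R),
        e.functor.map (ObjectProperty.homMk (cmul F c X.obj)) =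
          ObjectProperty.homMk (cmul F c (e.functor.obj X).obj)) := by
  have h' : IsFullCorner (opCorner ψ) := by
    refine ⟨?_, ?_, ?_⟩
    · intro s t hst
      exact MulOpposite.unop_injective (h.inj (MulOpposite.op_injective hst))
    · intro r
      obtain ⟨s, hs⟩ := h.surj r.unop
      refine ⟨MulOpposite.op s, MulOpposite.unop_injective ?_⟩
      change ψ s = ψ 1 * (r.unop * ψ 1)
      rw [hs, mul_assoc]
    · obtain ⟨ι, i, u, v, huv⟩ := h.full
      refine ⟨ι, i, fun j => MulOpposite.op (v j), fun j => MulOpposite.op (u j), ?_⟩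
      apply MulOpposite.unop_injective
      rw [MulOpposite.unop_one, ← huv, Finset.unop_sum]
      refine Finset.sum_congr rfl fun j _ => ?_
      change u j * (ψ 1 * v j) = _
      rw [mul_assoc]
  exact morita_left h'

end Morita2

section Affine
variable {F A : Type*} [Field F] [Ring A] [Algebra F A]

/-- The local affine Hecke (Bernstein) relations. -/
structure Bern (q : F) (T x y : A) : Prop where
  tt : T * T = (q - 1) • T + q • (1 : A)
  xy : x * y = y * x
  tx : T * x = y * T - (q - 1) • y
  ty : T * y = x * T + (q - 1) • y

/-- The intertwiner. -/
def Ph (T x : A) : A := T * x - x * T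

theorem bern_of_tlt {q : F} (hq : q ≠ 0) {T x y : A} (tt : T * T = (q - 1) • T + q • (1 : A))
    (xy : x * y = y * x) (h : T * x * T = q • y) : Bern q T x y := by
  refine ⟨tt, xy, ?_, ?_⟩
  · have h1 : T * x * (T * T) = q • (y * T) := by
      rw [← mul_assoc, h, smul_mul_assoc]
    rw [tt, mul_add, mul_smul_comm, h, mul_smul_comm, mul_one, smul_smul, mul_comm, ← smul_smul,
      ← smul_add] at h1
    have h2 := smul_right_injective A hq h1
    rw [← h2]; abel
  · have h1 : (T * T) * x * T = q • (T * y) := by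
      rw [mul_assoc T T x, mul_assoc, h, mul_smul_comm]
    rw [tt, add_mul, add_mul, smul_mul_assoc, smul_mul_assoc, h, smul_mul_assoc, one_mul,
      smul_mul_assoc, smul_smul, mul_comm, ← smul_smul,
      ← smul_add] at h1
    have h2 := smul_right_injective A hq h1
    rw [← h2]; abel

theorem Bern.tlt {q : F} {T x y : A} (h : Bern q T x y) : T * x * T = q • y := by
  rw [h.tx, sub_mul, mul_assoc, h.tt]
  simp only [mul_add, mul_smul_comm, smul_mul_assoc, mul_one]
  module

theorem Bern.xT {q : F} {T x y : A} (h : Bern q T x y) : x * T = T * y - (q - 1) • y := by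
  rw [h.ty]; abel
theorem Bern.yT {q : F} {T x y : A} (h : Bern q T x y) : y * T = T * x + (q - 1) • y := by
  rw [h.tx]; abel

theorem assoc3 {a b c : A} (h : a * b = c) (z : A) : a * (b * z) = c * z := by
  rw [← mul_assoc, h]

theorem Bern.ph_eq {q : F} {T x y : A} (h : Bern q T x y) :
    Ph T x = T * (x - y) + (q - 1) • y := by
  rw [Ph, h.xT, mul_sub]; abel

theorem Bern.ph_eq' {q : F} {T x y : A} (h : Bern q T x y) :
    Ph T x = y * T - T * y := by
  rw [Ph, h.xT, h.yT]; abel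

theorem Bern.ph_x {q : F} {T x y : A} (h : Bern q T x y) : Ph T x * x = y * Ph T x := by
  have e1 := h.xT; have e2 := h.yT; have e4 := h.xy.symm
  rw [h.ph_eq]
  simp only [mul_add, add_mul, mul_sub, sub_mul, smul_mul_assoc, mul_smul_comm, mul_assoc,
    e1, e2, e4, assoc3 e1, assoc3 e2, assoc3 e4]
  module

theorem Bern.ph_y {q : F} {T x y : A} (h : Bern q T x y) : Ph T x * y = x * Ph T x := by
  have e1 := h.xT; have e2 := h.yT; have e4 := h.xy.symm
  rw [h.ph_eq]
  simp only [mul_add, add_mul, mul_sub, sub_mul, smul_mul_assoc, mul_smul_comm, mul_assoc,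
    e1, e2, e4, assoc3 e1, assoc3 e2, assoc3 e4]
  module

theorem ph_comm {T x z : A} (h1 : z * T = T * z) (h2 : z * x = x * z) :
    z * Ph T x = Ph T x * z := by
  rw [Ph, mul_sub, sub_mul]
  simp only [mul_assoc, h1, h2, assoc3 h1, assoc3 h2]

theorem Bern.ph_sq {q : F} {T x y : A} (h : Bern q T x y) :
    Ph T x * Ph T x = (q • x - y) * (q • y - x) := by
  obtain ⟨r, rfl⟩ : ∃ r, q = r + 1 := ⟨q - 1, by ring⟩
  have e1 := h.xT; have e2 := h.yT; have e3 := h.tt; have e4 := h.xy.symm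
  rw [add_sub_cancel_right] at e1 e2 e3
  rw [h.ph_eq]
  simp only [mul_add, add_mul, mul_sub, sub_mul, smul_mul_assoc, mul_smul_comm, mul_assoc,
    e1, e2, e3, e4, assoc3 e1, assoc3 e2, assoc3 e3, assoc3 e4, add_sub_cancel_right, mul_one,
    one_mul, smul_add, smul_sub, smul_smul]
  module

/-- Three-strand data without the braid relation. -/
structure Bern3 (q : F) (T1 T2 x y z : A) : Prop where
  b1 : Bern q T1 x y
  b2 : Bern q T2 y z
  c1 : T1 * z = z * T1
  c2 : T2 * x = x * T2
  xz : x * z = z * x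

/-- The defect of the braid relation. -/
def Vd (T1 T2 : A) : A := T1 * T2 * T1 - T2 * T1 * T2

theorem Bern3.E1 {q : F} {T1 T2 x y z : A} (h : Bern3 q T1 T2 x y z) :
    T1 * (Ph T2 y * Ph T1 x) - Ph T2 y * Ph T1 x * T2 = Vd T1 T2 * ((x - y) * (x - z)) := by
  obtain ⟨r, rfl⟩ : ∃ r, q = r + 1 := ⟨q - 1, by ring⟩
  have e1 := h.b1.xT; have e2 := h.b1.yT; have e3 := h.b1.tt; have e4 := h.b1.xy.symm
  have f1 := h.b2.xT; have f2 := h.b2.yT; have f3 := h.b2.tt; have f4 := h.b2.xy.symm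
  have g1 := h.c1.symm; have g2 := h.c2.symm; have g3 := h.xz.symm
  rw [add_sub_cancel_right] at e1 e2 e3 f1 f2 f3
  rw [h.b1.ph_eq, h.b2.ph_eq, Vd]
  simp only [mul_add, add_mul, mul_sub, sub_mul, smul_mul_assoc, mul_smul_comm, mul_assoc,
    e1, e2, e3, e4, assoc3 e1, assoc3 e2, assoc3 e3, assoc3 e4,
    f1, f2, f3, f4, assoc3 f1, assoc3 f2, assoc3 f3, assoc3 f4,
    g1, g2, g3, assoc3 g1, assoc3 g2, assoc3 g3, add_sub_cancel_right, mul_one,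
    one_mul, smul_add, smul_sub, smul_smul]
  module

theorem Bern3.E2 {q : F} {T1 T2 x y z : A} (h : Bern3 q T1 T2 x y z) :
    Ph T1 x * Ph T2 y * T1 - T2 * (Ph T1 x * Ph T2 y) = Vd T1 T2 * ((x - z) * (y - z)) := by
  obtain ⟨r, rfl⟩ : ∃ r, q = r + 1 := ⟨q - 1, by ring⟩
  have e1 := h.b1.xT; have e2 := h.b1.yT; have e3 := h.b1.tt; have e4 := h.b1.xy.symm
  have f1 := h.b2.xT; have f2 := h.b2.yT; have f3 := h.b2.tt; have f4 := h.b2.xy.symm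
  have g1 := h.c1.symm; have g2 := h.c2.symm; have g3 := h.xz.symm
  rw [add_sub_cancel_right] at e1 e2 e3 f1 f2 f3
  rw [h.b1.ph_eq, h.b2.ph_eq, Vd]
  simp only [mul_add, add_mul, mul_sub, sub_mul, smul_mul_assoc, mul_smul_comm, mul_assoc,
    e1, e2, e3, e4, assoc3 e1, assoc3 e2, assoc3 e3, assoc3 e4,
    f1, f2, f3, f4, assoc3 f1, assoc3 f2, assoc3 f3, assoc3 f4,
    g1, g2, g3, assoc3 g1, assoc3 g2, assoc3 g3, add_sub_cancel_right, mul_one,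
    one_mul, smul_add, smul_sub, smul_smul]
  module

theorem Bern3.E3 {q : F} {T1 T2 x y z : A} (h : Bern3 q T1 T2 x y z) :
    Ph T1 x * Ph T2 y * Ph T1 x - Ph T2 y * Ph T1 x * Ph T2 y =
      Vd T1 T2 * ((x - y) * (x - z) * (y - z)) := by
  obtain ⟨r, rfl⟩ : ∃ r, q = r + 1 := ⟨q - 1, by ring⟩
  have e1 := h.b1.xT; have e2 := h.b1.yT; have e3 := h.b1.tt; have e4 := h.b1.xy.symm
  have f1 := h.b2.xT; have f2 := h.b2.yT; have f3 := h.b2.tt; have f4 := h.b2.xy.symm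
  have g1 := h.c1.symm; have g2 := h.c2.symm; have g3 := h.xz.symm
  rw [add_sub_cancel_right] at e1 e2 e3 f1 f2 f3
  rw [h.b1.ph_eq, h.b2.ph_eq, Vd]
  simp only [mul_add, add_mul, mul_sub, sub_mul, smul_mul_assoc, mul_smul_comm, mul_assoc,
    e1, e2, e3, e4, assoc3 e1, assoc3 e2, assoc3 e3, assoc3 e4,
    f1, f2, f3, f4, assoc3 f1, assoc3 f2, assoc3 f3, assoc3 f4,
    g1, g2, g3, assoc3 g1, assoc3 g2, assoc3 g3, add_sub_cancel_right, mul_one,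
    one_mul, smul_add, smul_sub, smul_smul]
  module

theorem Bern3.E4 {q : F} {T1 T2 x y z : A} (h : Bern3 q T1 T2 x y z) :
    Vd T1 T2 * Ph T1 x = Ph T2 y * Vd T1 T2 := by
  obtain ⟨r, rfl⟩ : ∃ r, q = r + 1 := ⟨q - 1, by ring⟩
  have e1 := h.b1.xT; have e2 := h.b1.yT; have e3 := h.b1.tt; have e4 := h.b1.xy.symm
  have f1 := h.b2.xT; have f2 := h.b2.yT; have f3 := h.b2.tt; have f4 := h.b2.xy.symm
  have g1 := h.c1.symm; have g2 := h.c2.symm; have g3 := h.xz.symm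
  rw [add_sub_cancel_right] at e1 e2 e3 f1 f2 f3
  rw [h.b1.ph_eq, h.b2.ph_eq, Vd]
  simp only [mul_add, add_mul, mul_sub, sub_mul, smul_mul_assoc, mul_smul_comm, mul_assoc,
    e1, e2, e3, e4, assoc3 e1, assoc3 e2, assoc3 e3, assoc3 e4,
    f1, f2, f3, f4, assoc3 f1, assoc3 f2, assoc3 f3, assoc3 f4,
    g1, g2, g3, assoc3 g1, assoc3 g2, assoc3 g3, add_sub_cancel_right, mul_one,
    one_mul, smul_add, smul_sub, smul_smul]
  module

end Affine

section Gens
open Polynomial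

/-- The affine Hecke relations for a family of elements. -/
structure Aff {F A : Type*} [Field F] [Ring A] [Algebra F A] (q : F) (N : ℕ) (L T : ℕ → A) :
    Prop where
  bern : ∀ i, i + 1 < N → Bern q (T i) (L i) (L (i + 1))
  LL : ∀ i j, L i * L j = L j * L i
  TL : ∀ i j, i + 1 < N → j ≠ i → j ≠ i + 1 → T i * L j = L j * T i
  TT : ∀ i j, i + 2 ≤ j → j + 1 < N → T i * T j = T j * T i
  br : ∀ i, i + 2 < N → T (i + 1) * T i * T (i + 1) = T i * T (i + 1) * T i

variable {F : Type} [Field F] {M N : ℕ} {w : Fin M → F} {q' : F}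

variable (M N w q') in
/-- The quotient map. -/
def chMk : FreeAlgebra F (Fin N) →ₐ[F] CH F M N w q' := RingQuot.mkAlgHom F (Rel F M N w q')

variable (M N w q') in
/-- The generator `T_i`. -/
def hT (i : ℕ) : CH F M N w q' :=
  if h : i + 1 < N then chMk M N w q' (FreeAlgebra.ι F ⟨i + 1, h⟩) else 0

variable (M N w q') in
/-- The Jucys-Murphy elements. -/
def hL : ℕ → CH F M N w q'
  | 0 => if h : 0 < N then chMk M N w q' (FreeAlgebra.ι F ⟨0, h⟩) else 0
  | i + 1 => q'⁻¹ • (hT M N w q' i * hL i * hT M N w q' i)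

theorem chMk_rel {x y : FreeAlgebra F (Fin N)} (h : Rel F M N w q' x y) :
    chMk M N w q' x = chMk M N w q' y := RingQuot.mkAlgHom_rel F h

theorem hT_of_lt {i : ℕ} (h : i + 1 < N) :
    hT M N w q' i = chMk M N w q' (FreeAlgebra.ι F ⟨i + 1, h⟩) := dif_pos h

theorem hL_zero_of_lt (h : 0 < N) :
    hL M N w q' 0 = chMk M N w q' (FreeAlgebra.ι F ⟨0, h⟩) := by
  rw [hL]; exact dif_pos h

theorem hT_quad {i : ℕ} (h : i + 1 < N) :
    hT M N w q' i * hT M N w q' i = (q' - 1) • hT M N w q' i + q' • (1 : CH F M N w q') := by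
  have h1 := chMk_rel (Rel.quad (k := F) (m := M) (v := w) (q := q') (⟨i + 1, h⟩ : Fin N)
    (Nat.le_add_left _ _))
  rw [map_zero, map_mul, map_sub, map_add, map_one, AlgHom.commutes, ← hT_of_lt h,
    Algebra.algebraMap_eq_smul_one] at h1
  simp only [sub_mul, mul_add, mul_one, smul_mul_assoc, one_mul] at h1
  have h2 : hT M N w q' i * hT M N w q' i = q' • hT M N w q' i + q' • 1 - hT M N w q' i := by
    rw [← sub_eq_zero, ← h1]; abel
  rw [h2]; module

theorem hT_comm {i j : ℕ} (hij : i + 2 ≤ j) (h : j + 1 < N) :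
    hT M N w q' i * hT M N w q' j = hT M N w q' j * hT M N w q' i := by
  have h1 := chMk_rel (Rel.comm (k := F) (m := M) (v := w) (q := q')
    (⟨i + 1, by omega⟩ : Fin N) ⟨j + 1, h⟩ (by simp; omega))
  rwa [map_mul, map_mul, ← hT_of_lt h, ← hT_of_lt] at h1

theorem hT_braid {i : ℕ} (h : i + 2 < N) :
    hT M N w q' (i + 1) * hT M N w q' i * hT M N w q' (i + 1) =
      hT M N w q' i * hT M N w q' (i + 1) * hT M N w q' i := by
  have h1 := chMk_rel (Rel.braid (k := F) (m := M) (v := w) (q := q')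
    (⟨i + 1, by omega⟩ : Fin N) ⟨i + 1 + 1, h⟩ (by simp) rfl)
  rwa [map_mul, map_mul, map_mul, map_mul, ← hT_of_lt, ← hT_of_lt] at h1

theorem hL0_comm {i : ℕ} (hi : 1 ≤ i) (h : i + 1 < N) :
    hL M N w q' 0 * hT M N w q' i = hT M N w q' i * hL M N w q' 0 := by
  have h1 := chMk_rel (Rel.comm (k := F) (m := M) (v := w) (q := q')
    (⟨0, by omega⟩ : Fin N) ⟨i + 1, h⟩ (by simp; omega))
  rwa [map_mul, map_mul, ← hT_of_lt, ← hL_zero_of_lt] at h1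

theorem hL0_braid (h : 1 < N) :
    hL M N w q' 0 * hT M N w q' 0 * hL M N w q' 0 * hT M N w q' 0 =
      hT M N w q' 0 * hL M N w q' 0 * hT M N w q' 0 * hL M N w q' 0 := by
  have h1 := chMk_rel (Rel.braid0 (k := F) (m := M) (v := w) (q := q')
    (⟨0, by omega⟩ : Fin N) ⟨0 + 1, h⟩ rfl rfl)
  simpa only [map_mul, ← hT_of_lt, ← hL_zero_of_lt] using h1

theorem hL0_cyclo (h : 0 < N) :
    aeval (hL M N w q' 0) (∏ j, (X - C (w j))) = 0 := by
  have h1 := chMk_rel (Rel.cyclo (k := F) (m := M) (v := w) (q := q')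
    (⟨0, by omega⟩ : Fin N) rfl)
  rw [map_zero, map_list_prod, List.map_ofFn] at h1
  rw [← h1, ← List.prod_ofFn, map_list_prod, List.map_ofFn]
  congr 2
  funext j
  simp [hL_zero_of_lt h, aeval_C]

theorem ch_lift {A : Type*} [Ring A] [Algebra F A] (L0 : A) (T : ℕ → A)
    (hc : 0 < N → aeval L0 (∏ j, (X - C (w j))) = 0)
    (hquad : ∀ i, i + 1 < N → T i * T i = (q' - 1) • T i + q' • (1 : A))
    (hb0 : 1 < N → L0 * T 0 * L0 * T 0 = T 0 * L0 * T 0 * L0)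
    (h0 : ∀ i, 1 ≤ i → i + 1 < N → L0 * T i = T i * L0)
    (hTT : ∀ i j, i + 2 ≤ j → j + 1 < N → T i * T j = T j * T i)
    (hbr : ∀ i, i + 2 < N → T (i + 1) * T i * T (i + 1) = T i * T (i + 1) * T i) :
    ∃ φ : CH F M N w q' →ₐ[F] A, (0 < N → φ (hL M N w q' 0) = L0) ∧
      ∀ i, i + 1 < N → φ (hT M N w q' i) = T i := by
  let g : ℕ → A := fun i => if i = 0 then L0 else T (i - 1)
  let f : FreeAlgebra F (Fin N) →ₐ[F] A := FreeAlgebra.lift F (fun i => g i.1)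
  have hf : ∀ i : Fin N, f (FreeAlgebra.ι F i) = g i.1 := fun i => FreeAlgebra.lift_ι_apply _ _
  have g0 : g 0 = L0 := if_pos rfl
  have gs : ∀ i, g (i + 1) = T i := fun i => by simp [g]
  have hrel : ∀ ⦃x y⦄, Rel F M N w q' x y → f x = f y := by
    intro x y h
    induction h with
    | cyclo i hi =>
      rw [map_zero, map_list_prod, List.map_ofFn, ← hc (by omega), ← List.prod_ofFn,
        map_list_prod, List.map_ofFn]
      congr 2
      funext j
      simp [hf, hi, g0]
    | quad i hi =>
      obtain ⟨i, hN⟩ := i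
      obtain ⟨i, rfl⟩ := Nat.exists_eq_add_of_le' hi
      rw [map_zero, map_mul, map_sub, map_add, map_one, AlgHom.commutes, hf, gs,
        Algebra.algebraMap_eq_smul_one]
      simp only [sub_mul, mul_add, mul_one, smul_mul_assoc, one_mul, hquad i hN]
      module
    | braid0 i j hi hj =>
      simp only [map_mul, hf, hi, hj, g0, gs 0]
      exact hb0 (by omega)
    | comm i j h =>
      obtain ⟨i, hN⟩ := i
      obtain ⟨j, hN'⟩ := j
      simp only at h
      rw [map_mul, map_mul, hf, hf]
      obtain ⟨j, rfl⟩ := Nat.exists_eq_add_of_le' (show 1 ≤ j by omega)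
      rcases i with _ | i
      · simp only [g0, gs]
        exact h0 j (by omega) hN'
      · simp only [gs]
        exact hTT i j (by omega) hN'
    | braid i j hi hj =>
      obtain ⟨i, hN⟩ := i
      obtain ⟨j, hN'⟩ := j
      simp only at hi hj
      subst hj
      obtain ⟨i, rfl⟩ := Nat.exists_eq_add_of_le' hi
      simp only [map_mul, hf, gs]
      exact hbr i hN'
  let φ : CH F M N w q' →ₐ[F] A := RingQuot.liftAlgHom F ⟨f, hrel⟩
  have hφ : ∀ x, φ (chMk M N w q' x) = f x := fun x => RingQuot.liftAlgHom_mkAlgHom_apply F f hrel x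
  refine ⟨φ, fun h => ?_, fun i h => ?_⟩
  · rw [hL_zero_of_lt h, hφ, hf, g0]
  · rw [hT_of_lt h, hφ, hf, gs]

theorem ch_induct (S : Subalgebra F (CH F M N w q')) (h0 : 0 < N → hL M N w q' 0 ∈ S)
    (hT' : ∀ i, i + 1 < N → hT M N w q' i ∈ S) : ∀ x, x ∈ S := by
  intro x
  obtain ⟨x, rfl⟩ := RingQuot.mkAlgHom_surjective F (Rel F M N w q') x
  change chMk M N w q' x ∈ S
  induction x using FreeAlgebra.induction with
  | grade0 r => rw [AlgHom.commutes]; exact S.algebraMap_mem r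
  | grade1 i =>
    obtain ⟨i, hN⟩ := i
    rcases i with _ | i
    · rw [← hL_zero_of_lt]; exact h0 hN
    · rw [← hT_of_lt]; exact hT' i hN
  | mul a b ha hb => rw [map_mul]; exact S.mul_mem ha hb
  | add a b ha hb => rw [map_add]; exact S.add_mem ha hb

theorem hT_of_ge {i : ℕ} (h : ¬ i + 1 < N) : hT M N w q' i = 0 := dif_neg h

theorem hL_of_ge : ∀ {i : ℕ} (h : N ≤ i), hL M N w q' i = 0
  | 0, h => by rw [hL]; exact dif_neg (by omega)
  | i + 1, h => by rw [hL, hT_of_ge (by omega)]; simp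

theorem comm_sandwich {A : Type*} [Ring A] [Algebra F A] {a t l : A} (r : F) (h1 : a * t = t * a)
    (h2 : a * l = l * a) : a * (r • (t * l * t)) = (r • (t * l * t)) * a := by
  have h3 : Commute a (t * l * t) := (Commute.mul_right (Commute.mul_right h1 h2) h1)
  exact h3.smul_right r

theorem hTL_gt {i j : ℕ} (hij : j < i) (h : i + 1 < N) :
    hT M N w q' i * hL M N w q' j = hL M N w q' j * hT M N w q' i := by
  induction j with
  | zero => exact (hL0_comm hij h).symm
  | succ j ih =>
    have h1 := ih (by omega)
    have h2 : hT M N w q' j * hT M N w q' i = hT M N w q' i * hT M N w q' j :=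
      hT_comm (by omega) h
    rw [hL]
    exact comm_sandwich _ h2.symm h1

theorem hTL_lt (hq' : q' ≠ 0) {i j : ℕ} (hij : i + 1 < j) :
    hT M N w q' i * hL M N w q' j = hL M N w q' j * hT M N w q' i := by
  by_cases hN : j < N
  · induction j, hij using Nat.le_induction with
    | base =>
      have h1 : hT M N w q' (i + 1) * hL M N w q' i = hL M N w q' i * hT M N w q' (i + 1) :=
        hTL_gt (by omega) (by omega)
      have h2 := hT_braid (M := M) (w := w) (q' := q') (i := i) (N := N) (by omega)
      rw [mul_assoc, mul_assoc] at h2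
      rw [hL, hL]
      simp only [mul_smul_comm, smul_mul_assoc, mul_assoc]
      rw [← h2]
      have h3 : ∀ z, hT M N w q' i * (hT M N w q' (i + 1) * (hT M N w q' i * z)) =
          hT M N w q' (i + 1) * (hT M N w q' i * (hT M N w q' (i + 1) * z)) := by
        intro z
        simp only [← mul_assoc] at h2 ⊢
        rw [h2]
      rw [h3, assoc3 h1, mul_assoc]
    | succ j hj ih =>
      have h1 := ih (by omega)
      have h2 : hT M N w q' i * hT M N w q' j = hT M N w q' j * hT M N w q' i :=
        hT_comm (by omega) (by omega)
      rw [hL]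
      exact comm_sandwich _ h2 h1
  · rw [hL_of_ge (by omega)]; simp

theorem hLL0 (hq' : q' ≠ 0) (j : ℕ) :
    hL M N w q' 0 * hL M N w q' j = hL M N w q' j * hL M N w q' 0 := by
  induction j with
  | zero => rfl
  | succ j ih =>
    by_cases hN : j + 1 < N
    · rcases j with _ | j
      · have h1 := hL0_braid (M := M) (w := w) (q' := q') (N := N) hN
        rw [hL.eq_2, mul_smul_comm, smul_mul_assoc]
        simp only [← mul_assoc] at h1 ⊢
        rw [h1]
      · have h1 := hL0_comm (M := M) (w := w) (q' := q') (i := j + 1) (by omega) hN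
        rw [hL.eq_2]
        exact comm_sandwich _ h1 ih
    · rw [hL_of_ge (i := j + 1) (by omega)]; simp

theorem hLL_lt (hq' : q' ≠ 0) (i j : ℕ) (hij : i < j) :
    hL M N w q' i * hL M N w q' j = hL M N w q' j * hL M N w q' i := by
  induction i with
  | zero => exact hLL0 hq' j
  | succ i ih =>
    have h1 := ih (by omega)
    have h2 := hTL_lt (M := M) (N := N) (w := w) hq' hij
    rw [hL.eq_2]
    exact (comm_sandwich _ h2.symm h1.symm).symm

theorem hLL (hq' : q' ≠ 0) (i j : ℕ) :
    hL M N w q' i * hL M N w q' j = hL M N w q' j * hL M N w q' i := by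
  rcases lt_trichotomy i j with h | h | h
  · exact hLL_lt hq' i j h
  · rw [h]
  · exact (hLL_lt hq' j i h).symm

theorem ch_aff (hq' : q' ≠ 0) : Aff q' N (hL M N w q') (hT M N w q') where
  bern i h := bern_of_tlt hq' (hT_quad h) (hLL hq' _ _) (by rw [hL, smul_inv_smul₀ hq'])
  LL := hLL hq'
  TL i j h h1 h2 := by
    rcases lt_or_ge j i with h3 | h3
    · exact hTL_gt h3 h
    · exact hTL_lt hq' (by omega)
  TT i j := hT_comm
  br i := hT_braid

end Gens

section Polys
open Polynomial
variable {F A : Type*} [Field F] [Ring A] [Algebra F A]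

theorem semi_aeval {a u w : A} (h : a * u = w * a) (f : F[X]) :
    a * aeval u f = aeval w f * a := by
  induction f using Polynomial.induction_on' with
  | add f g hf hg => rw [map_add, map_add, mul_add, add_mul, hf, hg]
  | monomial n r =>
    have h1 : SemiconjBy a u w := h
    rw [aeval_monomial, aeval_monomial, ← mul_assoc, ← Algebra.commutes, mul_assoc, mul_assoc,
      (h1.pow_right n).eq]

theorem aeval_comm {x y : A} (h : x * y = y * x) (f g : F[X]) :
    aeval x f * aeval y g = aeval y g * aeval x f :=
  semi_aeval (semi_aeval h.symm f).symm g

theorem aeval_comm' (y : A) (f g : F[X]) :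
    aeval y f * aeval y g = aeval y g * aeval y f := aeval_comm rfl f g

theorem Bern.poly {q : F} {T x y : A} (h : Bern q T x y) (f : F[X]) :
    ∃ d : A, d * x = x * d ∧ d * y = y * d ∧ T * aeval y f = aeval x f * T + d ∧
      T * aeval x f = aeval y f * T - d ∧ d * (y - x) = (q - 1) • (y * (aeval y f - aeval x f)) := by
  induction f using Polynomial.induction_on with
  | C a =>
    refine ⟨0, by simp, by simp, ?_, ?_, by simp⟩
    · simp [Algebra.commutes]
    · simp [Algebra.commutes]
  | add f g hf hg =>
    obtain ⟨d, h1, h2, h3, h4, h5⟩ := hf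
    obtain ⟨d', h1', h2', h3', h4', h5'⟩ := hg
    refine ⟨d + d', ?_, ?_, ?_, ?_, ?_⟩
    · rw [add_mul, mul_add, h1, h1']
    · rw [add_mul, mul_add, h2, h2']
    · rw [map_add, mul_add, h3, h3', map_add, add_mul]; abel
    · rw [map_add, mul_add, h4, h4', map_add, add_mul]; abel
    · rw [add_mul, h5, h5', ← smul_add, ← mul_add, map_add, map_add]
      congr 2; abel
  | monomial n a hf =>
    obtain ⟨d, h1, h2, h3, h4, h5⟩ := hf
    rw [pow_succ, ← mul_assoc]
    generalize (C a * X ^ n : F[X]) = f at *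
    simp only [map_mul, aeval_X]
    have c1 : aeval x f * y = y * aeval x f := (semi_aeval h.xy.symm f).symm
    have c2 : aeval x f * x = x * aeval x f := (semi_aeval rfl f).symm
    have c3 : aeval y f * y = y * aeval y f := (semi_aeval rfl f).symm
    have c4 : aeval y f * x = x * aeval y f := (semi_aeval h.xy f).symm
    have key : (q - 1) • (y * aeval y f) + d * x = (q - 1) • (y * aeval x f) + d * y := by
      have : d * y = d * x + d * (y - x) := by rw [mul_sub]; abel
      rw [this, h5, mul_sub, smul_sub]; abel
    refine ⟨(q - 1) • (y * aeval x f) + d * y, ?_, ?_, ?_, ?_, ?_⟩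
    · rw [add_mul, mul_add, smul_mul_assoc, mul_smul_comm, mul_assoc, c2, ← mul_assoc, ← h.xy,
        mul_assoc, mul_assoc, ← h.xy, ← mul_assoc, ← mul_assoc d, h1, mul_assoc, mul_assoc]
    · rw [add_mul, mul_add, smul_mul_assoc, mul_smul_comm, mul_assoc, c1, mul_assoc,
        ← mul_assoc y d, ← h2, mul_assoc]
    · rw [← mul_assoc, h3, add_mul, mul_assoc, h.ty, mul_add, mul_smul_comm, c1, mul_assoc]; abel
    · rw [← mul_assoc, h4, sub_mul, mul_assoc, h.tx, mul_sub, mul_smul_comm, c3, ← key,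
        ← mul_assoc, c3]; abel
    · have : d * y * (y - x) = (d * (y - x)) * y := by
        rw [mul_assoc, mul_assoc, mul_sub, sub_mul, h.xy]
      rw [add_mul, this, h5, smul_mul_assoc, smul_mul_assoc, ← smul_add]
      congr 1
      simp only [mul_sub, sub_mul, mul_assoc, c1, c2, c3, c4]
      abel

theorem Bern.sym {q : F} {T x y : A} (h : Bern q T x y) (f : F[X]) :
    T * (aeval x f * aeval y f) = aeval x f * aeval y f * T := by
  obtain ⟨d, h1, h2, h3, h4, h5⟩ := h.poly f
  rw [← mul_assoc, h4, sub_mul, mul_assoc, h3, mul_add, semi_aeval h2 f, ← mul_assoc,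
    aeval_comm h.xy f f]
  abel

theorem sub_factor {x y : A} (h : x * y = y * x) (f : F[X]) :
    ∃ D ∈ Algebra.adjoin F {x, y}, aeval x f - aeval y f = D * (x - y) := by
  have hx : x ∈ Algebra.adjoin F {x, y} := Algebra.subset_adjoin (by simp)
  have hy : y ∈ Algebra.adjoin F {x, y} := Algebra.subset_adjoin (by simp)
  induction f using Polynomial.induction_on with
  | C a => exact ⟨0, Subalgebra.zero_mem _, by simp⟩
  | add f g hf hg =>
    obtain ⟨D, h1, h2⟩ := hf
    obtain ⟨D', h1', h2'⟩ := hg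
    refine ⟨D + D', Subalgebra.add_mem _ h1 h1', ?_⟩
    rw [add_mul, ← h2, ← h2', map_add, map_add]; abel
  | monomial n a hf =>
    obtain ⟨D, h1, h2⟩ := hf
    rw [pow_succ, ← mul_assoc]
    generalize (C a * X ^ n : F[X]) = f at *
    simp only [map_mul, aeval_X]
    refine ⟨x * D + aeval y f, Subalgebra.add_mem _ (Subalgebra.mul_mem _ hx h1)
      (aeval_mem_adjoin_singleton' hy f), ?_⟩
    rw [add_mul, mul_assoc, ← h2, mul_sub, mul_sub, semi_aeval (F := F) (show x * x = x * x from rfl) f,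
      semi_aeval h f]
    abel
where
  aeval_mem_adjoin_singleton' {S : Subalgebra F A} {y : A} (hy : y ∈ S) (f : F[X]) :
      aeval y f ∈ S := by
    have h1 : aeval y f = ((aeval (⟨y, hy⟩ : S) f : S) : A) := by
      rw [← Subalgebra.coe_val, ← aeval_algHom_apply]; rfl
    rw [h1]; exact Subtype.property _

theorem aeval_mem {S : Subalgebra F A} {y : A} (hy : y ∈ S) (f : F[X]) : aeval y f ∈ S :=
  sub_factor.aeval_mem_adjoin_singleton' hy f

/-- Enlarge a polynomial by `q`-shifts. -/
def spread (q : F) (f : F[X]) : F[X] := f.comp (C q * X) * f.comp (C q⁻¹ * X) * f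

theorem aeval_scale (r : F) (y : A) (f : F[X]) :
    aeval y (f.comp (C r * X)) = aeval (r • y) f := by
  rw [aeval_comp]
  congr 2
  rw [map_mul, aeval_C, aeval_X, Algebra.smul_def]

theorem Bern.ann {q : F} (hq : q ≠ 0) {T x y : A} (h : Bern q T x y) (f : F[X])
    (hf : aeval x f = 0) : aeval y (spread q f) = 0 := by
  have h1 : Ph T x * (Ph T x * aeval y f) = 0 := by
    rw [semi_aeval h.ph_y f, hf]; simp
  rw [← mul_assoc, h.ph_sq] at h1
  have cx : ∀ r : F, (r • y) * x = x * (r • y) := fun r => by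
    rw [smul_mul_assoc, mul_smul_comm, h.xy]
  obtain ⟨D1, -, e1⟩ := sub_factor (cx q) f
  obtain ⟨D2, -, e2⟩ := sub_factor (cx q⁻¹) f
  rw [hf, sub_zero] at e1 e2
  rw [spread, map_mul, map_mul, aeval_scale, aeval_scale, e1, mul_assoc, mul_assoc]
  have h2 : (q • y - x) * aeval (q⁻¹ • y) f = aeval (q⁻¹ • y) f * (q • y - x) := by
    apply semi_aeval
    rw [sub_mul, mul_sub, smul_mul_smul_comm, smul_mul_smul_comm, mul_comm q, cx]
  rw [assoc3 h2, e2]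
  have h3 : (q⁻¹ • y - x) * ((q • y - x) * aeval y f) = 0 := by
    have : (q⁻¹ • y - x) = - q⁻¹ • (q • x - y) := by
      rw [smul_sub, smul_smul, neg_mul, inv_mul_cancel₀ hq]; module
    rw [this, smul_mul_assoc, ← mul_assoc, h1, smul_zero]
  rw [mul_assoc, mul_assoc, h3, mul_zero, mul_zero]

/-- Iterated spreading. -/
def fam (q : F) (f : F[X]) : ℕ → F[X]
  | 0 => f
  | i + 1 => spread q (fam q f i)

theorem fam_dvd (q : F) (f : F[X]) {i j : ℕ} (h : i ≤ j) : fam q f i ∣ fam q f j := by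
  induction j, h using Nat.le_induction with
  | base => exact dvd_rfl
  | succ j hj ih => exact ih.trans (Dvd.intro_left _ rfl)

theorem fam_prod {ι : Type*} (s : Finset ι) (q : F) (f : ι → F[X]) (i : ℕ) :
    fam q (∏ x ∈ s, f x) i = ∏ x ∈ s, fam q (f x) i := by
  induction i with
  | zero => rfl
  | succ i ih =>
    simp only [fam, ih, spread, Polynomial.prod_comp, Finset.prod_mul_distrib]

theorem aeval_dvd {f g : F[X]} (h : f ∣ g) {y : A} (hf : aeval y f = 0) : aeval y g = 0 := by
  obtain ⟨r, rfl⟩ := h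
  rw [map_mul, hf, zero_mul]

theorem Aff.ann {q : F} (hq : q ≠ 0) {N : ℕ} {L T : ℕ → A} (h : Aff q N L T) (f : F[X])
    (hf : 0 < N → aeval (L 0) f = 0) (i : ℕ) (hi : i < N) {N' : ℕ} (hN : N ≤ N') :
    aeval (L i) (fam q f N') = 0 := by
  have h1 : aeval (L i) (fam q f i) = 0 := by
    induction i with
    | zero => exact hf hi
    | succ i ih => exact (h.bern i hi).ann hq _ (ih (by omega))
  exact aeval_dvd (fam_dvd q f (by omega)) h1

theorem exists_winv {a b e : A} (hab : a * b = b * a) {f g : F[X]} (h : IsCoprime f g)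
    (ha : aeval a f * e = 0) (hb : aeval b g * e = 0) :
    ∃ w ∈ Algebra.adjoin F {a, b}, w * (a - b) * e = e := by
  obtain ⟨u, w, huw⟩ := h
  obtain ⟨D, hD, e1⟩ := sub_factor hab f
  refine ⟨- (aeval b u * D), Subalgebra.neg_mem _ (Subalgebra.mul_mem _
    (aeval_mem (Algebra.subset_adjoin (by simp)) u) hD), ?_⟩
  have h1 : e = aeval b u * (aeval b f * e) := by
    conv_lhs => rw [← one_mul e, ← map_one (aeval (R := F) b), ← huw, map_add, map_mul, map_mul, add_mul,
      mul_assoc, mul_assoc, hb, mul_zero, add_zero]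
  conv_rhs => rw [h1]
  have h2 : aeval b f = aeval a f - D * (a - b) := by rw [← e1]; abel
  rw [h2, sub_mul, ha, zero_sub, neg_mul, neg_mul, mul_neg, mul_assoc, mul_assoc, mul_assoc]

/-- Polynomials that split with all roots in `V`. -/
def Gm (V : Set F) : Submonoid F[X] :=
  Submonoid.closure ({f | ∃ u : F, u ≠ 0 ∧ f = C u} ∪ {f | ∃ r ∈ V, f = X - C r})

theorem Gm_coprime {V W : Set F} (h : ∀ r ∈ V, r ∉ W) {f g : F[X]} (hf : f ∈ Gm V)
    (hg : g ∈ Gm W) : IsCoprime f g := by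
  have hu : ∀ u : F, u ≠ 0 → ∀ g, IsCoprime (C u) g := fun u hu g =>
    ⟨C u⁻¹, 0, by rw [← C_mul, inv_mul_cancel₀ hu]; simp⟩
  induction hf using Submonoid.closure_induction with
  | mem f hf =>
    rcases hf with ⟨u, h1, rfl⟩ | ⟨r, h1, rfl⟩
    · exact hu u h1 g
    · induction hg using Submonoid.closure_induction with
      | mem g hg =>
        rcases hg with ⟨u, h2, rfl⟩ | ⟨s, h2, rfl⟩
        · exact (hu u h2 _).symm
        · apply isCoprime_X_sub_C_of_isUnit_sub
          rw [isUnit_iff_ne_zero, sub_ne_zero]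
          rintro rfl
          exact h _ h1 h2
      | one => exact isCoprime_one_right
      | mul a b _ _ h3 h4 => exact h3.mul_right h4
  | one => exact isCoprime_one_left
  | mul a b _ _ h3 h4 => exact h3.mul_left h4

theorem Gm_scale {V : Set F} {s : F} (hs : s ≠ 0) (h : ∀ r ∈ V, s⁻¹ * r ∈ V) {f : F[X]}
    (hf : f ∈ Gm V) : f.comp (C s * X) ∈ Gm V := by
  induction hf using Submonoid.closure_induction with
  | mem f hf =>
    rcases hf with ⟨u, h1, rfl⟩ | ⟨r, h1, rfl⟩
    · rw [C_comp]; exact Submonoid.subset_closure (Or.inl ⟨u, h1, rfl⟩)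
    · have : (X - C r).comp (C s * X) = C s * (X - C (s⁻¹ * r)) := by
        rw [sub_comp, X_comp, C_comp, mul_sub, ← C_mul, mul_inv_cancel_left₀ hs]
      rw [this]
      exact Submonoid.mul_mem _ (Submonoid.subset_closure (Or.inl ⟨s, hs, rfl⟩))
        (Submonoid.subset_closure (Or.inr ⟨_, h r h1, rfl⟩))
  | one => rw [one_comp]; exact Submonoid.one_mem _
  | mul a b _ _ h3 h4 => rw [mul_comp]; exact Submonoid.mul_mem _ h3 h4

theorem Gm_fam {V : Set F} {q : F} (hq : q ≠ 0) (h : ∀ r ∈ V, q * r ∈ V)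
    (h' : ∀ r ∈ V, q⁻¹ * r ∈ V) {f : F[X]} (hf : f ∈ Gm V) (i : ℕ) : fam q f i ∈ Gm V := by
  induction i with
  | zero => exact hf
  | succ i ih =>
    exact Submonoid.mul_mem _ (Submonoid.mul_mem _ (Gm_scale hq h' ih)
      (Gm_scale (inv_ne_zero hq) (by rwa [inv_inv]) ih)) ih

/-- The spectral idempotent polynomials. -/
theorem exists_idem {ι : Type} [Fintype ι] [Nonempty ι] (f : ι → F[X])
    (h : ∀ x y, x ≠ y → IsCoprime (f x) (f y)) :
    ∃ e : ι → F[X], ∑ x, e x = 1 ∧ (∀ x y, x ≠ y → f x ∣ e y) ∧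
      (∀ x, (∏ y, f y) ∣ f x * e x) ∧ ∀ x y, x ≠ y → (∏ z, f z) ∣ e x * e y := by
  obtain ⟨μ, hμ⟩ := (exists_sum_eq_one_iff_pairwise_coprime (t := Finset.univ) (s := f)
    Finset.univ_nonempty).2 (fun x y hxy => h _ _ (fun h' => hxy (Subtype.ext h')))
  have e1 : ∀ x, (∏ y, f y) = f x * ∏ y ∈ Finset.univ \ {x}, f y := fun x => by
    rw [← Finset.mul_prod_erase _ _ (Finset.mem_univ x), Finset.sdiff_singleton_eq_erase]
  have e2 : ∀ x y, x ≠ y → f x ∣ μ y * ∏ z ∈ Finset.univ \ {y}, f z := fun x y hxy =>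
    Dvd.dvd.mul_left (Finset.dvd_prod_of_mem _ (by simp [hxy])) _
  refine ⟨fun x => μ x * ∏ y ∈ Finset.univ \ {x}, f y, hμ, e2, fun x => ?_, fun x y hxy => ?_⟩
  · rw [e1 x, mul_left_comm]
    exact Dvd.intro_left _ rfl
  · rw [e1 x, mul_comm (f x)]
    exact mul_dvd_mul (Dvd.intro_left _ rfl) (e2 x y hxy)

end Polys

section PolyData
open Polynomial
variable {F : Type*} [Field F]

/-- The polynomial data used to cut out the blocks. -/
structure PD {ι : Type} [Fintype ι] (q' : F) (N : ℕ) (G P : ι → F[X]) : Prop where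
  cop : ∀ x y, x ≠ y → IsCoprime (fam q' (G x) N) (fam q' (G y) N)
  cops : ∀ x y, x ≠ y → IsCoprime ((fam q' (G x) N).comp (C q'⁻¹ * X)) (fam q' (G y) N)
  sum : ∑ x, P x = 1
  dvd : ∀ x y, x ≠ y → fam q' (G x) N ∣ P y
  self : ∀ x, (∏ y, fam q' (G y) N) ∣ fam q' (G x) N * P x
  orth : ∀ x y, x ≠ y → (∏ z, fam q' (G z) N) ∣ P x * P y

/-- The product of the linear factors in a given part. -/
def Gp {M a' : ℕ} (w : Fin M → F) (p' : Fin M → Fin a') (x : Fin a') : F[X] :=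
  ∏ j ∈ Finset.univ.filter (fun j => p' j = x), (X - C (w j))

theorem Gp_prod {M a' : ℕ} (w : Fin M → F) (p' : Fin M → Fin a') :
    ∏ x, Gp w p' x = ∏ j, (X - C (w j)) :=
  Finset.prod_fiberwise _ _ _

theorem exists_PD {M a' : ℕ} (w : Fin M → F) (p' : Fin M → Fin a') {q' : F} (hq : q' ≠ 0)
    (hp : ∀ j l : Fin M, p' j = p' l ↔ ∃ b : ℤ, w j = q' ^ b * w l) (N : ℕ) [Nonempty (Fin a')] :
    ∃ P, PD q' N (Gp w p') P := by
  let V : Fin a' → Set F := fun x => {r | ∃ j, p' j = x ∧ ∃ b : ℤ, r = q' ^ b * w j}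
  have hV : ∀ x y, x ≠ y → ∀ r ∈ V x, r ∉ V y := by
    rintro x y hxy r ⟨j, rfl, b, rfl⟩ ⟨l, rfl, b', h⟩
    apply hxy
    rw [hp]
    refine ⟨-b + b', ?_⟩
    rw [zpow_add₀ hq, mul_assoc, ← h, ← mul_assoc, ← zpow_add₀ hq]
    simp
  have h1 : ∀ x, ∀ r ∈ V x, q' * r ∈ V x := by
    rintro x r ⟨j, h, b, rfl⟩
    exact ⟨j, h, 1 + b, by rw [zpow_add₀ hq, zpow_one, mul_assoc]⟩
  have h2 : ∀ x, ∀ r ∈ V x, q'⁻¹ * r ∈ V x := by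
    rintro x r ⟨j, h, b, rfl⟩
    exact ⟨j, h, -1 + b, by rw [zpow_add₀ hq, zpow_neg_one, mul_assoc]⟩
  have h3 : ∀ x, Gp w p' x ∈ Gm (V x) := fun x => by
    refine Submonoid.prod_mem _ fun j hj => Submonoid.subset_closure (Or.inr ⟨w j, ?_, rfl⟩)
    exact ⟨j, by simpa using hj, 0, by simp⟩
  have h4 : ∀ x, fam q' (Gp w p' x) N ∈ Gm (V x) := fun x => Gm_fam hq (h1 x) (h2 x) (h3 x) N
  have hc : ∀ x y, x ≠ y → IsCoprime (fam q' (Gp w p' x) N) (fam q' (Gp w p' y) N) :=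
    fun x y hxy => Gm_coprime (hV x y hxy) (h4 x) (h4 y)
  obtain ⟨P, a1, a2, a3, a4⟩ := exists_idem (fun x => fam q' (Gp w p' x) N) hc
  exact ⟨P, hc, fun x y hxy => Gm_coprime (hV x y hxy)
    (Gm_scale (inv_ne_zero hq) (by rw [inv_inv]; exact h1 x) (h4 x)) (h4 y), a1, a2, a3, a4⟩

variable {A : Type*} [Ring A] [Algebra F A]

/-- difference invertible -/
theorem PD.winv {ι : Type} [Fintype ι] {q' : F} {N : ℕ} {G P : ι → F[X]} (h : PD q' N G P)
    {x y : ι} (hxy : x ≠ y) {s t e : A} (hst : s * t = t * s)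
    (hs : aeval s (fam q' (G x) N) * e = 0) (ht : aeval t (fam q' (G y) N) * e = 0) :
    ∃ w ∈ Algebra.adjoin F {s, t}, w * (s - t) * e = e :=
  exists_winv hst (h.cop x y hxy) hs ht

theorem PD.winvq {ι : Type} [Fintype ι] {q' : F} (hq : q' ≠ 0) {N : ℕ} {G P : ι → F[X]}
    (h : PD q' N G P)
    {x y : ι} (hxy : x ≠ y) {s t e : A} (hst : s * t = t * s)
    (hs : aeval s (fam q' (G x) N) * e = 0) (ht : aeval t (fam q' (G y) N) * e = 0) :
    ∃ w ∈ Algebra.adjoin F {s, t}, w * (q' • s - t) * e = e := by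
  have h1 : (q' • s) * t = t * (q' • s) := by rw [smul_mul_assoc, mul_smul_comm, hst]
  obtain ⟨w, hw, h2⟩ := exists_winv h1 (h.cops x y hxy) (e := e) (by
    rw [aeval_scale, smul_smul, inv_mul_cancel₀ hq, one_smul, hs]) ht
  refine ⟨w, ?_, h2⟩
  have : Algebra.adjoin F {q' • s, t} ≤ Algebra.adjoin F {s, t} := by
    apply Algebra.adjoin_le
    rintro z (rfl | rfl)
    · exact Subalgebra.smul_mem _ (Algebra.subset_adjoin (by simp)) _
    · exact Algebra.subset_adjoin (by simp)
  exact this hw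

end PolyData

section Words
variable {ι : Type}

/-- swap the letters at `i`, `i+1` -/
def sw (i : ℕ) (c : ℕ → ι) : ℕ → ι := fun j => c (Equiv.swap i (i + 1) j)

/-- number of letters `x` before position `i` -/
def cnt (c : ℕ → ι) (x : ι) (i : ℕ) : ℕ := Nat.count (fun j => c j = x) i

/-- rank of the letter at `i` among the equal letters -/
def rk (c : ℕ → ι) (i : ℕ) : ℕ := cnt c (c i) i

theorem sw_left (i : ℕ) (c : ℕ → ι) : sw i c i = c (i + 1) := by simp [sw]
theorem sw_right (i : ℕ) (c : ℕ → ι) : sw i c (i + 1) = c i := by simp [sw]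
theorem sw_of (i : ℕ) (c : ℕ → ι) {j : ℕ} (h1 : j ≠ i) (h2 : j ≠ i + 1) : sw i c j = c j := by
  simp [sw, Equiv.swap_apply_of_ne_of_ne h1 h2]
theorem sw_sw (i : ℕ) (c : ℕ → ι) : sw i (sw i c) = c := by
  funext j; simp [sw]
theorem sw_eq (i : ℕ) (c : ℕ → ι) (h : c i = c (i + 1)) : sw i c = c := by
  funext j
  by_cases h1 : j = i
  · subst h1; rw [sw_left, h]
  by_cases h2 : j = i + 1
  · subst h2; rw [sw_right, h]
  rw [sw_of i c h1 h2]

theorem sw_comm {i j : ℕ} (h : i + 2 ≤ j) (c : ℕ → ι) : sw i (sw j c) = sw j (sw i c) := by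
  funext l
  simp only [sw]
  congr 1
  simp only [Equiv.swap_apply_def]
  split_ifs <;> omega

theorem sw_braid (i : ℕ) (c : ℕ → ι) :
    sw i (sw (i + 1) (sw i c)) = sw (i + 1) (sw i (sw (i + 1) c)) := by
  funext l
  simp only [sw]
  congr 1
  simp only [Equiv.swap_apply_def]
  split_ifs <;> omega

theorem cnt_zero (c : ℕ → ι) (x : ι) : cnt c x 0 = 0 := rfl
theorem cnt_succ (c : ℕ → ι) (x : ι) (i : ℕ) :
    cnt c x (i + 1) = cnt c x i + if c i = x then 1 else 0 := Nat.count_succ _ _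

theorem cnt_congr {c c' : ℕ → ι} {i : ℕ} (h : ∀ j < i, c j = c' j) (x : ι) :
    cnt c x i = cnt c' x i := by
  induction i with
  | zero => rfl
  | succ i ih => rw [cnt_succ, cnt_succ, ih (fun j hj => h j (by omega)), h i (by omega)]

theorem cnt_mono (c : ℕ → ι) (x : ι) : Monotone (cnt c x) :=
  monotone_nat_of_le_succ fun i => by rw [cnt_succ]; omega

theorem cnt_sw_le (c : ℕ → ι) (x : ι) {i N : ℕ} (h : N ≤ i) : cnt (sw i c) x N = cnt c x N :=
  cnt_congr (fun j hj => sw_of i c (by omega) (by omega)) x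

theorem cnt_sw_ge (c : ℕ → ι) (x : ι) {i N : ℕ} (h : i + 2 ≤ N) :
    cnt (sw i c) x N = cnt c x N := by
  induction N, h using Nat.le_induction with
  | base =>
    rw [cnt_succ, cnt_succ, cnt_succ, cnt_succ, cnt_sw_le c x le_rfl, sw_left, sw_right]
    omega
  | succ N hN ih => rw [cnt_succ, cnt_succ, ih, sw_of i c (by omega) (by omega)]

theorem rk_sw_of (c : ℕ → ι) {i j : ℕ} (h1 : j ≠ i) (h2 : j ≠ i + 1) :
    rk (sw i c) j = rk c j := by
  unfold rk
  rw [sw_of i c h1 h2]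
  rcases lt_or_ge j i with h | h
  · exact cnt_sw_le c _ (by omega)
  · exact cnt_sw_ge c _ (by omega)

theorem rk_sw_left (c : ℕ → ι) {i : ℕ} (h : c i ≠ c (i + 1)) :
    rk (sw i c) i = rk c (i + 1) := by
  unfold rk
  rw [sw_left, cnt_sw_le c _ le_rfl, cnt_succ, if_neg h, add_zero]

theorem rk_sw_right (c : ℕ → ι) {i : ℕ} (h : c i ≠ c (i + 1)) :
    rk (sw i c) (i + 1) = rk c i := by
  unfold rk
  rw [sw_right, cnt_succ, cnt_sw_le c _ le_rfl, sw_left, if_neg h.symm, add_zero]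

theorem rk_succ (c : ℕ → ι) {i : ℕ} (h : c i = c (i + 1)) : rk c (i + 1) = rk c i + 1 := by
  unfold rk
  rw [cnt_succ, if_pos h, h]

theorem rk_lt (c : ℕ → ι) {i j : ℕ} (h : i < j) (hc : c i = c j) : rk c i < rk c j := by
  have h1 := cnt_mono c (c i) (show i + 1 ≤ j by omega)
  rw [cnt_succ, if_pos rfl] at h1
  unfold rk
  rw [← hc]; omega

theorem rk_lt_cnt (c : ℕ → ι) {i N : ℕ} (h : i < N) : rk c i < cnt c (c i) N := by
  have h1 := cnt_mono c (c i) (show i + 1 ≤ N by omega)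
  rw [cnt_succ, if_pos rfl] at h1
  unfold rk
  omega

/-- letters of `c` up to `N` have multiplicities `t` -/
def IsTy (N : ℕ) (t : ι → ℕ) (c : ℕ → ι) : Prop := ∀ x, cnt c x N = t x

theorem IsTy.sw {N : ℕ} {t : ι → ℕ} {c : ℕ → ι} (h : IsTy N t c) {i : ℕ} (hi : i + 1 < N) :
    IsTy N t (sw i c) := fun x => by rw [cnt_sw_ge c x (by omega), h]

theorem IsTy.rk_lt {N : ℕ} {t : ι → ℕ} {c : ℕ → ι} (h : IsTy N t c) {i : ℕ} (hi : i < N) :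
    rk c i < t (c i) := by rw [← h]; exact rk_lt_cnt c hi

theorem cnt_eq_card (c : ℕ → ι) (x : ι) (i : ℕ) [DecidablePred fun j => c j = x] :
    cnt c x i = ((Finset.range i).filter (fun j => c j = x)).card := by
  have : cnt c x i = Nat.count (fun j => c j = x) i := by
    unfold cnt
    congr
  rw [this, Nat.count_eq_card_filter_range]

end Words

section Sorted
variable {a' : ℕ}

/-- offsets of the blocks in the sorted word -/
def off (t : Fin a' → ℕ) (x : Fin a') : ℕ := ∑ y ∈ Finset.univ.filter (· < x), t y

theorem off_add (t : Fin a' → ℕ) (x : Fin a') :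
    off t x + t x = ∑ y ∈ Finset.univ.filter (· ≤ x), t y := by
  have : (Finset.univ.filter (· ≤ x) : Finset (Fin a')) =
      insert x (Finset.univ.filter (· < x)) := by
    ext y; simp [le_iff_lt_or_eq, or_comm]
  rw [this, Finset.sum_insert (by simp), add_comm]; rfl

theorem off_le (t : Fin a' → ℕ) (x : Fin a') : off t x + t x ≤ ∑ y, t y := by
  rw [off_add]
  exact Finset.sum_le_sum_of_subset (Finset.subset_univ _)

theorem off_mono (t : Fin a' → ℕ) {x y : Fin a'} (h : x < y) : off t x + t x ≤ off t y := by
  rw [off_add]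
  apply Finset.sum_le_sum_of_subset
  intro z hz
  simp only [Finset.mem_filter, Finset.mem_univ, true_and] at hz ⊢
  exact lt_of_le_of_lt hz h

theorem off_uniq (t : Fin a' → ℕ) {x y : Fin a'} {i : ℕ} (h1 : off t x ≤ i)
    (h2 : i < off t x + t x) (h3 : off t y ≤ i) (h4 : i < off t y + t y) : x = y := by
  rcases lt_trichotomy x y with h | h | h
  · have := off_mono t h; omega
  · exact h
  · have := off_mono t h; omega

theorem off_exists (t : Fin a' → ℕ) {i : ℕ} (hi : i < ∑ y, t y) :
    ∃ x, off t x ≤ i ∧ i < off t x + t x := by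
  obtain ⟨⟨x, r⟩, h⟩ := (finSigmaFinEquiv (n := t)).surjective ⟨i, hi⟩
  have h1 := congrArg Fin.val h
  rw [finSigmaFinEquiv_apply] at h1
  have h2 : off t x = ∑ j : Fin x.1, t (Fin.castLE x.2.le j) := by
    unfold off
    symm
    apply Finset.sum_bij (fun (j : Fin x.1) _ => Fin.castLE x.2.le j)
    · intro j _
      simp only [Finset.mem_filter, Finset.mem_univ, true_and]
      exact Fin.lt_def.2 j.2
    · intro j _ l _ h; simpa [Fin.ext_iff] using h
    · intro y hy
      simp only [Finset.mem_filter, Finset.mem_univ, true_and] at hy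
      exact ⟨⟨y.1, hy⟩, Finset.mem_univ _, rfl⟩
    · intros; rfl
  have h3 := r.2
  simp only at h1
  refine ⟨x, ?_, ?_⟩ <;> omega

/-- the sorted word of type `t` -/
def srt (x0 : Fin a') (t : Fin a' → ℕ) (i : ℕ) : Fin a' :=
  if h : i < ∑ y, t y then (off_exists t h).choose else x0

theorem srt_spec (x0 : Fin a') (t : Fin a' → ℕ) {i : ℕ} (hi : i < ∑ y, t y) :
    off t (srt x0 t i) ≤ i ∧ i < off t (srt x0 t i) + t (srt x0 t i) := by
  unfold srt
  rw [dif_pos hi]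
  exact (off_exists t hi).choose_spec

theorem srt_of_ge (x0 : Fin a') (t : Fin a' → ℕ) {i : ℕ} (hi : ∑ y, t y ≤ i) :
    srt x0 t i = x0 := by
  unfold srt
  rw [dif_neg (by omega)]

theorem srt_off (x0 : Fin a') (t : Fin a' → ℕ) {x : Fin a'} {r : ℕ} (hr : r < t x) :
    srt x0 t (off t x + r) = x := by
  have h1 := off_le t x
  have h2 := srt_spec x0 t (i := off t x + r) (by omega)
  exact off_uniq t h2.1 h2.2 (by omega) (by omega)

theorem srt_isTy (x0 : Fin a') (t : Fin a' → ℕ) : IsTy (∑ y, t y) t (srt x0 t) := by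
  intro x
  rw [cnt_eq_card]
  have : (Finset.range (∑ y, t y)).filter (fun j => srt x0 t j = x) =
      Finset.Ico (off t x) (off t x + t x) := by
    ext j
    have h1 := off_le t x
    simp only [Finset.mem_filter, Finset.mem_range, Finset.mem_Ico]
    constructor
    · rintro ⟨h, rfl⟩; exact srt_spec x0 t h
    · rintro ⟨h2, h3⟩
      refine ⟨by omega, ?_⟩
      obtain ⟨r, rfl⟩ := Nat.exists_eq_add_of_le h2
      exact srt_off x0 t (by omega)
  rw [this]; simp

theorem srt_le (x0 : Fin a') (t : Fin a' → ℕ) {i : ℕ} (hi : i + 1 < ∑ y, t y) :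
    srt x0 t i ≤ srt x0 t (i + 1) := by
  by_contra h
  push Not at h
  have h1 := off_mono t h
  have h2 := srt_spec x0 t hi
  have h3 := srt_spec x0 t (i := i) (by omega)
  omega

theorem rk_srt (x0 : Fin a') (t : Fin a' → ℕ) {x : Fin a'} {r : ℕ} (hr : r < t x) :
    rk (srt x0 t) (off t x + r) = r := by
  unfold rk
  rw [srt_off x0 t hr]
  induction r with
  | zero =>
    rw [cnt_eq_card, Finset.card_eq_zero, Finset.filter_eq_empty_iff]
    intro j hj h
    have h1 := off_le t x
    rw [Finset.mem_range] at hj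
    have := srt_spec x0 t (i := j) (by omega)
    rw [h] at this
    omega
  | succ r ih =>
    rw [← add_assoc, cnt_succ, ih (by omega), srt_off x0 t (by omega), if_pos rfl]

/-- a weakly increasing word of type `t` is the sorted word -/
theorem sorted_eq (x0 : Fin a') {N : ℕ} {t : Fin a' → ℕ} (ht : ∑ y, t y = N) {c : ℕ → Fin a'} (hc : IsTy N t c)
    (h0 : ∀ i, N ≤ i → c i = x0) (hs : ∀ i, i + 1 < N → c i ≤ c (i + 1)) : c = srt x0 t := by
  have hm : ∀ i j, i ≤ j → j < N → c i ≤ c j := by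
    intro i j hij
    induction j, hij using Nat.le_induction with
    | base => intro _; exact le_rfl
    | succ j hj ih => intro h; exact (ih (by omega)).trans (hs j h)
  have hcard : ∀ s : Finset (Fin a'), ∑ y ∈ s, t y =
      ((Finset.range N).filter (fun j => c j ∈ s)).card := by
    intro s
    rw [Finset.card_eq_sum_card_fiberwise (f := c) (t := s) (by
      intro j hj; simp at hj; simpa using hj.2)]
    apply Finset.sum_congr rfl
    intro y hy
    rw [← hc y, cnt_eq_card, Finset.filter_filter]
    congr 1
    ext j
    simp only [Finset.mem_filter]
    constructor
    · rintro ⟨h1, rfl⟩; exact ⟨h1, hy, rfl⟩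
    · rintro ⟨h1, _, h2⟩; exact ⟨h1, h2⟩
  funext i
  rcases lt_or_ge i N with hi | hi
  · have h1 := srt_spec x0 t (i := i) (by omega)
    refine (off_uniq t h1.1 h1.2 (y := c i) ?_ ?_).symm
    · rw [off, hcard]
      calc _ ≤ (Finset.range i).card := by
            apply Finset.card_le_card
            intro j hj
            simp only [Finset.mem_filter, Finset.mem_range, Finset.mem_univ, true_and] at hj ⊢
            by_contra h
            exact absurd (hm i j (by omega) hj.1) (not_le.2 hj.2)
        _ = i := by simp
    · rw [off_add, hcard]
      calc i < (Finset.range (i + 1)).card := by simp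
        _ ≤ _ := by
            apply Finset.card_le_card
            intro j hj
            simp only [Finset.mem_filter, Finset.mem_range, Finset.mem_univ, true_and] at hj ⊢
            exact ⟨by omega, hm j i (by omega) hi⟩
  · rw [h0 i hi, srt_of_ge x0 t (by omega)]

/-- a measure decreasing when descents are removed -/
def mu (N : ℕ) (c : ℕ → Fin a') : ℕ := ∑ i ∈ Finset.range N, (N - i) * (c i).1

theorem mu_sw {N : ℕ} {c : ℕ → Fin a'} {i : ℕ} (hi : i + 1 < N) (h : c (i + 1) < c i) :
    mu N (sw i c) < mu N c := by
  have key : ∀ d : ℕ → Fin a', mu N d = (N - i) * (d i).1 + ((N - (i + 1)) * (d (i + 1)).1 +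
      ∑ j ∈ ((Finset.range N).erase i).erase (i + 1), (N - j) * (d j).1) := by
    intro d
    rw [mu, ← Finset.add_sum_erase _ _ (Finset.mem_range.2 (show i < N by omega)),
      ← Finset.add_sum_erase _ _ (show i + 1 ∈ (Finset.range N).erase i by simp; omega)]
  rw [key, key c, sw_left, sw_right]
  have : ∑ j ∈ ((Finset.range N).erase i).erase (i + 1), (N - j) * (sw i c j).1 =
      ∑ j ∈ ((Finset.range N).erase i).erase (i + 1), (N - j) * (c j).1 := by
    apply Finset.sum_congr rfl
    intro j hj
    simp only [Finset.mem_erase] at hj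
    rw [sw_of i c hj.2.1 hj.1]
  rw [this]
  obtain ⟨d, hd⟩ := Nat.exists_eq_add_of_lt hi
  have e1 : N - i = d + 2 := by omega
  have e2 : N - (i + 1) = d + 1 := by omega
  rw [e1, e2]
  have := Fin.lt_def.1 h
  nlinarith

end Sorted

section AffineLeft
variable {F A : Type*} [Field F] [Ring A] [Algebra F A]

theorem Bern3.vx {q : F} {T1 T2 x y z : A} (h : Bern3 q T1 T2 x y z) :
    Vd T1 T2 * x = z * Vd T1 T2 := by
  obtain ⟨r, rfl⟩ : ∃ r, q = r + 1 := ⟨q - 1, by ring⟩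
  have e1 := h.b1.xT; have e2 := h.b1.yT; have e3 := h.b1.tt; have e4 := h.b1.xy.symm
  have f1 := h.b2.xT; have f2 := h.b2.yT; have f3 := h.b2.tt; have f4 := h.b2.xy.symm
  have g1 := h.c1.symm; have g2 := h.c2.symm; have g3 := h.xz.symm
  rw [add_sub_cancel_right] at e1 e2 e3 f1 f2 f3
  rw [Vd]
  simp only [mul_add, add_mul, mul_sub, sub_mul, smul_mul_assoc, mul_smul_comm, mul_assoc,
    e1, e2, e3, e4, assoc3 e1, assoc3 e2, assoc3 e3, assoc3 e4,
    f1, f2, f3, f4, assoc3 f1, assoc3 f2, assoc3 f3, assoc3 f4,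
    g1, g2, g3, assoc3 g1, assoc3 g2, assoc3 g3, add_sub_cancel_right, mul_one,
    one_mul, smul_add, smul_sub, smul_smul]
  module

theorem Bern3.vy {q : F} {T1 T2 x y z : A} (h : Bern3 q T1 T2 x y z) :
    Vd T1 T2 * y = y * Vd T1 T2 := by
  obtain ⟨r, rfl⟩ : ∃ r, q = r + 1 := ⟨q - 1, by ring⟩
  have e1 := h.b1.xT; have e2 := h.b1.yT; have e3 := h.b1.tt; have e4 := h.b1.xy.symm
  have f1 := h.b2.xT; have f2 := h.b2.yT; have f3 := h.b2.tt; have f4 := h.b2.xy.symm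
  have g1 := h.c1.symm; have g2 := h.c2.symm; have g3 := h.xz.symm
  rw [add_sub_cancel_right] at e1 e2 e3 f1 f2 f3
  rw [Vd]
  simp only [mul_add, add_mul, mul_sub, sub_mul, smul_mul_assoc, mul_smul_comm, mul_assoc,
    e1, e2, e3, e4, assoc3 e1, assoc3 e2, assoc3 e3, assoc3 e4,
    f1, f2, f3, f4, assoc3 f1, assoc3 f2, assoc3 f3, assoc3 f4,
    g1, g2, g3, assoc3 g1, assoc3 g2, assoc3 g3, add_sub_cancel_right, mul_one,
    one_mul, smul_add, smul_sub, smul_smul]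
  module

theorem Bern3.vz {q : F} {T1 T2 x y z : A} (h : Bern3 q T1 T2 x y z) :
    Vd T1 T2 * z = x * Vd T1 T2 := by
  obtain ⟨r, rfl⟩ : ∃ r, q = r + 1 := ⟨q - 1, by ring⟩
  have e1 := h.b1.xT; have e2 := h.b1.yT; have e3 := h.b1.tt; have e4 := h.b1.xy.symm
  have f1 := h.b2.xT; have f2 := h.b2.yT; have f3 := h.b2.tt; have f4 := h.b2.xy.symm
  have g1 := h.c1.symm; have g2 := h.c2.symm; have g3 := h.xz.symm
  rw [add_sub_cancel_right] at e1 e2 e3 f1 f2 f3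
  rw [Vd]
  simp only [mul_add, add_mul, mul_sub, sub_mul, smul_mul_assoc, mul_smul_comm, mul_assoc,
    e1, e2, e3, e4, assoc3 e1, assoc3 e2, assoc3 e3, assoc3 e4,
    f1, f2, f3, f4, assoc3 f1, assoc3 f2, assoc3 f3, assoc3 f4,
    g1, g2, g3, assoc3 g1, assoc3 g2, assoc3 g3, add_sub_cancel_right, mul_one,
    one_mul, smul_add, smul_sub, smul_smul]
  module

theorem Bern3.vxy {q : F} {T1 T2 x y z : A} (h : Bern3 q T1 T2 x y z) :
    Vd T1 T2 * (x - y) = (z - y) * Vd T1 T2 := by rw [mul_sub, sub_mul, h.vx, h.vy]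

theorem Bern3.vxz {q : F} {T1 T2 x y z : A} (h : Bern3 q T1 T2 x y z) :
    Vd T1 T2 * (x - z) = (z - x) * Vd T1 T2 := by rw [mul_sub, sub_mul, h.vx, h.vz]

theorem Bern3.vyz {q : F} {T1 T2 x y z : A} (h : Bern3 q T1 T2 x y z) :
    Vd T1 T2 * (y - z) = (y - x) * Vd T1 T2 := by rw [mul_sub, sub_mul, h.vy, h.vz]

theorem Bern3.E1L {q : F} {T1 T2 x y z : A} (h : Bern3 q T1 T2 x y z) :
    T1 * (Ph T2 y * Ph T1 x) - Ph T2 y * Ph T1 x * T2 = (z - y) * ((z - x) * Vd T1 T2) := by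
  rw [h.E1, ← mul_assoc, h.vxy, mul_assoc, h.vxz]

theorem Bern3.E2L {q : F} {T1 T2 x y z : A} (h : Bern3 q T1 T2 x y z) :
    Ph T1 x * Ph T2 y * T1 - T2 * (Ph T1 x * Ph T2 y) = (z - x) * ((y - x) * Vd T1 T2) := by
  rw [h.E2, ← mul_assoc, h.vxz, mul_assoc, h.vyz]

theorem Bern3.E3L {q : F} {T1 T2 x y z : A} (h : Bern3 q T1 T2 x y z) :
    Ph T1 x * Ph T2 y * Ph T1 x - Ph T2 y * Ph T1 x * Ph T2 y =
      (z - y) * ((z - x) * ((y - x) * Vd T1 T2)) := by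
  rw [h.E3, ← mul_assoc, ← mul_assoc, h.vxy, mul_assoc (z - y), h.vxz, mul_assoc, mul_assoc, h.vyz]

end AffineLeft

section OffDiag
variable {F B : Type*} [Field F] [Ring B] [Algebra F B]

theorem od_ids (q : F) {x y w : B} (xy : x * y = y * x) (wx : w * x = x * w) (wy : w * y = y * w)
    (h : w * (y - x) = 1) :
    let α := (q - 1) • (w * y)
    let β := w * (q • y - x)
    let α' := (q - 1) • (-w * x)
    let β' := -w * (q • x - y)
    (α * α + β * β' = (q - 1) • α + q • (1 : B)) ∧ (α * β + β * α' = (q - 1) • β) ∧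
    (α * x = y * α - (q - 1) • y) ∧ (α * y = x * α + (q - 1) • y) ∧
    (y - x) * β = q • y - x := by
  have h1 : w * y = 1 + w * x := by rw [← h, mul_sub]; abel
  have h2 : y * w = 1 + w * x := by rw [← wy, h1]
  have h3 := wx.symm
  have h4 : x * y = y * x := xy
  refine ⟨?_, ?_, ?_, ?_, ?_⟩
  all_goals
    simp only [mul_add, add_mul, mul_sub, sub_mul, smul_mul_assoc, mul_smul_comm, neg_mul,
      mul_neg, smul_neg, smul_add, smul_sub, mul_assoc, h1, h2, h3, h4, assoc3 h1, assoc3 h2,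
      assoc3 h3, assoc3 h4, mul_one, one_mul]
    module

end OffDiag

section Rep
variable {F B ι : Type} [Field F] [Ring B] [Algebra F B]

/-- A commuting family of affine Hecke systems with separated spectra. -/
structure Sys (q' : F) (t : ι → ℕ) (l s : ι → ℕ → B) : Prop where
  aff : ∀ x, Aff q' (t x) (l x) (s x)
  ll : ∀ x y i j, l x i * l y j = l y j * l x i
  sl : ∀ x y i j, x ≠ y → s x i * l y j = l y j * s x i
  ss : ∀ x y i j, x ≠ y → s x i * s y j = s y j * s x i
  un : ∀ x y i j, x ≠ y → i < t x → j < t y → IsUnit (l y j - l x i)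
  unq : ∀ x y i j, x ≠ y → i < t x → j < t y → IsUnit (q' • l y j - l x i)

/-- diagonal element -/
def lc (l : ι → ℕ → B) (c : ℕ → ι) (i : ℕ) : B := l (c i) (rk c i)

/-- diagonal coefficient of `T` -/
def al (q' : F) (l s : ι → ℕ → B) (c : ℕ → ι) (i : ℕ) : B :=
  if c i = c (i + 1) then lc s c i
  else (q' - 1) • (Ring.inverse (lc l c (i + 1) - lc l c i) * lc l c (i + 1))

/-- off-diagonal coefficient of `T` -/
def be (q' : F) (l : ι → ℕ → B) (c : ℕ → ι) (i : ℕ) : B :=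
  if c i = c (i + 1) then 0
  else Ring.inverse (lc l c (i + 1) - lc l c i) * (q' • lc l c (i + 1) - lc l c i)

theorem comm_inverse {z d : B} (h : z * d = d * z) : z * Ring.inverse d = Ring.inverse d * z := by
  by_cases hd : IsUnit d
  · obtain ⟨u, rfl⟩ := hd
    rw [Ring.inverse_unit]
    exact (Commute.units_inv_right h : Commute z _)
  · rw [Ring.inverse_non_unit _ hd, mul_zero, zero_mul]

theorem inverse_neg' (d : B) : Ring.inverse (-d) = - Ring.inverse d := by
  by_cases hd : IsUnit d
  · obtain ⟨u, rfl⟩ := hd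
    rw [← Units.val_neg, Ring.inverse_unit, Ring.inverse_unit, inv_neg, Units.val_neg]
  · rw [Ring.inverse_non_unit _ hd, Ring.inverse_non_unit _ (by rwa [IsUnit.neg_iff]), neg_zero]

theorem lc_sw_of (l : ι → ℕ → B) (c : ℕ → ι) {i j : ℕ} (h1 : j ≠ i) (h2 : j ≠ i + 1) :
    lc l (sw i c) j = lc l c j := by
  unfold lc; rw [rk_sw_of c h1 h2, sw_of i c h1 h2]

theorem lc_sw_left (l : ι → ℕ → B) {c : ℕ → ι} {i : ℕ} (h : c i ≠ c (i + 1)) :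
    lc l (sw i c) i = lc l c (i + 1) := by
  unfold lc; rw [rk_sw_left c h, sw_left]

theorem lc_sw_right (l : ι → ℕ → B) {c : ℕ → ι} {i : ℕ} (h : c i ≠ c (i + 1)) :
    lc l (sw i c) (i + 1) = lc l c i := by
  unfold lc; rw [rk_sw_right c h, sw_right]

theorem al_sw_of (q' : F) (l s : ι → ℕ → B) (c : ℕ → ι) {i j : ℕ} (h : j + 2 ≤ i ∨ i + 2 ≤ j) :
    al q' l s (sw i c) j = al q' l s c j := by
  unfold al
  rw [lc_sw_of l c (by omega) (by omega), lc_sw_of l c (by omega) (by omega),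
    lc_sw_of s c (by omega) (by omega), sw_of i c (by omega) (by omega),
    sw_of i c (by omega) (by omega)]

theorem be_sw_of (q' : F) (l : ι → ℕ → B) (c : ℕ → ι) {i j : ℕ} (h : j + 2 ≤ i ∨ i + 2 ≤ j) :
    be q' l (sw i c) j = be q' l c j := by
  unfold be
  rw [lc_sw_of l c (by omega) (by omega), lc_sw_of l c (by omega) (by omega),
    sw_of i c (by omega) (by omega), sw_of i c (by omega) (by omega)]

variable {q' : F} {t : ι → ℕ} {l s : ι → ℕ → B} {N : ℕ} {c : ℕ → ι}

theorem Sys.llc (h : Sys q' t l s) (c : ℕ → ι) (i j : ℕ) :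
    lc l c i * lc l c j = lc l c j * lc l c i := h.ll _ _ _ _

theorem Sys.rk1 (h : Sys q' t l s) (hc : IsTy N t c) {i : ℕ} (hi : i + 1 < N)
    (he : c i = c (i + 1)) : rk c i + 1 < t (c i) := by
  rw [← rk_succ c he, he]; exact hc.rk_lt hi

theorem Sys.bernc (h : Sys q' t l s) (hc : IsTy N t c) {i : ℕ} (hi : i + 1 < N)
    (he : c i = c (i + 1)) : Bern q' (lc s c i) (lc l c i) (lc l c (i + 1)) := by
  have := (h.aff (c i)).bern _ (h.rk1 hc hi he)
  unfold lc
  rwa [rk_succ c he, ← he]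

theorem Sys.slc (h : Sys q' t l s) (hc : IsTy N t c) {i j : ℕ} (hi : i + 1 < N)
    (he : c i = c (i + 1)) (h1 : j ≠ i) (h2 : j ≠ i + 1) :
    lc s c i * lc l c j = lc l c j * lc s c i := by
  unfold lc
  by_cases hx : c i = c j
  · rw [← hx]
    refine (h.aff (c i)).TL _ _ (h.rk1 hc hi he) ?_ ?_
    · rcases lt_or_gt_of_ne h1 with h3 | h3
      · exact (rk_lt c h3 hx.symm).ne
      · exact (rk_lt c h3 hx).ne'
    · rw [← rk_succ c he]
      rcases lt_or_gt_of_ne h2 with h3 | h3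
      · exact (rk_lt c h3 (hx.symm.trans he)).ne
      · exact (rk_lt c h3 (he.symm.trans hx)).ne'
  · exact h.sl _ _ _ _ hx

theorem Sys.ssc (h : Sys q' t l s) (hc : IsTy N t c) {i j : ℕ} (hij : i + 2 ≤ j) (hj : j + 1 < N)
    (he : c i = c (i + 1)) (he' : c j = c (j + 1)) :
    lc s c i * lc s c j = lc s c j * lc s c i := by
  unfold lc
  by_cases hx : c i = c j
  · rw [← hx]
    have h1 := h.rk1 hc hj he'
    rw [← hx] at h1
    refine (h.aff (c i)).TT _ _ ?_ h1
    have := rk_lt c (show i + 1 < j by omega) (he.symm.trans hx)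
    rw [rk_succ c he] at this
    omega
  · exact h.ss _ _ _ _ hx

theorem Sys.unc (h : Sys q' t l s) (hc : IsTy N t c) {i j : ℕ} (hi : i < N) (hj : j < N)
    (he : c i ≠ c j) : IsUnit (lc l c j - lc l c i) :=
  h.un _ _ _ _ he (hc.rk_lt hi) (hc.rk_lt hj)

theorem Sys.uncq (h : Sys q' t l s) (hc : IsTy N t c) {i j : ℕ} (hi : i < N) (hj : j < N)
    (he : c i ≠ c j) : IsUnit (q' • lc l c j - lc l c i) :=
  h.unq _ _ _ _ he (hc.rk_lt hi) (hc.rk_lt hj)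

/-- anything commuting with the relevant diagonal elements commutes with the coefficients -/
theorem al_be_comm {z : B} {i : ℕ} (h1 : c i = c (i + 1) → z * lc s c i = lc s c i * z)
    (h2 : c i ≠ c (i + 1) → z * lc l c i = lc l c i * z)
    (h3 : c i ≠ c (i + 1) → z * lc l c (i + 1) = lc l c (i + 1) * z) :
    z * al q' l s c i = al q' l s c i * z ∧ z * be q' l c i = be q' l c i * z := by
  unfold al be
  by_cases he : c i = c (i + 1)
  · simp only [if_pos he, mul_zero, zero_mul, and_true]; exact h1 he
  · simp only [if_neg he]
    have e1 : Commute z (lc l c i) := h2 he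
    have e2 : Commute z (lc l c (i + 1)) := h3 he
    have e3 : Commute z (Ring.inverse (lc l c (i + 1) - lc l c i)) :=
      comm_inverse (e2.sub_right e1)
    exact ⟨((e3.mul_right e2).smul_right _).eq, (e3.mul_right ((e2.smul_right _).sub_right e1)).eq⟩

theorem Sys.lal (h : Sys q' t l s) (hc : IsTy N t c) {i j : ℕ} (hi : i + 1 < N)
    (h1 : j ≠ i) (h2 : j ≠ i + 1) :
    lc l c j * al q' l s c i = al q' l s c i * lc l c j ∧
    lc l c j * be q' l c i = be q' l c i * lc l c j :=
  al_be_comm (fun he => (h.slc hc hi he h1 h2).symm) (fun _ => h.llc _ _ _) (fun _ => h.llc _ _ _)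

theorem Sys.alal (h : Sys q' t l s) (hc : IsTy N t c) {i j : ℕ} (hij : i + 2 ≤ j) (hj : j + 1 < N) :
    (al q' l s c i * al q' l s c j = al q' l s c j * al q' l s c i ∧
    al q' l s c i * be q' l c j = be q' l c j * al q' l s c i) ∧
    be q' l c i * al q' l s c j = al q' l s c j * be q' l c i ∧
    be q' l c i * be q' l c j = be q' l c j * be q' l c i := by
  have a1 : ∀ m', m' ≠ i → m' ≠ i + 1 → _ := fun m' e1 e2 =>
    h.lal hc (i := i) (j := m') (by omega) e1 e2
  have a2 : c j = c (j + 1) → lc s c j * al q' l s c i = al q' l s c i * lc s c j ∧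
      lc s c j * be q' l c i = be q' l c i * lc s c j := fun he =>
    al_be_comm (fun he' => (h.ssc hc hij hj he' he).symm)
      (fun _ => h.slc hc hj he (by omega) (by omega)) (fun _ => h.slc hc hj he (by omega) (by omega))
  exact ⟨al_be_comm (fun he => (a2 he).1.symm) (fun _ => (a1 j (by omega) (by omega)).1.symm)
      (fun _ => (a1 (j + 1) (by omega) (by omega)).1.symm),
    al_be_comm (fun he => (a2 he).2.symm) (fun _ => (a1 j (by omega) (by omega)).2.symm)
      (fun _ => (a1 (j + 1) (by omega) (by omega)).2.symm)⟩

end Rep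

section Sym2
variable {F B : Type*} [Field F] [Ring B] [Algebra F B]

theorem Bern.sym2 {q : F} {T x y z : B} (h : Bern q T x y) (hz : T * z = z * T) (zx : z * x = x * z)
    (zy : z * y = y * z) (r r' : F) :
    T * ((r • z - r' • y) * (r • z - r' • x)) = ((r • z - r' • y) * (r • z - r' • x)) * T := by
  obtain ⟨u, rfl⟩ : ∃ r, q = r + 1 := ⟨q - 1, by ring⟩
  have e1 := h.xT; have e2 := h.yT; have e4 := h.xy.symm
  rw [add_sub_cancel_right] at e1 e2
  have g1 := hz.symm
  simp only [mul_add, add_mul, mul_sub, sub_mul, smul_mul_assoc, mul_smul_comm, mul_assoc,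
    e1, e2, e4, assoc3 e1, assoc3 e2, assoc3 e4, g1, assoc3 g1, zx, zy, assoc3 zx, assoc3 zy,
    smul_add, smul_sub, smul_smul]
  module

end Sym2

section Rep2
variable {F B ι : Type} [Field F] [Ring B] [Algebra F B]

/-- words of type `t` -/
abbrev Wd (N : ℕ) (t : ι → ℕ) := {c : ℕ → ι // IsTy N t c}

variable {N : ℕ} {t : ι → ℕ}

/-- swap on words of type `t` -/
def sws (i : ℕ) (c : Wd N t) : Wd N t := if h : i + 1 < N then ⟨sw i c.1, c.2.sw h⟩ else c

theorem sws_val {i : ℕ} (hi : i + 1 < N) (c : Wd N t) : (sws i c).1 = sw i c.1 := by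
  unfold sws; rw [dif_pos hi]

variable (N t)
/-- the operators `L` -/
def Lop (F : Type) [Field F] [Algebra F B] (l : ι → ℕ → B) (i : ℕ) : Module.End F (Wd N t → B) where
  toFun f c := lc l c.1 i * f c
  map_add' f g := by funext c; exact mul_add _ _ _
  map_smul' r f := by funext c; exact mul_smul_comm _ _ _

/-- the operators `T` -/
def Top (q' : F) (l s : ι → ℕ → B) (i : ℕ) : Module.End F (Wd N t → B) where
  toFun f c := al q' l s c.1 i * f c + be q' l c.1 i * f (sws i c)
  map_add' f g := by funext c; simp only [Pi.add_apply, mul_add]; abel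
  map_smul' r f := by
    funext c; simp only [Pi.smul_apply, mul_smul_comm, smul_add, RingHom.id_apply]
variable {N t}

theorem Lop_apply (l : ι → ℕ → B) (i : ℕ) (f : Wd N t → B) (c : Wd N t) :
    Lop N t F l i f c = lc l c.1 i * f c := rfl
theorem Top_apply (q' : F) (l s : ι → ℕ → B) (i : ℕ) (f : Wd N t → B) (c : Wd N t) :
    Top N t q' l s i f c = al q' l s c.1 i * f c + be q' l c.1 i * f (sws i c) := rfl

variable {q' : F} {l s : ι → ℕ → B}

theorem Top_diag {i : ℕ} (f : Wd N t → B) (c : Wd N t) (he : c.1 i = c.1 (i + 1)) :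
    Top N t q' l s i f c = lc s c.1 i * f c := by
  rw [Top_apply, al, be, if_pos he, if_pos he, zero_mul, add_zero]

theorem Sys.offd (h : Sys q' t l s) {i : ℕ} (hi : i + 1 < N) (c : Wd N t)
    (he : c.1 i ≠ c.1 (i + 1)) :
    let x := lc l c.1 i
    let y := lc l c.1 (i + 1)
    let α := al q' l s c.1 i
    let β := be q' l c.1 i
    let α' := al q' l s (sws i c).1 i
    let β' := be q' l (sws i c).1 i
    (α * α + β * β' = (q' - 1) • α + q' • (1 : B)) ∧ (α * β + β * α' = (q' - 1) • β) ∧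
    (α * x = y * α - (q' - 1) • y) ∧ (α * y = x * α + (q' - 1) • y) ∧
    ((y - x) * β = q' • y - x) ∧ (x * α = α * x) ∧ (x * β = β * x) ∧ y * β = β * y := by
  have hu := h.unc c.2 (show i < N by omega) hi he
  have xy := h.llc c.1 i (i + 1)
  have wx : lc l c.1 i * Ring.inverse (lc l c.1 (i + 1) - lc l c.1 i) = _ :=
    comm_inverse (by rw [mul_sub, sub_mul, xy])
  have wy : lc l c.1 (i + 1) * Ring.inverse (lc l c.1 (i + 1) - lc l c.1 i) = _ :=
    comm_inverse (by rw [mul_sub, sub_mul, xy])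
  have key := od_ids q' xy wx.symm wy.symm (Ring.inverse_mul_cancel _ hu)
  have he' : ¬ (sw i c.1 i = sw i c.1 (i + 1)) := by rw [sw_left, sw_right]; exact he.symm
  have hx : ∀ z, z * lc l c.1 i = lc l c.1 i * z → z * lc l c.1 (i + 1) = lc l c.1 (i + 1) * z →
    z * al q' l s c.1 i = al q' l s c.1 i * z ∧ z * be q' l c.1 i = be q' l c.1 i * z :=
    fun z h1 h2 => al_be_comm (fun h => absurd h he) (fun _ => h1) (fun _ => h2)
  rw [sws_val hi]
  have e1 : al q' l s (sw i c.1) i = (q' - 1) • (-Ring.inverse (lc l c.1 (i + 1) - lc l c.1 i) *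
      lc l c.1 i) := by
    rw [al, if_neg he', lc_sw_left l he, lc_sw_right l he, ← inverse_neg', neg_sub]
  have e2 : be q' l (sw i c.1) i = -Ring.inverse (lc l c.1 (i + 1) - lc l c.1 i) *
      (q' • lc l c.1 i - lc l c.1 (i + 1)) := by
    rw [be, if_neg he', lc_sw_left l he, lc_sw_right l he, ← inverse_neg', neg_sub]
  have e3 : al q' l s c.1 i = _ := if_neg he
  have e4 : be q' l c.1 i = _ := if_neg he
  intro x y α β α' β'
  refine ⟨?_, ?_, ?_, ?_, ?_, (hx _ rfl xy).1, (hx _ rfl xy).2, (hx _ xy.symm rfl).2⟩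
  · simp only [α, β, α', β', e1, e2, e3, e4]; exact key.1
  · simp only [α, β, α', β', e1, e2, e3, e4]; exact key.2.1
  · simp only [α, β, α', β', e1, e2, e3, e4]; exact key.2.2.1
  · simp only [α, β, α', β', e1, e2, e3, e4]; exact key.2.2.2.1
  · simp only [α, β, α', β', e1, e2, e3, e4]; exact key.2.2.2.2

theorem sws_sws {i : ℕ} (hi : i + 1 < N) (c : Wd N t) : sws i (sws i c) = c :=
  Subtype.ext (by rw [sws_val hi, sws_val hi, sw_sw])

theorem Sys.bernOp (h : Sys q' t l s) {i : ℕ} (hi : i + 1 < N) :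
    Bern q' (Top N t q' l s i) (Lop N t F l i) (Lop N t F l (i + 1)) := by
  refine ⟨?_, ?_, ?_, ?_⟩
  · refine LinearMap.ext fun f => funext fun c => ?_
    change Top N t q' l s i (Top N t q' l s i f) c = (q' - 1) • Top N t q' l s i f c + q' • f c
    by_cases he : c.1 i = c.1 (i + 1)
    · rw [Top_diag _ _ he, Top_diag _ _ he, ← mul_assoc, (h.bernc c.2 hi he).tt, add_mul,
        smul_mul_assoc, smul_mul_assoc, one_mul]
    · obtain ⟨k1, k2, -⟩ := h.offd hi c he
      rw [Top_apply, Top_apply, Top_apply, sws_sws hi]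
      have e1 : (q' - 1) • (al q' l s c.1 i * f c + be q' l c.1 i * f (sws i c)) + q' • f c =
          ((q' - 1) • al q' l s c.1 i + q' • 1) * f c +
            ((q' - 1) • be q' l c.1 i) * f (sws i c) := by
        simp only [add_mul, smul_mul_assoc, one_mul, smul_add]; abel
      rw [e1, ← k1, ← k2]
      simp only [mul_add, add_mul, mul_assoc]
      abel
  · refine LinearMap.ext fun f => funext fun c => ?_
    change lc l c.1 i * (lc l c.1 (i + 1) * f c) = lc l c.1 (i + 1) * (lc l c.1 i * f c)
    rw [← mul_assoc, h.llc, mul_assoc]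
  · refine LinearMap.ext fun f => funext fun c => ?_
    change Top N t q' l s i (Lop N t F l i f) c =
      lc l c.1 (i + 1) * Top N t q' l s i f c - (q' - 1) • (lc l c.1 (i + 1) * f c)
    by_cases he : c.1 i = c.1 (i + 1)
    · rw [Top_diag _ _ he, Top_diag _ _ he, Lop_apply, ← mul_assoc, (h.bernc c.2 hi he).tx, sub_mul,
        smul_mul_assoc, mul_assoc]
    · obtain ⟨-, -, k1, -, -, -, -, k2⟩ := h.offd hi c he
      rw [Top_apply, Top_apply, Lop_apply, Lop_apply, sws_val hi, lc_sw_left l he, ← mul_assoc, k1,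
        ← mul_assoc, ← k2, sub_mul, mul_add, smul_mul_assoc, mul_assoc, mul_assoc]
      abel
  · refine LinearMap.ext fun f => funext fun c => ?_
    change Top N t q' l s i (Lop N t F l (i + 1) f) c =
      lc l c.1 i * Top N t q' l s i f c + (q' - 1) • (lc l c.1 (i + 1) * f c)
    by_cases he : c.1 i = c.1 (i + 1)
    · rw [Top_diag _ _ he, Top_diag _ _ he, Lop_apply, ← mul_assoc, (h.bernc c.2 hi he).ty, add_mul,
        smul_mul_assoc, mul_assoc]
    · obtain ⟨-, -, -, k1, -, -, k2, -⟩ := h.offd hi c he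
      rw [Top_apply, Top_apply, Lop_apply, Lop_apply, sws_val hi, lc_sw_right l he, ← mul_assoc, k1,
        ← mul_assoc, ← k2, add_mul, mul_add, smul_mul_assoc, mul_assoc, mul_assoc]
      abel

theorem Sys.phOp (h : Sys q' t l s) {i : ℕ} (hi : i + 1 < N) (f : Wd N t → B) (c : Wd N t)
    (he : c.1 i ≠ c.1 (i + 1)) :
    Ph (Top N t q' l s i) (Lop N t F l i) f c =
      (q' • lc l c.1 (i + 1) - lc l c.1 i) * f (sws i c) := by
  change Top N t q' l s i (Lop N t F l i f) c - lc l c.1 i * Top N t q' l s i f c = _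
  obtain ⟨-, -, -, -, k1, k2, k3, k4⟩ := h.offd hi c he
  rw [Top_apply, Top_apply, Lop_apply, Lop_apply, sws_val hi, lc_sw_left l he, ← k1, mul_add,
    ← mul_assoc, ← k2, sub_mul, sub_mul, k4]
  simp only [mul_assoc]
  abel

end Rep2

section Rep3
variable {F B ι : Type} [Field F] [Ring B] [Algebra F B] {N : ℕ} {t : ι → ℕ}
  {q' : F} {l s : ι → ℕ → B}

theorem Sys.TLop (h : Sys q' t l s) {i j : ℕ} (hi : i + 1 < N) (h1 : j ≠ i) (h2 : j ≠ i + 1) :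
    Top N t q' l s i * Lop N t F l j = Lop N t F l j * Top N t q' l s i := by
  refine LinearMap.ext fun f => funext fun c => ?_
  change Top N t q' l s i (Lop N t F l j f) c = lc l c.1 j * Top N t q' l s i f c
  obtain ⟨k1, k2⟩ := h.lal c.2 hi h1 h2
  rw [Top_apply, Top_apply, Lop_apply, Lop_apply, sws_val hi, lc_sw_of l c.1 h1 h2, mul_add,
    ← mul_assoc, ← k1, ← mul_assoc, ← k2, mul_assoc, mul_assoc]

theorem Sys.TTop (h : Sys q' t l s) {i j : ℕ} (hij : i + 2 ≤ j) (hj : j + 1 < N) :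
    Top N t q' l s i * Top N t q' l s j = Top N t q' l s j * Top N t q' l s i := by
  refine LinearMap.ext fun f => funext fun c => ?_
  change Top N t q' l s i (Top N t q' l s j f) c = Top N t q' l s j (Top N t q' l s i f) c
  have hi : i + 1 < N := by omega
  obtain ⟨⟨k1, k2⟩, k3, k4⟩ := h.alal c.2 hij hj
  have e : sws i (sws j c) = sws j (sws i c) := Subtype.ext (by
    rw [sws_val hi, sws_val hj, sws_val hj, sws_val hi, sw_comm hij])
  simp only [Top_apply, sws_val hi, sws_val hj, al_sw_of q' l s c.1 (Or.inl hij),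
    al_sw_of q' l s c.1 (Or.inr hij), be_sw_of q' l c.1 (Or.inl hij),
    be_sw_of q' l c.1 (Or.inr hij), mul_add, ← mul_assoc, k1, k2, k3, k4, e]
  abel

theorem Sys.bern3Op (h : Sys q' t l s) {i : ℕ} (hi : i + 2 < N) :
    Bern3 q' (Top N t q' l s i) (Top N t q' l s (i + 1)) (Lop N t F l i) (Lop N t F l (i + 1))
      (Lop N t F l (i + 2)) := by
  refine ⟨h.bernOp (by omega), h.bernOp (by omega), h.TLop (by omega) (by omega) (by omega),
    h.TLop (by omega) (by omega) (by omega), ?_⟩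
  refine LinearMap.ext fun f => funext fun c => ?_
  change lc l c.1 i * (lc l c.1 (i + 2) * f c) = lc l c.1 (i + 2) * (lc l c.1 i * f c)
  rw [← mul_assoc, h.llc, mul_assoc]

/-- The braid defect vanishes at words `xxz`. -/
theorem Sys.vd1 (h : Sys q' t l s) {i : ℕ} (hi : i + 2 < N) (c : Wd N t)
    (h1 : c.1 i = c.1 (i + 1)) (h2 : c.1 (i + 1) ≠ c.1 (i + 2)) (f : Wd N t → B) :
    Vd (Top N t q' l s i) (Top N t q' l s (i + 1)) f c = 0 := by
  have hi1 : i + 1 < N := by omega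
  have hi2 : i + 1 + 1 < N := by omega
  have hE := congrFun (LinearMap.congr_fun (h.bern3Op hi).E1L f) c
  set V := Vd (Top N t q' l s i) (Top N t q' l s (i + 1))
  have hR : _ = (lc l c.1 (i + 2) - lc l c.1 (i + 1)) * ((lc l c.1 (i + 2) - lc l c.1 i) * V f c) :=
    hE.trans (by
      change lc l c.1 (i + 2) * (lc l c.1 (i + 2) * _ - lc l c.1 i * _) -
        lc l c.1 (i + 1) * (lc l c.1 (i + 2) * _ - lc l c.1 i * _) = _
      rw [sub_mul, sub_mul])
  have hu1 := h.unc c.2 hi1 hi h2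
  have hu2 := h.unc c.2 (show i < N by omega) hi (by rw [h1]; exact h2)
  have hL : (Top N t q' l s i * (Ph (Top N t q' l s (i + 1)) (Lop N t F l (i + 1)) *
      Ph (Top N t q' l s i) (Lop N t F l i)) - Ph (Top N t q' l s (i + 1)) (Lop N t F l (i + 1)) *
      Ph (Top N t q' l s i) (Lop N t F l i) * Top N t q' l s (i + 1)) f c = 0 := by
    change Top N t q' l s i (Ph (Top N t q' l s (i + 1)) (Lop N t F l (i + 1))
      (Ph (Top N t q' l s i) (Lop N t F l i) f)) c - Ph (Top N t q' l s (i + 1)) (Lop N t F l (i + 1))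
      (Ph (Top N t q' l s i) (Lop N t F l i) (Top N t q' l s (i + 1) f)) c = 0
    have a1 : (sws (i + 1) c).1 i ≠ (sws (i + 1) c).1 (i + 1) := by
      rw [sws_val hi2, sw_left, sw_of _ _ (by omega) (by omega), h1]; exact h2
    have a2 : (sws i (sws (i + 1) c)).1 (i + 1) = (sws i (sws (i + 1) c)).1 (i + 1 + 1) := by
      rw [sws_val hi1, sws_val hi2, sw_right, sw_of _ _ (by omega) (by omega),
        sw_of _ _ (by omega) (by omega), sw_right, h1]
    rw [Top_diag _ _ h1, h.phOp hi2 _ _ h2, h.phOp hi2 _ _ h2, h.phOp hi1 _ _ a1,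
      h.phOp hi1 _ _ a1, Top_diag _ _ a2]
    have a3 : lc s (sws i (sws (i + 1) c)).1 (i + 1) = lc s c.1 i := by
      rw [sws_val hi1, lc_sw_right s a1, sws_val hi2, lc_sw_of s _ (by omega) (by omega)]
    have a4 : lc l (sws (i + 1) c).1 (i + 1) = lc l c.1 (i + 2) := by
      rw [sws_val hi2, lc_sw_left l h2]
    have a5 : lc l (sws (i + 1) c).1 i = lc l c.1 i := by
      rw [sws_val hi2, lc_sw_of l _ (by omega) (by omega)]
    rw [a3, a4, a5]
    have := (h.bernc c.2 hi1 h1).sym2 (h.slc c.2 hi1 h1 (j := i + 2) (by omega) (by omega))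
      (h.llc _ _ _) (h.llc _ _ _) q' 1
    rw [one_smul, one_smul] at this
    rw [← mul_assoc, ← mul_assoc, mul_assoc (lc s c.1 i)]
    change lc s c.1 i * ((q' • lc l c.1 (i + 2) - _) * _) * _ - _ = (0 : B)
    rw [this]
    simp only [mul_assoc]
    exact sub_self _
  rw [hL] at hR
  exact (hu2.mul_right_eq_zero.1 (hu1.mul_right_eq_zero.1 hR.symm))

/-- The braid defect vanishes at words `xzz`. -/
theorem Sys.vd2 (h : Sys q' t l s) {i : ℕ} (hi : i + 2 < N) (c : Wd N t)
    (h1 : c.1 i ≠ c.1 (i + 1)) (h2 : c.1 (i + 1) = c.1 (i + 2)) (f : Wd N t → B) :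
    Vd (Top N t q' l s i) (Top N t q' l s (i + 1)) f c = 0 := by
  have hi1 : i + 1 < N := by omega
  have hi2 : i + 1 + 1 < N := by omega
  have hE := congrFun (LinearMap.congr_fun (h.bern3Op hi).E2L f) c
  set V := Vd (Top N t q' l s i) (Top N t q' l s (i + 1))
  have hR : _ = (lc l c.1 (i + 2) - lc l c.1 i) * ((lc l c.1 (i + 1) - lc l c.1 i) * V f c) :=
    hE.trans (by
      change lc l c.1 (i + 2) * (lc l c.1 (i + 1) * _ - lc l c.1 i * _) -
        lc l c.1 i * (lc l c.1 (i + 1) * _ - lc l c.1 i * _) = _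
      rw [sub_mul, sub_mul])
  have hu1 := h.unc c.2 (show i < N by omega) hi1 h1
  have hu2 := h.unc c.2 (show i < N by omega) hi (by rw [← h2]; exact h1)
  have hL : (Ph (Top N t q' l s i) (Lop N t F l i) *
      Ph (Top N t q' l s (i + 1)) (Lop N t F l (i + 1)) * Top N t q' l s i -
      Top N t q' l s (i + 1) * (Ph (Top N t q' l s i) (Lop N t F l i) *
      Ph (Top N t q' l s (i + 1)) (Lop N t F l (i + 1)))) f c = 0 := by
    change Ph (Top N t q' l s i) (Lop N t F l i) (Ph (Top N t q' l s (i + 1)) (Lop N t F l (i + 1))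
      (Top N t q' l s i f)) c - Top N t q' l s (i + 1) (Ph (Top N t q' l s i) (Lop N t F l i)
      (Ph (Top N t q' l s (i + 1)) (Lop N t F l (i + 1)) f)) c = 0
    have a1 : (sws i c).1 (i + 1) ≠ (sws i c).1 (i + 1 + 1) := by
      rw [sws_val hi1, sw_right, sw_of _ _ (by omega) (by omega)]; exact h2 ▸ h1
    have a2 : (sws (i + 1) (sws i c)).1 i = (sws (i + 1) (sws i c)).1 (i + 1) := by
      rw [sws_val hi2, sws_val hi1, sw_of (i := i + 1) (j := i) _ (by omega) (by omega),
        sw_left i, sw_left (i + 1), sw_of (i := i) (j := i + 1 + 1) _ (by omega) (by omega), h2]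
    rw [Top_diag _ _ h2, h.phOp hi1 _ _ h1, h.phOp hi1 _ _ h1, h.phOp hi2 _ _ a1,
      h.phOp hi2 _ _ a1, Top_diag _ _ a2]
    have a3 : lc s (sws (i + 1) (sws i c)).1 i = lc s c.1 (i + 1) := by
      rw [sws_val hi2, lc_sw_of s _ (by omega) (by omega), sws_val hi1, lc_sw_left s h1]
    have a4 : lc l (sws i c).1 (i + 1) = lc l c.1 i := by
      rw [sws_val hi1, lc_sw_right l h1]
    have a5 : lc l (sws i c).1 (i + 1 + 1) = lc l c.1 (i + 2) := by
      rw [sws_val hi1, lc_sw_of l _ (by omega) (by omega)]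
    rw [a3, a4, a5]
    have := (h.bernc c.2 hi2 h2).sym2 (h.slc c.2 hi2 h2 (j := i) (by omega) (by omega))
      (h.llc _ _ _) (h.llc _ _ _) (-1) (-q')
    have e1 : ∀ z, (-1 : F) • lc l c.1 i - (-q') • z = q' • z - lc l c.1 i := fun z => by module
    rw [e1, e1] at this
    have e2 : (q' • lc l c.1 (i + 2) - lc l c.1 i) * (q' • lc l c.1 (i + 1) - lc l c.1 i) =
      (q' • lc l c.1 (i + 1) - lc l c.1 i) * (q' • lc l c.1 (i + 2) - lc l c.1 i) := by
      have k1 := h.llc c.1 (i + 1) (i + 2)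
      have k2 := h.llc c.1 i (i + 2)
      have k3 := h.llc c.1 i (i + 1)
      simp only [mul_sub, sub_mul, smul_mul_assoc, mul_smul_comm, k1, k2, k3]; module
    change lc s c.1 (i + 1) * ((q' • lc l c.1 (i + 2) - lc l c.1 i) * (q' • lc l c.1 (i + 1) - lc l c.1 i)) =
      ((q' • lc l c.1 (i + 2) - lc l c.1 i) * (q' • lc l c.1 (i + 1) - lc l c.1 i)) *
        lc s c.1 (i + 1) at this
    rw [e2] at this
    rw [← mul_assoc _ _ (f _), ← mul_assoc _ _ (f _), ← mul_assoc _ _ (f _), ← mul_assoc _ _ (f _),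
      ← mul_assoc _ _ (lc s c.1 (i + 1)), this, sub_self]
  rw [hL] at hR
  exact (hu1.mul_right_eq_zero.1 (hu2.mul_right_eq_zero.1 hR.symm))

/-- The braid defect vanishes at words `xyx`. -/
theorem Sys.vd3 (h : Sys q' t l s) {i : ℕ} (hi : i + 2 < N) (c : Wd N t)
    (h1 : c.1 i = c.1 (i + 2)) (h2 : c.1 (i + 1) ≠ c.1 (i + 2)) (f : Wd N t → B) :
    Vd (Top N t q' l s i) (Top N t q' l s (i + 1)) f c = 0 := by
  have hi2 : i + 1 + 1 < N := by omega
  have hE := congrFun (LinearMap.congr_fun (h.bern3Op hi).E4 f) (sws (i + 1) c)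
  have a0 : (sws (i + 1) c).1 (i + 1) ≠ (sws (i + 1) c).1 (i + 1 + 1) := by
    rw [sws_val hi2, sw_right, sw_left]; exact h2.symm
  have hL := h.vd1 hi (sws (i + 1) c) (by
    rw [sws_val hi2, sw_left, sw_of _ _ (by omega) (by omega)]; exact h1) a0
      (Ph (Top N t q' l s i) (Lop N t F l i) f)
  have hE' := hL.symm.trans hE
  have hE2 := hE'.trans (h.phOp hi2 _ _ a0)
  rw [sws_sws hi2] at hE2
  exact (h.uncq (sws (i + 1) c).2 (by omega) hi2 a0).mul_right_eq_zero.1 hE2.symm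

/-- The braid defect vanishes at words `xyz`. -/
theorem Sys.vd4 (h : Sys q' t l s) {i : ℕ} (hi : i + 2 < N) (c : Wd N t)
    (h1 : c.1 i ≠ c.1 (i + 1)) (h2 : c.1 (i + 1) ≠ c.1 (i + 2)) (h3 : c.1 i ≠ c.1 (i + 2))
    (f : Wd N t → B) :
    Vd (Top N t q' l s i) (Top N t q' l s (i + 1)) f c = 0 := by
  have hi1 : i + 1 < N := by omega
  have hi2 : i + 1 + 1 < N := by omega
  have hE := congrFun (LinearMap.congr_fun (h.bern3Op hi).E3L f) c
  set V := Vd (Top N t q' l s i) (Top N t q' l s (i + 1))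
  have hR : _ = (lc l c.1 (i + 2) - lc l c.1 (i + 1)) * ((lc l c.1 (i + 2) - lc l c.1 i) *
      ((lc l c.1 (i + 1) - lc l c.1 i) * V f c)) :=
    hE.trans (by
      change lc l c.1 (i + 2) * (lc l c.1 (i + 2) * (lc l c.1 (i + 1) * _ - lc l c.1 i * _) -
        lc l c.1 i * (lc l c.1 (i + 1) * _ - lc l c.1 i * _)) -
        lc l c.1 (i + 1) * (lc l c.1 (i + 2) * (lc l c.1 (i + 1) * _ - lc l c.1 i * _) -
        lc l c.1 i * (lc l c.1 (i + 1) * _ - lc l c.1 i * _)) = _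
      rw [sub_mul, sub_mul, sub_mul])
  have hu1 := h.unc c.2 (show i < N by omega) hi1 h1
  have hu2 := h.unc c.2 (show i < N by omega) hi h3
  have hu3 := h.unc c.2 hi1 hi h2
  have hL : (Ph (Top N t q' l s i) (Lop N t F l i) *
      Ph (Top N t q' l s (i + 1)) (Lop N t F l (i + 1)) * Ph (Top N t q' l s i) (Lop N t F l i) -
      Ph (Top N t q' l s (i + 1)) (Lop N t F l (i + 1)) * Ph (Top N t q' l s i) (Lop N t F l i) *
      Ph (Top N t q' l s (i + 1)) (Lop N t F l (i + 1))) f c = 0 := by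
    change Ph (Top N t q' l s i) (Lop N t F l i) (Ph (Top N t q' l s (i + 1)) (Lop N t F l (i + 1))
      (Ph (Top N t q' l s i) (Lop N t F l i) f)) c -
      Ph (Top N t q' l s (i + 1)) (Lop N t F l (i + 1)) (Ph (Top N t q' l s i) (Lop N t F l i)
      (Ph (Top N t q' l s (i + 1)) (Lop N t F l (i + 1)) f)) c = 0
    have d1 : (sws i c).1 (i + 1) ≠ (sws i c).1 (i + 1 + 1) := by
      rw [sws_val hi1, sw_right, sw_of _ _ (by omega) (by omega)]; exact h3
    have d2 : (sws (i + 1) (sws i c)).1 i ≠ (sws (i + 1) (sws i c)).1 (i + 1) := by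
      rw [sws_val hi2, sws_val hi1, sw_of (i := i + 1) (j := i) _ (by omega) (by omega),
        sw_left i, sw_left (i + 1), sw_of (i := i) (j := i + 1 + 1) _ (by omega) (by omega)]; exact h2
    have b1 : (sws (i + 1) c).1 i ≠ (sws (i + 1) c).1 (i + 1) := by
      rw [sws_val hi2, sw_left, sw_of _ _ (by omega) (by omega)]; exact h3
    have b2 : (sws i (sws (i + 1) c)).1 (i + 1) ≠ (sws i (sws (i + 1) c)).1 (i + 1 + 1) := by
      rw [sws_val hi1, sws_val hi2, sw_right, sw_of _ _ (by omega) (by omega),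
        sw_of _ _ (by omega) (by omega), sw_right]; exact h1
    rw [h.phOp hi1 _ _ h1, h.phOp hi2 _ _ d1, h.phOp hi1 _ _ d2, h.phOp hi2 _ _ h2,
      h.phOp hi1 _ _ b1, h.phOp hi2 _ _ b2]
    have e : sws i (sws (i + 1) (sws i c)) = sws (i + 1) (sws i (sws (i + 1) c)) :=
      Subtype.ext (by simp only [sws_val hi1, sws_val hi2, sw_braid])
    have u1 : lc l (sws i c).1 (i + 1) = lc l c.1 i := by rw [sws_val hi1, lc_sw_right l h1]
    have u2 : lc l (sws i c).1 (i + 1 + 1) = lc l c.1 (i + 2) := by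
      rw [sws_val hi1, lc_sw_of l _ (by omega) (by omega)]
    have u3 : lc l (sws (i + 1) (sws i c)).1 (i + 1) = lc l c.1 (i + 2) := by
      rw [sws_val hi2, lc_sw_left l d1, u2]
    have u4 : lc l (sws (i + 1) (sws i c)).1 i = lc l c.1 (i + 1) := by
      rw [sws_val hi2, lc_sw_of l _ (by omega) (by omega), sws_val hi1, lc_sw_left l h1]
    have v1 : lc l (sws (i + 1) c).1 (i + 1) = lc l c.1 (i + 2) := by
      rw [sws_val hi2, lc_sw_left l h2]
    have v2 : lc l (sws (i + 1) c).1 i = lc l c.1 i := by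
      rw [sws_val hi2, lc_sw_of l _ (by omega) (by omega)]
    have v3 : lc l (sws i (sws (i + 1) c)).1 (i + 1) = lc l c.1 i := by
      rw [sws_val hi1, lc_sw_right l b1, v2]
    have v4 : lc l (sws i (sws (i + 1) c)).1 (i + 1 + 1) = lc l c.1 (i + 1) := by
      rw [sws_val hi1, lc_sw_of l _ (by omega) (by omega), sws_val hi2, lc_sw_right l h2]
    rw [e, u1, u2, u3, u4, v1, v2, v3, v4]
    have k1 : lc l c.1 (i + 1 + 1) * lc l c.1 (i + 1) = _ := h.llc c.1 (i + 1 + 1) (i + 1)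
    have k2 : lc l c.1 (i + 1 + 1) * lc l c.1 i = _ := h.llc c.1 (i + 1 + 1) (i)
    have k3 : lc l c.1 (i + 1) * lc l c.1 i = _ := h.llc c.1 (i + 1) i
    change _ * ((q' • lc l c.1 (i + 1 + 1) - _) * ((q' • lc l c.1 (i + 1 + 1) - _) * _)) -
      _ * ((q' • lc l c.1 (i + 1 + 1) - _) * _) = (0 : B)
    simp only [mul_sub, sub_mul, smul_mul_assoc, mul_smul_comm, mul_assoc, k1, k2, k3, assoc3 k1,
      assoc3 k2, assoc3 k3, smul_sub]
    abel
  rw [hL] at hR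
  exact hu1.mul_right_eq_zero.1 (hu2.mul_right_eq_zero.1 (hu3.mul_right_eq_zero.1 hR.symm))

theorem Sys.affOp (h : Sys q' t l s) : Aff q' N (Lop N t F l) (Top N t q' l s) where
  bern i hi := h.bernOp hi
  LL i j := by
    refine LinearMap.ext fun f => funext fun c => ?_
    change lc l c.1 i * (lc l c.1 j * f c) = lc l c.1 j * (lc l c.1 i * f c)
    rw [← mul_assoc, h.llc, mul_assoc]
  TL i j hi h1 h2 := h.TLop hi h1 h2
  TT i j hij hj := h.TTop hij hj
  br i hi := by
    symm
    rw [← sub_eq_zero]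
    refine LinearMap.ext fun f => funext fun c => ?_
    change Vd (Top N t q' l s i) (Top N t q' l s (i + 1)) f c = 0
    by_cases h1 : c.1 i = c.1 (i + 1)
    · by_cases h2 : c.1 (i + 1) = c.1 (i + 2)
      · change Top N t q' l s i (Top N t q' l s (i + 1) (Top N t q' l s i f)) c -
          Top N t q' l s (i + 1) (Top N t q' l s i (Top N t q' l s (i + 1) f)) c = 0
        rw [Top_diag _ _ h1, Top_diag _ _ h2, Top_diag _ _ h1, Top_diag _ _ h2, Top_diag _ _ h1,
          Top_diag _ _ h2]
        have h3 := h.rk1 c.2 (show i + 1 + 1 < N by omega) h2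
        rw [rk_succ c.1 h1, ← h1] at h3
        have h4 := (h.aff (c.1 i)).br _ h3
        have e1 : lc s c.1 (i + 1) = s (c.1 i) (rk c.1 i + 1) := by
          rw [lc, rk_succ c.1 h1, ← h1]
        rw [e1, lc, ← mul_assoc, ← mul_assoc, ← mul_assoc, ← mul_assoc, h4, sub_self]
      · exact h.vd1 hi c h1 h2 f
    · by_cases h2 : c.1 (i + 1) = c.1 (i + 2)
      · exact h.vd2 hi c h1 h2 f
      · by_cases h3 : c.1 i = c.1 (i + 2)
        · exact h.vd3 hi c h3 h2 f
        · exact h.vd4 hi c h1 h2 h3 f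

end Rep3

section Lev
open Polynomial
variable {F A : Type} [Field F] [Ring A] [Algebra F A] {L T : ℕ → A}

/-- Evaluation of multivariate polynomials at a commuting family. -/
theorem exists_lev (L : ℕ → A) (h : ∀ i j, L i * L j = L j * L i) :
    ∃ φ : MvPolynomial ℕ F →ₐ[F] A, ∀ i, φ (MvPolynomial.X i) = L i := by
  have hc : ∀ a ∈ Set.range L, ∀ b ∈ Set.range L, a * b = b * a := by
    rintro _ ⟨i, rfl⟩ _ ⟨j, rfl⟩; exact h i j
  letI : CommRing (Algebra.adjoin F (Set.range L)) := Algebra.adjoinCommRingOfComm F hc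
  let ψ : MvPolynomial ℕ F →ₐ[F] (Algebra.adjoin F (Set.range L)) :=
    MvPolynomial.aeval (fun i => (⟨L i, Algebra.subset_adjoin ⟨i, rfl⟩⟩ :
      (Algebra.adjoin F (Set.range L))))
  refine ⟨(Algebra.adjoin F (Set.range L)).val.comp ψ, fun i => ?_⟩
  rw [AlgHom.comp_apply, MvPolynomial.aeval_X]
  rfl

/-- Evaluation of multivariate polynomials at a commuting family (junk otherwise). -/
def Lev (F : Type) [Field F] [Algebra F A] (L : ℕ → A) (h : ∀ i j, L i * L j = L j * L i) :
    MvPolynomial ℕ F →ₐ[F] A := (exists_lev L h).choose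

theorem Lev_X (h : ∀ i j, L i * L j = L j * L i) (i : ℕ) :
    Lev F L h (MvPolynomial.X i) = L i := (exists_lev L h).choose_spec i

theorem Lev_aeval (h : ∀ i j, L i * L j = L j * L i) (i : ℕ) (f : F[X]) :
    Lev F L h (aeval (MvPolynomial.X i) f) = aeval (L i) f := by
  rw [← aeval_algHom_apply, Lev_X]

theorem Lev_comm (h : ∀ i j, L i * L j = L j * L i) (f g : MvPolynomial ℕ F) :
    Lev F L h f * Lev F L h g = Lev F L h g * Lev F L h f := by
  rw [← map_mul, mul_comm, map_mul]

theorem Lev_semi (h : ∀ i j, L i * L j = L j * L i) {z : A} {σ : ℕ → ℕ}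
    (hz : ∀ i, z * L i = L (σ i) * z) (f : MvPolynomial ℕ F) :
    z * Lev F L h f = Lev F L h (MvPolynomial.rename σ f) * z := by
  induction f using MvPolynomial.induction_on with
  | C r =>
    rw [MvPolynomial.rename_C, ← MvPolynomial.algebraMap_eq, AlgHom.commutes, Algebra.commutes]
  | add f g hf hg => rw [map_add, map_add, map_add, mul_add, add_mul, hf, hg]
  | mul_X f i hf =>
    rw [map_mul, map_mul, map_mul, Lev_X, MvPolynomial.rename_X, Lev_X, ← mul_assoc, hf, mul_assoc,
      hz, mul_assoc]

end Lev

section HDsec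
open Polynomial
variable {F A ι : Type} [Field F] [Ring A] [Algebra F A] [Fintype ι]

/-- The ambient Hecke data. -/
structure HD (q' : F) (N : ℕ) (G P : ι → F[X]) (L T : ℕ → A) : Prop where
  hq : q' ≠ 0
  aff : Aff q' N L T
  pd : PD q' N G P
  cy : 0 < N → aeval (L 0) (∏ x, G x) = 0

variable {q' : F} {N : ℕ} {G P : ι → F[X]} {L T : ℕ → A}

/-- idempotent polynomial of a word -/
def EE (N : ℕ) (P : ι → F[X]) (c : ℕ → ι) : MvPolynomial ℕ F :=
  ∏ i ∈ Finset.range N, aeval (MvPolynomial.X i) (P (c i))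

/-- idempotent of a word -/
def HD.e (h : HD q' N G P L T) (c : ℕ → ι) : A := Lev F L h.aff.LL (EE N P c)

theorem HD.ph_L (h : HD q' N G P L T) {i : ℕ} (hi : i + 1 < N) (j : ℕ) :
    Ph (T i) (L i) * L j = L (Equiv.swap i (i + 1) j) * Ph (T i) (L i) := by
  by_cases h1 : j = i
  · subst h1; rw [Equiv.swap_apply_left]; exact (h.aff.bern j hi).ph_x
  by_cases h2 : j = i + 1
  · subst h2; rw [Equiv.swap_apply_right]; exact (h.aff.bern i hi).ph_y
  rw [Equiv.swap_apply_of_ne_of_ne h1 h2]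
  exact (ph_comm (h.aff.TL i j hi h1 h2).symm (h.aff.LL _ _)).symm

theorem EE_sw (P : ι → F[X]) {i N : ℕ} (hi : i + 1 < N) (c : ℕ → ι) :
    MvPolynomial.rename (Equiv.swap i (i + 1)) (EE N P c) = EE N P (sw i c) := by
  unfold EE
  rw [map_prod]
  refine Finset.prod_bij (fun j _ => Equiv.swap i (i + 1) j) ?_ ?_ ?_ ?_
  · intro j hj
    rw [Finset.mem_range] at hj ⊢
    rw [Equiv.swap_apply_def]; split_ifs <;> omega
  · intro j _ j' _ hjj; exact (Equiv.swap i (i + 1)).injective hjj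
  · intro j hj
    refine ⟨Equiv.swap i (i + 1) j, ?_, by simp⟩
    rw [Finset.mem_range] at hj ⊢
    rw [Equiv.swap_apply_def]; split_ifs <;> omega
  · intro j hj
    rw [← aeval_algHom_apply, MvPolynomial.rename_X]
    simp [sw]

theorem HD.ph_e (h : HD q' N G P L T) {i : ℕ} (hi : i + 1 < N) (c : ℕ → ι) :
    Ph (T i) (L i) * h.e c = h.e (sw i c) * Ph (T i) (L i) := by
  rw [HD.e, Lev_semi h.aff.LL (h.ph_L hi), EE_sw P hi]; rfl

theorem HD.e_L (h : HD q' N G P L T) (c : ℕ → ι) (i : ℕ) : h.e c * L i = L i * h.e c := by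
  rw [HD.e, ← Lev_X (F := F) h.aff.LL i, Lev_comm]

theorem HD.e_aeval (h : HD q' N G P L T) (c : ℕ → ι) (i : ℕ) (f : F[X]) :
    h.e c * aeval (L i) f = aeval (L i) f * h.e c := by
  rw [HD.e, ← Lev_aeval h.aff.LL i, Lev_comm]

theorem HD.T_e (h : HD q' N G P L T) {i : ℕ} (hi : i + 1 < N) {c : ℕ → ι} (hc : c i = c (i + 1)) :
    T i * h.e c = h.e c * T i := by
  have h1 : EE N P c = (aeval (MvPolynomial.X i) (P (c i)) * aeval (MvPolynomial.X (i + 1)) (P (c i)))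
      * ∏ j ∈ ((Finset.range N).erase i).erase (i + 1), aeval (MvPolynomial.X j) (P (c j)) := by
    unfold EE
    rw [← Finset.mul_prod_erase (Finset.range N) _ (Finset.mem_range.2 (show i < N by omega)),
      ← Finset.mul_prod_erase ((Finset.range N).erase i) _ (show i + 1 ∈ _ by simp; omega), ← hc]
    ring
  have h2 : ∀ s : Finset ℕ, i ∉ s → i + 1 ∉ s → T i * Lev F L h.aff.LL (∏ j ∈ s,
      aeval (MvPolynomial.X j) (P (c j))) = Lev F L h.aff.LL (∏ j ∈ s,
      aeval (MvPolynomial.X j) (P (c j))) * T i := by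
    intro s
    induction s using Finset.induction_on with
    | empty => simp
    | insert j s hj ih =>
      intro a1 a2
      simp only [Finset.mem_insert, not_or] at a1 a2
      rw [Finset.prod_insert hj, map_mul, Lev_aeval, ← mul_assoc,
        semi_aeval (h.aff.TL i j hi (Ne.symm a1.1) (Ne.symm a2.1)), mul_assoc, ih a1.2 a2.2, mul_assoc]
  rw [HD.e, h1, map_mul, map_mul, Lev_aeval, Lev_aeval, ← mul_assoc, (h.aff.bern i hi).sym, mul_assoc,
    h2 _ (by simp) (by simp)]
  simp only [mul_assoc]

theorem HD.ann0 (h : HD q' N G P L T) {i : ℕ} (hi : i < N) :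
    aeval (L i) (∏ x, fam q' (G x) N) = 0 := by
  rw [← fam_prod]; exact h.aff.ann h.hq _ h.cy i hi le_rfl

theorem HD.Porth (h : HD q' N G P L T) {i : ℕ} (hi : i < N) {x y : ι} (hxy : x ≠ y) :
    aeval (L i) (P x) * aeval (L i) (P y) = 0 := by
  rw [← map_mul]; exact aeval_dvd (h.pd.orth x y hxy) (h.ann0 hi)

theorem HD.Psum (h : HD q' N G P L T) (i : ℕ) : ∑ x, aeval (L i) (P x) = 1 := by
  rw [← map_sum, h.pd.sum, map_one]

theorem HD.Pidem (h : HD q' N G P L T) {i : ℕ} (hi : i < N) (x : ι) :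
    aeval (L i) (P x) * aeval (L i) (P x) = aeval (L i) (P x) := by
  conv_rhs => rw [← mul_one (aeval (L i) (P x)), ← h.Psum i, Finset.mul_sum]
  rw [Finset.sum_eq_single x (fun y _ hy => h.Porth hi (Ne.symm hy)) (by simp)]

theorem HD.e_split (h : HD q' N G P L T) {i : ℕ} (hi : i < N) (c : ℕ → ι) :
    ∃ r, h.e c = aeval (L i) (P (c i)) * r ∧ h.e c = r * aeval (L i) (P (c i)) := by
  have h1 : EE N P c = aeval (MvPolynomial.X i) (P (c i)) *
      ∏ j ∈ (Finset.range N).erase i, aeval (MvPolynomial.X j) (P (c j)) :=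
    (Finset.mul_prod_erase (Finset.range N) _ (Finset.mem_range.2 hi)).symm
  refine ⟨Lev F L h.aff.LL (∏ j ∈ (Finset.range N).erase i, aeval (MvPolynomial.X j) (P (c j))), ?_, ?_⟩
  · rw [HD.e, h1, map_mul, Lev_aeval]
  · rw [HD.e, h1, mul_comm, map_mul, Lev_aeval]

theorem HD.Pe (h : HD q' N G P L T) {i : ℕ} (hi : i < N) (c : ℕ → ι) :
    aeval (L i) (P (c i)) * h.e c = h.e c := by
  obtain ⟨r, hr, -⟩ := h.e_split hi c
  rw [hr, ← mul_assoc, h.Pidem hi]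

theorem HD.e_orth (h : HD q' N G P L T) {i : ℕ} (hi : i < N) {c d : ℕ → ι} (hcd : c i ≠ d i) :
    h.e c * h.e d = 0 := by
  obtain ⟨r, -, hr⟩ := h.e_split hi c
  obtain ⟨r', hr', -⟩ := h.e_split hi d
  rw [hr, hr', mul_assoc, ← mul_assoc _ _ r', h.Porth hi hcd, zero_mul, mul_zero]

theorem HD.e_idem (h : HD q' N G P L T) (c : ℕ → ι) : h.e c * h.e c = h.e c := by
  have : ∀ s : Finset ℕ, (∀ i ∈ s, i < N) → Lev F L h.aff.LL (∏ j ∈ s,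
      aeval (MvPolynomial.X j) (P (c j))) * h.e c = h.e c := by
    intro s
    induction s using Finset.induction_on with
    | empty => intro _; simp
    | insert j s hj ih =>
      intro hs
      rw [Finset.prod_insert hj, map_mul, mul_assoc, ih (fun i hi => hs i (Finset.mem_insert_of_mem hi)),
        Lev_aeval, h.Pe (hs j (Finset.mem_insert_self _ _))]
  exact this _ (fun i hi => Finset.mem_range.1 hi)

theorem HD.e_ann (h : HD q' N G P L T) {i : ℕ} (hi : i < N) (c : ℕ → ι) :
    aeval (L i) (fam q' (G (c i)) N) * h.e c = 0 := by
  obtain ⟨r, hr, -⟩ := h.e_split hi c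
  rw [hr, ← mul_assoc, ← map_mul, aeval_dvd (h.pd.self (c i)) (h.ann0 hi), zero_mul]

theorem HD.e_congr (h : HD q' N G P L T) {c d : ℕ → ι} (hcd : ∀ i < N, c i = d i) :
    h.e c = h.e d := by
  unfold HD.e EE
  rw [Finset.prod_congr rfl fun i hi => by rw [hcd i (Finset.mem_range.1 hi)]]

/-- extend a finite word -/
def xt (x0 : ι) {N : ℕ} (f : Fin N → ι) (i : ℕ) : ι := if h : i < N then f ⟨i, h⟩ else x0

theorem HD.e_sum (h : HD q' N G P L T) (x0 : ι) : ∑ f : Fin N → ι, h.e (xt x0 f) = 1 := by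
  unfold HD.e
  rw [← map_sum]
  have : ∑ f : Fin N → ι, EE N P (xt x0 f) = 1 := by
    have h1 : ∀ f : Fin N → ι, EE N P (xt x0 f) =
        ∏ i : Fin N, aeval (MvPolynomial.X (i : ℕ) : MvPolynomial ℕ F) (P (f i)) := by
      intro f
      unfold EE
      rw [Finset.prod_range]
      refine Finset.prod_congr rfl fun i _ => ?_
      rw [xt, dif_pos i.2]
    rw [Finset.sum_congr rfl fun f _ => h1 f]
    have h2 := Finset.prod_univ_sum (fun _ : Fin N => (Finset.univ : Finset ι))
      (fun i x => aeval (MvPolynomial.X (i : ℕ) : MvPolynomial ℕ F) (P x))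
    rw [Fintype.piFinset_univ] at h2
    refine Eq.trans (by convert h2.symm) ?_
    refine Finset.prod_eq_one fun i _ => ?_
    rw [← map_sum, h.pd.sum, map_one]
  rw [this, map_one]

end HDsec

section HDinv
open Polynomial
variable {F A ι : Type} [Field F] [Ring A] [Algebra F A] [Fintype ι]
variable {q' : F} {N : ℕ} {G P : ι → F[X]} {L T : ℕ → A}

theorem HD.inv (h : HD q' N G P L T) {i j : ℕ} (hi : i < N) (hj : j < N) {c : ℕ → ι}
    (hc : c i ≠ c j) : ∃ w ∈ Algebra.adjoin F {L i, L j}, w * (L i - L j) * h.e c = h.e c :=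
  h.pd.winv hc (h.aff.LL i j) (h.e_ann hi c) (h.e_ann hj c)

theorem HD.invq (h : HD q' N G P L T) {i j : ℕ} (hi : i < N) (hj : j < N) {c : ℕ → ι}
    (hc : c i ≠ c j) : ∃ w ∈ Algebra.adjoin F {L i, L j}, w * (q' • L i - L j) * h.e c = h.e c :=
  h.pd.winvq h.hq hc (h.aff.LL i j) (h.e_ann hi c) (h.e_ann hj c)

theorem HD.invsq (h : HD q' N G P L T) {i : ℕ} (hi : i + 1 < N) {c : ℕ → ι}
    (hc : c i ≠ c (i + 1)) :
    ∃ w, w * (Ph (T i) (L i) * Ph (T i) (L i)) * h.e c = h.e c := by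
  obtain ⟨w1, -, h1⟩ := h.invq (show i < N by omega) hi hc
  obtain ⟨w2, -, h2⟩ := h.invq hi (show i < N by omega) hc.symm
  refine ⟨w2 * w1, ?_⟩
  rw [(h.aff.bern i hi).ph_sq]
  have h3 : (q' • L (i + 1) - L i) * h.e c = h.e c * (q' • L (i + 1) - L i) := by
    rw [sub_mul, mul_sub, smul_mul_assoc, mul_smul_comm, h.e_L, h.e_L]
  calc w2 * w1 * ((q' • L i - L (i + 1)) * (q' • L (i + 1) - L i)) * h.e c
      = w2 * (w1 * (q' • L i - L (i + 1)) * ((q' • L (i + 1) - L i) * h.e c)) := by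
        simp only [mul_assoc]
    _ = w2 * (w1 * (q' • L i - L (i + 1)) * h.e c * (q' • L (i + 1) - L i)) := by
        rw [h3]; simp only [mul_assoc]
    _ = _ := by rw [h1, ← h3, ← mul_assoc, h2]

theorem G_dvd_fam (q' : F) (f : F[X]) (N : ℕ) : f ∣ fam q' f N := by
  have h0 : fam q' f 0 ∣ fam q' f N := fam_dvd q' f (Nat.zero_le N)
  rwa [fam] at h0

theorem HD.cyc (h : HD q' N G P L T) {i : ℕ} (hi : i < N) {c : ℕ → ι}
    (hc : ∀ j < i, c j ≠ c i) : aeval (L i) (G (c i)) * h.e c = 0 := by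
  induction i generalizing c with
  | zero =>
    have h0 := h.cy hi
    rw [← Finset.mul_prod_erase Finset.univ G (Finset.mem_univ (c 0))] at h0
    have hcop : IsCoprime (∏ y ∈ Finset.univ.erase (c 0), G y) (fam q' (G (c 0)) N) := by
      refine IsCoprime.prod_left fun y hy => ?_
      have hd : G y ∣ fam q' (G y) N := G_dvd_fam q' (G y) N
      have hcp := h.pd.cop y (c 0) (Finset.ne_of_mem_erase hy)
      exact IsCoprime.of_isCoprime_of_dvd_left hcp hd
    obtain ⟨α, β, hab⟩ := hcop
    have e1 : G (c 0) = α * (G (c 0) * ∏ y ∈ Finset.univ.erase (c 0), G y) +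
        G (c 0) * β * fam q' (G (c 0)) N := by
      conv_lhs => rw [← mul_one (G (c 0)), ← hab]
      ring
    rw [e1, map_add, map_mul, h0, mul_zero, zero_add, map_mul, mul_assoc, h.e_ann hi, mul_zero]
  | succ i ih =>
    have hne : c i ≠ c (i + 1) := hc i (by omega)
    have h1 := ih (c := sw i c) (by omega) (fun j hj => by
      rw [sw_left, sw_of i c (by omega) (by omega)]; exact hc j (by omega))
    rw [sw_left] at h1
    have h2 : Ph (T i) (L i) * (aeval (L (i + 1)) (G (c (i + 1))) * h.e c) = 0 := by
      rw [← mul_assoc, semi_aeval (h.aff.bern i hi).ph_y, mul_assoc, h.ph_e hi, ← mul_assoc, h1,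
        zero_mul]
    obtain ⟨w, hw⟩ := h.invsq hi hne
    rw [← h.e_aeval]
    calc h.e c * aeval (L (i + 1)) (G (c (i + 1)))
        = w * (Ph (T i) (L i) * Ph (T i) (L i)) * h.e c * aeval (L (i + 1)) (G (c (i + 1))) := by
          rw [hw]
      _ = w * (Ph (T i) (L i) * (Ph (T i) (L i) * (aeval (L (i + 1)) (G (c (i + 1))) * h.e c))) := by
          rw [← h.e_aeval]; simp only [mul_assoc]
      _ = 0 := by rw [h2, mul_zero, mul_zero]

end HDinv

section HDU
open Polynomial
variable {F A : Type} [Field F] [Ring A] [Algebra F A] {a' : ℕ}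
variable {q' : F} {N : ℕ} {G P : Fin a' → F[X]} {L T : ℕ → A}

/-- The intertwining elements. -/
inductive IsU (N : ℕ) (L T : ℕ → A) (x0 : Fin a') (t : Fin a' → ℕ) (e0 : A) :
    (ℕ → Fin a') → A → Prop
  | base : IsU N L T x0 t e0 (srt x0 t) e0
  | step {c : ℕ → Fin a'} {u : A} {i : ℕ} (hu : IsU N L T x0 t e0 c u) (hi : i + 1 < N)
      (hc : c i < c (i + 1)) : IsU N L T x0 t e0 (sw i c) (Ph (T i) (L i) * u)

variable {x0 : Fin a'} {t : Fin a' → ℕ} {e0 u : A} {c : ℕ → Fin a'}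

theorem IsU.step' {i : ℕ} (hu : IsU N L T x0 t e0 (sw i c) u) (hi : i + 1 < N)
    (hc : c (i + 1) < c i) : IsU N L T x0 t e0 c (Ph (T i) (L i) * u) := by
  have := hu.step hi (by rw [sw_left, sw_right]; exact hc)
  rwa [sw_sw] at this

theorem IsU.cases' (hu : IsU N L T x0 t e0 c u) : (c = srt x0 t ∧ u = e0) ∨
    ∃ i w, i + 1 < N ∧ c (i + 1) < c i ∧ IsU N L T x0 t e0 (sw i c) w ∧ u = Ph (T i) (L i) * w := by
  cases hu with
  | base => exact Or.inl ⟨rfl, rfl⟩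
  | @step c u i hu hi hc =>
    refine Or.inr ⟨i, u, hi, ?_, ?_, rfl⟩
    · rw [sw_left, sw_right]; exact hc
    · rwa [sw_sw]

theorem IsU.ty (ht : ∑ y, t y = N) (hu : IsU N L T x0 t e0 c u) : IsTy N t c := by
  induction hu with
  | base => subst ht; exact srt_isTy x0 t
  | step hu hi hc ih => exact ih.sw hi

theorem IsU.tail (ht : ∑ y, t y = N) (hu : IsU N L T x0 t e0 c u) : ∀ i, N ≤ i → c i = x0 := by
  induction hu with
  | base => subst ht; exact fun i hi => srt_of_ge x0 t hi
  | step hu hi hc ih =>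
    intro j hj
    rw [sw_of _ _ (by omega) (by omega)]; exact ih j hj

theorem IsU.exists (ht : ∑ y, t y = N) (e0 : A) (L T : ℕ → A) :
    ∀ c, IsTy N t c → (∀ i, N ≤ i → c i = x0) → ∃ u, IsU N L T x0 t e0 c u := by
  intro c
  induction hk : mu N c using Nat.strong_induction_on generalizing c with
  | _ k ih =>
  intro hc h0
  by_cases hs : ∀ i, i + 1 < N → c i ≤ c (i + 1)
  · rw [sorted_eq x0 ht hc h0 hs]; exact ⟨_, IsU.base⟩
  · push Not at hs
    obtain ⟨i, hi, hlt⟩ := hs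
    obtain ⟨u, hu⟩ := ih _ (hk ▸ mu_sw hi hlt) (sw i c) rfl (hc.sw hi) (fun j hj => by
      rw [sw_of _ _ (by omega) (by omega)]; exact h0 j hj)
    exact ⟨_, hu.step' hi hlt⟩

theorem Aff.phph (h : Aff q' N L T) {i j : ℕ} (hij : i + 2 ≤ j) (hj : j + 1 < N) :
    Ph (T i) (L i) * Ph (T j) (L j) = Ph (T j) (L j) * Ph (T i) (L i) := by
  refine ph_comm ?_ ?_
  · exact (ph_comm (h.TT i j hij hj).symm (h.TL j i hj (by omega) (by omega))).symm
  · exact (ph_comm (h.TL i j (by omega) (by omega) (by omega)).symm (h.LL _ _)).symm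

theorem Aff.bern3 (h : Aff q' N L T) {i : ℕ} (hi : i + 2 < N) :
    Bern3 q' (T i) (T (i + 1)) (L i) (L (i + 1)) (L (i + 2)) :=
  ⟨h.bern i (by omega), h.bern (i + 1) hi, h.TL i (i + 2) (by omega) (by omega) (by omega),
    h.TL (i + 1) i (by omega) (by omega) (by omega), h.LL _ _⟩

theorem Aff.vd (h : Aff q' N L T) {i : ℕ} (hi : i + 2 < N) : Vd (T i) (T (i + 1)) = 0 :=
  sub_eq_zero.2 (h.br i hi).symm

theorem Aff.phbr (h : Aff q' N L T) {i : ℕ} (hi : i + 2 < N) :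
    Ph (T i) (L i) * (Ph (T (i + 1)) (L (i + 1)) * Ph (T i) (L i)) =
    Ph (T (i + 1)) (L (i + 1)) * (Ph (T i) (L i) * Ph (T (i + 1)) (L (i + 1))) := by
  have := (h.bern3 hi).E3
  rw [h.vd hi, zero_mul, sub_eq_zero] at this
  simpa only [mul_assoc] using this

theorem IsU.uniq (h : Aff q' N L T) (ht : ∑ y, t y = N) :
    ∀ c u u', IsU N L T x0 t e0 c u → IsU N L T x0 t e0 c u' → u = u' := by
  intro c
  induction hk : mu N c using Nat.strong_induction_on generalizing c with
  | _ k ih =>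
  have key : ∀ i j w w', i < j → i + 1 < N → c (i + 1) < c i → IsU N L T x0 t e0 (sw i c) w →
      j + 1 < N → c (j + 1) < c j → IsU N L T x0 t e0 (sw j c) w' →
      Ph (T i) (L i) * w = Ph (T j) (L j) * w' := by
    intro i j w w' hij hi hci hw hj hcj hw'
    have ty := hw.ty ht
    have tl := hw.tail ht
    by_cases h2 : i + 2 ≤ j
    · obtain ⟨z, hz⟩ := IsU.exists (x0 := x0) ht e0 L T (sw j (sw i c)) (ty.sw hj)
        (fun l hl => by rw [sw_of _ _ (by omega) (by omega)]; exact tl l hl)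
      have e1 := ih _ (hk ▸ mu_sw hi hci) (sw i c) rfl w _ hw (hz.step' hj (by
        rw [sw_of _ _ (by omega) (by omega), sw_of _ _ (by omega) (by omega)]; exact hcj))
      rw [← sw_comm h2] at hz
      have e2 := ih _ (hk ▸ mu_sw hj hcj) (sw j c) rfl w' _ hw' (hz.step' hi (by
        rw [sw_of _ _ (by omega) (by omega), sw_of _ _ (by omega) (by omega)]; exact hci))
      rw [e1, e2, ← mul_assoc, ← mul_assoc, h.phph h2 hj]
    · obtain rfl : j = i + 1 := by omega
      obtain ⟨z, hz⟩ := IsU.exists (x0 := x0) ht e0 L T (sw i (sw (i + 1) (sw i c))) ((ty.sw hj).sw hi)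
        (fun l hl => by
          rw [sw_of i _ (by omega) (by omega), sw_of (i + 1) _ (by omega) (by omega)]; exact tl l hl)
      have e1 := ih _ (hk ▸ mu_sw hi hci) (sw i c) rfl w _ hw ((hz.step' hi (by
        rw [sw_left (i + 1), sw_of (i + 1) _ (by omega) (by omega), sw_left i,
          sw_of i _ (by omega) (by omega)]; exact hcj)).step' hj (by
        rw [sw_right i, sw_of i _ (by omega) (by omega)]; exact hcj.trans hci))
      rw [sw_braid] at hz
      have e2 := ih _ (hk ▸ mu_sw hj hcj) (sw (i + 1) c) rfl w' _ hw' ((hz.step' hj (by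
        rw [sw_right i, sw_of i _ (by omega) (by omega), sw_right (i + 1),
          sw_of (i + 1) _ (by omega) (by omega)]; exact hci)).step' hi (by
        rw [sw_left (i + 1), sw_of (i + 1) _ (by omega) (by omega)]; exact hcj.trans hci))
      rw [e1, e2, ← mul_assoc (Ph (T (i + 1)) (L (i + 1))), ← mul_assoc (Ph (T i) (L i)),
        h.phbr (by omega)]
      simp only [mul_assoc]
  have nos : ∀ i, i + 1 < N → c (i + 1) < c i → c ≠ srt x0 t := by
    rintro i hi hlt rfl
    exact absurd (srt_le x0 t (ht ▸ hi)) (not_le.2 hlt)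
  intro u u' hu hu'
  rcases hu.cases' with ⟨hc, rfl⟩ | ⟨i, w, hi, hci, hw, rfl⟩
  · rcases hu'.cases' with ⟨-, rfl⟩ | ⟨j, w', hj, hcj, hw', rfl⟩
    · rfl
    · exact absurd hc (nos j hj hcj)
  · rcases hu'.cases' with ⟨hc, -⟩ | ⟨j, w', hj, hcj, hw', rfl⟩
    · exact absurd hc (nos i hi hci)
    · rcases lt_trichotomy i j with hij | hij | hij
      · exact key i j w w' hij hi hci hw hj hcj hw'
      · subst hij
        rw [ih _ (hk ▸ mu_sw hi hci) (sw i c) rfl w w' hw hw']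
      · exact (key j i w' w hij hj hcj hw' hi hci hw).symm

theorem IsU.desc (h : Aff q' N L T) (ht : ∑ y, t y = N) (hu : IsU N L T x0 t e0 c u) {i : ℕ}
    (hi : i + 1 < N) (hc : c (i + 1) < c i) :
    ∃ w, IsU N L T x0 t e0 (sw i c) w ∧ u = Ph (T i) (L i) * w := by
  obtain ⟨w, hw⟩ := IsU.exists (x0 := x0) ht e0 L T (sw i c) ((hu.ty ht).sw hi)
    (fun l hl => by rw [sw_of _ _ (by omega) (by omega)]; exact hu.tail ht l hl)
  exact ⟨w, hw, IsU.uniq h ht c _ _ hu (hw.step' hi hc)⟩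

/-- target position -/
def pos (t : Fin a' → ℕ) (c : ℕ → Fin a') (i : ℕ) : ℕ := off t (c i) + rk c i

theorem pos_srt (x0 : Fin a') (ht : ∑ y, t y = N) {i : ℕ} (hi : i < N) : pos t (srt x0 t) i = i := by
  obtain ⟨h1, h2⟩ := srt_spec x0 t (i := i) (ht ▸ hi)
  have h3 := rk_srt x0 t (x := srt x0 t i) (r := i - off t (srt x0 t i)) (by omega)
  rw [Nat.add_sub_cancel' h1] at h3
  unfold pos
  rw [h3]; omega

theorem pos_sw_of (t : Fin a' → ℕ) (c : ℕ → Fin a') {i j : ℕ} (h1 : j ≠ i) (h2 : j ≠ i + 1) :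
    pos t (sw i c) j = pos t c j := by
  unfold pos; rw [sw_of i c h1 h2, rk_sw_of c h1 h2]
theorem pos_sw_left (t : Fin a' → ℕ) {c : ℕ → Fin a'} {i : ℕ} (h : c i ≠ c (i + 1)) :
    pos t (sw i c) i = pos t c (i + 1) := by
  unfold pos; rw [sw_left, rk_sw_left c h]
theorem pos_sw_right (t : Fin a' → ℕ) {c : ℕ → Fin a'} {i : ℕ} (h : c i ≠ c (i + 1)) :
    pos t (sw i c) (i + 1) = pos t c i := by
  unfold pos; rw [sw_right, rk_sw_right c h]

theorem IsU.slideL (h : HD q' N G P L T) (ht : ∑ y, t y = N)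
    (hu : IsU N L T x0 t (h.e (srt x0 t)) c u) : ∀ i, i < N → L i * u = u * L (pos t c i) := by
  induction hu with
  | base => intro i hi; rw [pos_srt x0 ht hi, h.e_L]
  | @step c u i hu hi hc ih =>
    intro j hj
    have hne : c i ≠ c (i + 1) := ne_of_lt hc
    by_cases h1 : j = i
    · subst h1
      rw [pos_sw_left t hne, ← mul_assoc, ← (h.aff.bern j hi).ph_y, mul_assoc, ih _ hi, mul_assoc]
    by_cases h2 : j = i + 1
    · subst h2
      rw [pos_sw_right t hne, ← mul_assoc, ← (h.aff.bern i hi).ph_x, mul_assoc, ih _ (by omega),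
        mul_assoc]
    have := h.ph_L hi j
    rw [Equiv.swap_apply_of_ne_of_ne h1 h2] at this
    rw [pos_sw_of t c h1 h2, ← mul_assoc, ← this, mul_assoc, ih _ hj, mul_assoc]

theorem IsU.eu (h : HD q' N G P L T) (hu : IsU N L T x0 t (h.e (srt x0 t)) c u) :
    h.e c * u = u := by
  induction hu with
  | base => exact h.e_idem _
  | @step c u i hu hi hc ih => rw [← mul_assoc, ← h.ph_e hi, mul_assoc, ih]

theorem IsU.ue (h : HD q' N G P L T) (hu : IsU N L T x0 t (h.e (srt x0 t)) c u) :
    u * h.e (srt x0 t) = u := by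
  induction hu with
  | base => exact h.e_idem _
  | @step c u i hu hi hc ih => rw [mul_assoc, ih]

theorem IsU.slideT (h : HD q' N G P L T) (ht : ∑ y, t y = N) :
    ∀ c u, IsU N L T x0 t (h.e (srt x0 t)) c u → ∀ i, i + 1 < N → c i = c (i + 1) →
      T i * u = u * T (pos t c i) := by
  intro c
  induction hk : mu N c using Nat.strong_induction_on generalizing c with
  | _ k ih =>
  intro u hu i hi hci
  rcases hu.cases' with ⟨rfl, rfl⟩ | ⟨j, w, hj, hcj, hw, rfl⟩
  · rw [pos_srt x0 ht (by omega), h.T_e hi hci]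
  · have hne : c j ≠ c (j + 1) := ne_of_gt hcj
    have hij : j ≠ i := by rintro rfl; exact hne hci
    have m1 := hk ▸ mu_sw hj hcj
    by_cases h1 : j = i + 1
    · subst h1
      obtain ⟨z, hz, rfl⟩ := hw.desc h.aff ht hi (by
        rw [sw_left (i + 1), sw_of (i + 1) _ (by omega) (by omega), hci]; exact hcj)
      have m2 : mu N (sw i (sw (i + 1) c)) < mu N (sw (i + 1) c) := mu_sw hi (by
        rw [sw_left (i + 1), sw_of (i + 1) _ (by omega) (by omega), hci]; exact hcj)
      have hne2 : sw (i + 1) c i ≠ sw (i + 1) c (i + 1) := by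
        rw [sw_left (i + 1), sw_of (i + 1) _ (by omega) (by omega), hci]; exact hne
      have e1 := ih _ (m2.trans m1) _ rfl z hz (i + 1) hj (by
        rw [sw_right i, sw_of (i + 1) _ (by omega) (by omega), sw_of i _ (by omega) (by omega),
          sw_right (i + 1), hci])
      rw [pos_sw_right t hne2, pos_sw_of t c (by omega) (by omega)] at e1
      have e2 := (h.aff.bern3 (i := i) (by omega)).E1
      rw [h.aff.vd (by omega), zero_mul, sub_eq_zero] at e2
      rw [← mul_assoc (Ph _ _), ← mul_assoc, e2, mul_assoc, e1]
      simp only [mul_assoc]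
    by_cases h2 : i = j + 1
    · subst h2
      obtain ⟨z, hz, rfl⟩ := hw.desc h.aff ht hi (by
        rw [sw_right j, sw_of j _ (by omega) (by omega), ← hci]; exact hcj)
      have m2 : mu N (sw (j + 1) (sw j c)) < mu N (sw j c) := mu_sw hi (by
        rw [sw_right j, sw_of j _ (by omega) (by omega), ← hci]; exact hcj)
      have hne2 : sw j c (j + 1) ≠ sw j c (j + 1 + 1) := by
        rw [sw_right j, sw_of j _ (by omega) (by omega), ← hci]; exact hne
      have e1 := ih _ (m2.trans m1) _ rfl z hz j hj (by
        rw [sw_left (j + 1), sw_of (j + 1) _ (by omega) (by omega), sw_left j,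
          sw_of j _ (by omega) (by omega), hci])
      rw [pos_sw_of t _ (by omega) (by omega), pos_sw_left t hne] at e1
      have e2 := (h.aff.bern3 (i := j) (by omega)).E2
      rw [h.aff.vd (by omega), zero_mul, sub_eq_zero] at e2
      rw [← mul_assoc (Ph _ _), ← mul_assoc, ← e2, mul_assoc, e1]
      simp only [mul_assoc]
    · have e1 := ih _ m1 _ rfl w hw i hi (by
        rw [sw_of j _ (by omega) (by omega), sw_of j _ (by omega) (by omega), hci])
      rw [pos_sw_of t c (by omega) (by omega)] at e1
      have e2 : T i * Ph (T j) (L j) = Ph (T j) (L j) * T i := by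
        refine ph_comm ?_ (h.aff.TL i j hi (by omega) (by omega))
        rcases lt_or_ge i j with h3 | h3
        · exact h.aff.TT i j (by omega) hj
        · exact (h.aff.TT j i (by omega) hi).symm
      rw [← mul_assoc, e2, mul_assoc, e1, mul_assoc]

end HDU

section Tens
variable {F R : Type} [Field F] [Ring R] [Algebra F R] {a' : ℕ} {A : Fin a' → Type}
  [∀ i, Ring (A i)] [∀ i, Algebra F (A i)]

theorem ofFn_comm {n' : ℕ} {z : R} {f : Fin n' → R} (h : ∀ i, Commute z (f i)) :
    Commute z (List.ofFn f).prod := by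
  refine Commute.list_prod_right _ _ fun y hy => ?_
  obtain ⟨i, rfl⟩ := List.mem_ofFn.1 hy
  exact h i

theorem ofFn_mul {n' : ℕ} (f g : Fin n' → R) (h : ∀ i j, i ≠ j → Commute (f i) (g j)) :
    (List.ofFn fun i => f i * g i).prod = (List.ofFn f).prod * (List.ofFn g).prod := by
  induction n' with
  | zero => simp
  | succ n' ih =>
    rw [List.ofFn_succ, List.ofFn_succ, List.ofFn_succ, List.prod_cons, List.prod_cons,
      List.prod_cons, ih (fun i => f i.succ) (fun i => g i.succ)
        (fun i j hij => h _ _ (by simpa using hij))]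
    have h1 : Commute (g 0) (List.ofFn fun i : Fin n' => f i.succ).prod :=
      ofFn_comm fun i => (h _ _ (Fin.succ_ne_zero i)).symm
    rw [mul_assoc, ← mul_assoc (g 0), h1.eq]
    simp only [mul_assoc]

theorem ofFn_one {n' : ℕ} : (List.ofFn fun _ : Fin n' => (1 : R)).prod = 1 := by
  induction n' with
  | zero => simp
  | succ n' ih => rw [List.ofFn_succ, List.prod_cons, ih, one_mul]

theorem ofFn_single {n' : ℕ} (f : Fin n' → R) (i : Fin n') (h : ∀ j, j ≠ i → f j = 1) :
    (List.ofFn f).prod = f i := by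
  induction n' with
  | zero => exact i.elim0
  | succ n' ih =>
    rw [List.ofFn_succ, List.prod_cons]
    rcases Fin.eq_zero_or_eq_succ i with rfl | ⟨j, rfl⟩
    · have : (fun i : Fin n' => f i.succ) = fun _ => 1 := by
        funext j; exact h _ (Fin.succ_ne_zero j)
      rw [this, ofFn_one, mul_one]
    · rw [h 0 (Fin.succ_ne_zero j).symm, one_mul, ih (fun i => f i.succ) j
        (fun l hl => h _ (by simpa using hl))]

theorem exists_comb (Ψ : ∀ i, A i →ₐ[F] R)
    (hc : ∀ i j, i ≠ j → ∀ x y, Commute (Ψ i x) (Ψ j y)) :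
    ∃ Φ : (⨂[F] i, A i) →ₐ[F] R, ∀ i x, Φ (PiTensorProduct.singleAlgHom i x) = Ψ i x := by
  let f : MultilinearMap F A R :=
    (MultilinearMap.mkPiAlgebraFin F a' R).compLinearMap (fun i => (Ψ i).toLinearMap)
  have hf : ∀ m : Π i, A i, f m = (List.ofFn fun i => Ψ i (m i)).prod := fun m => rfl
  refine ⟨PiTensorProduct.liftAlgHom f ?_ ?_, ?_⟩
  · rw [hf]; simp only [Pi.one_apply, map_one]; exact ofFn_one
  · intro x y
    simp only [hf, Pi.mul_apply, map_mul]
    exact ofFn_mul _ _ fun i j hij => hc i j hij _ _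
  · intro i x
    have h1 : (PiTensorProduct.singleAlgHom i x : ⨂[F] i, A i) =
      PiTensorProduct.tprod F (Pi.mulSingle i x) := rfl
    rw [h1, PiTensorProduct.liftAlgHom_apply, PiTensorProduct.lift.tprod, hf,
      ofFn_single _ i (fun j hj => by rw [Pi.mulSingle_eq_of_ne hj, map_one]),
      Pi.mulSingle_eq_same]

theorem tens_induct (S : Subalgebra F (⨂[F] i, A i))
    (h : ∀ i x, PiTensorProduct.singleAlgHom i x ∈ S) (z : ⨂[F] i, A i) : z ∈ S := by
  induction z using PiTensorProduct.induction_on with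
  | smul_tprod r f =>
    refine S.smul_mem ?_ r
    have h1 : f ∈ S.toSubmonoid.comap (PiTensorProduct.tprodMonoidHom F) := by
      rw [← Finset.noncommProd_mulSingle f]
      exact Submonoid.noncommProd_mem _ _ _ _ fun i _ => h i (f i)
    exact h1
  | add x y hx hy => exact S.add_mem hx hy

theorem single_comm {i j : Fin a'} (hij : i ≠ j) (x : A i) (y : A j) :
    (PiTensorProduct.singleAlgHom i x : ⨂[F] i, A i) * PiTensorProduct.singleAlgHom j y =
      PiTensorProduct.singleAlgHom j y * PiTensorProduct.singleAlgHom i x :=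
  (Commute.tprod (Pi.mulSingle_commute hij x y)).eq

end Tens

section Psi
open Polynomial
variable {F A : Type} [Field F] [Ring A] [Algebra F A]

/-- `a` on the corner, a scalar off it. -/
def mix (e a : A) (α : F) : A := a * e + α • (1 - e)

theorem mix_mul {e a b : A} (he : e * e = e) (hb : e * b = b * e) (α β : F) :
    mix e a α * mix e b β = mix e (a * b) (α * β) := by
  have h1 : (1 - e) * (b * e) = 0 := by
    rw [← hb, ← mul_assoc, sub_mul, one_mul, he, sub_self, zero_mul]
  have h2 : e * (1 - e) = 0 := by rw [mul_sub, mul_one, he, sub_self]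
  have h3 : (1 - e) * (1 - e) = 1 - e := by rw [sub_mul, one_mul, h2, sub_zero]
  have h4 : a * e * (b * e) = a * b * e := by
    rw [mul_assoc, ← mul_assoc e, hb, mul_assoc b, he, mul_assoc]
  unfold mix
  rw [add_mul, mul_add, mul_add, h4, mul_smul_comm, mul_assoc a e (1 - e), h2, mul_zero, smul_zero, add_zero,
    smul_mul_assoc, h1, smul_zero, zero_add, smul_mul_smul_comm, h3]

theorem mix_comm {e a b : A} (he : e * e = e) (ha : e * a = a * e) (hb : e * b = b * e)
    (hab : a * b = b * a) (α β : F) : mix e a α * mix e b β = mix e b β * mix e a α := by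
  rw [mix_mul he hb, mix_mul he ha, hab, mul_comm α]

theorem mix_add {e a b : A} (α β : F) : mix e a α + mix e b β = mix e (a + b) (α + β) := by
  unfold mix; rw [add_mul, add_smul]; abel

theorem mix_smul {e a : A} (r α : F) : r • mix e a α = mix e (r • a) (r * α) := by
  unfold mix; rw [smul_add, smul_mul_assoc, smul_smul]

theorem mix_one (e : A) : mix e 1 (1 : F) = 1 := by unfold mix; rw [one_mul, one_smul]; abel

theorem mix_e {e a : A} (he : e * e = e) (α : F) : mix e a α * e = a * e := by
  unfold mix
  rw [add_mul, mul_assoc, he, smul_mul_assoc, sub_mul, one_mul, he, sub_self, smul_zero, add_zero]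

theorem e_mix {e a : A} (ha : e * a = a * e) (α : F) : e * mix e a α = mix e a α * e := by
  unfold mix
  rw [mul_add, add_mul, ← mul_assoc, ha, mul_smul_comm, smul_mul_assoc, mul_sub, sub_mul, one_mul,
    mul_one]

theorem mix_aeval {e a : A} (he : e * e = e) (ha : e * a = a * e) (α : F) (f : F[X]) :
    aeval (mix e a α) f = mix e (aeval a f) (f.eval α) := by
  induction f using Polynomial.induction_on with
  | C r =>
    rw [aeval_C, aeval_C, eval_C, Algebra.algebraMap_eq_smul_one]
    conv_lhs => rw [← mix_one (F := F) e, mix_smul, mul_one]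
  | add f g hf hg => rw [map_add, map_add, eval_add, hf, hg, mix_add]
  | monomial i r h =>
    rw [pow_succ, ← mul_assoc, map_mul, map_mul (aeval a), eval_mul, h, aeval_X, aeval_X, eval_X,
      mix_mul he ha]

variable {a' : ℕ} {q' : F} {N : ℕ} {G P : Fin a' → F[X]} {L T : ℕ → A} {x0 : Fin a'}
  {t : Fin a' → ℕ}

theorem srt_T (h : HD q' N G P L T) (ht : ∑ y, t y = N) {x : Fin a'} {r : ℕ} (hr : r + 1 < t x) :
    h.e (srt x0 t) * T (off t x + r) = T (off t x + r) * h.e (srt x0 t) := by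
  have h1 := off_le t x
  refine (h.T_e (by omega) ?_).symm
  rw [srt_off x0 t (by omega), add_assoc, srt_off x0 t hr]

theorem HD.cyc_srt (h : HD q' N G P L T) (ht : ∑ y, t y = N) {x : Fin a'} (hx : 0 < t x) :
    aeval (L (off t x)) (G x) * h.e (srt x0 t) = 0 := by
  have h1 := off_le t x
  have h3 : srt x0 t (off t x) = x := srt_off x0 t (r := 0) hx
  have h2 := h.cyc (i := off t x) (by omega) (c := srt x0 t) (fun j hj => by
    rw [h3]; intro h4
    have h5 := srt_spec x0 t (i := j) (by omega)
    rw [h4] at h5; omega)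
  rwa [h3] at h2

theorem Bern.braid4 {q : F} {S x y : A} (h : Bern q S x y) : x * S * x * S = S * x * S * x := by
  have h1 := h.tlt
  rw [mul_assoc, mul_assoc, ← mul_assoc S, h1, mul_smul_comm, smul_mul_assoc, h.xy]

theorem exists_Psi (h : HD q' N G P L T) (x0 : Fin a') (ht : ∑ y, t y = N) (x : Fin a') {M : ℕ}
    (w : Fin M → F) (hG : G x = ∏ j, (X - C (w j))) (j0 : Fin M) :
    ∃ Ψ : CH F M (t x) w q' →ₐ[F] A,
      (0 < t x → Ψ (hL M (t x) w q' 0) = mix (h.e (srt x0 t)) (L (off t x)) (w j0)) ∧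
      ∀ r, r + 1 < t x → Ψ (hT M (t x) w q' r) = mix (h.e (srt x0 t)) (T (off t x + r)) q' := by
  have he := h.e_idem (srt x0 t)
  have h1 := off_le t x
  have hL := fun i => h.e_L (srt x0 t) i
  refine ch_lift _ (fun r => mix (h.e (srt x0 t)) (T (off t x + r)) q') ?_ ?_ ?_ ?_ ?_ ?_
  · intro hx
    rw [← hG, mix_aeval he (hL _)]
    have h2 : (G x).eval (w j0) = 0 := by
      rw [hG, eval_prod]; exact Finset.prod_eq_zero (Finset.mem_univ j0) (by simp)
    rw [h2, mix, h.cyc_srt ht hx, zero_smul, add_zero]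
  · intro r hr
    rw [mix_mul he (srt_T h ht hr), (h.aff.bern _ (by omega)).tt, mix_smul]
    conv_rhs => rw [← mix_one (F := F) (h.e (srt x0 t)), mix_smul, mix_add]
    congr 1; ring
  · intro hx
    have hT0 := srt_T (x0 := x0) h ht (x := x) (r := 0) hx
    rw [add_zero] at hT0 ⊢
    rw [mix_mul he hT0, mix_mul he (hL _), mix_mul he hT0, mix_mul he (hL _), mix_mul he hT0,
      mix_mul he (hL _), (h.aff.bern _ (by omega)).braid4]
    congr 1; ring
  · intro i hi hx
    exact mix_comm he (hL _) (srt_T h ht hx) (h.aff.TL _ _ (by omega) (by omega) (by omega)).symm _ _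
  · intro i j hij hj
    exact mix_comm he (srt_T h ht (by omega)) (srt_T h ht hj) (h.aff.TT _ _ (by omega) (by omega)) _ _
  · intro i hi
    have e1 := srt_T (x0 := x0) h ht (x := x) (r := i) (by omega)
    have e2 := srt_T (x0 := x0) h ht (x := x) (r := i + 1) (by omega)
    rw [mix_mul he e1, mix_mul he e2, mix_mul he e2, mix_mul he e1, ← add_assoc,
      h.aff.br _ (by omega)]

end Psi

section CorS
open Polynomial
variable {F A B : Type} [Field F] [Ring A] [Algebra F A] [Ring B] [Algebra F B]

theorem Bern.map {q : F} {T x y : A} (h : Bern q T x y) (f : A →ₐ[F] B) :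
    Bern q (f T) (f x) (f y) where
  tt := by have := congrArg f h.tt; simpa using this
  xy := by have := congrArg f h.xy; simpa using this
  tx := by have := congrArg f h.tx; simpa using this
  ty := by have := congrArg f h.ty; simpa using this

theorem Aff.map {q : F} {N : ℕ} {L T : ℕ → A} (h : Aff q N L T) (f : A →ₐ[F] B) :
    Aff q N (fun i => f (L i)) (fun i => f (T i)) where
  bern i hi := (h.bern i hi).map f
  LL i j := by have := congrArg f (h.LL i j); simpa using this
  TL i j h1 h2 h3 := by have := congrArg f (h.TL i j h1 h2 h3); simpa using this
  TT i j h1 h2 := by have := congrArg f (h.TT i j h1 h2); simpa using this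
  br i hi := by have := congrArg f (h.br i hi); simpa using this

theorem isUnit_of_adjoin {s t w z : A} (hst : s * t = t * s) (hw : w ∈ Algebra.adjoin F {s, t})
    (hz : z ∈ Algebra.adjoin F {s, t}) (h : w * z * 1 = 1) : IsUnit z := by
  rw [mul_one] at h
  have hc : ∀ a ∈ ({s, t} : Set A), ∀ b ∈ ({s, t} : Set A), a * b = b * a := by
    rintro a (rfl | rfl) b (rfl | rfl)
    · rfl
    · exact hst
    · exact hst.symm
    · rfl
  letI : CommRing (Algebra.adjoin F {s, t}) := Algebra.adjoinCommRingOfComm F hc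
  have h2 : w * z = z * w :=
    congrArg Subtype.val (mul_comm (⟨w, hw⟩ : Algebra.adjoin F {s, t}) ⟨z, hz⟩)
  exact ⟨⟨z, w, by rw [← h2, h], h⟩, rfl⟩

variable {a' : ℕ} {q' : F} {N : ℕ} {G P : Fin a' → F[X]} {L T : ℕ → A}

/-- Data for one corner. -/
structure CorD (h : HD q' N G P L T) (x0 : Fin a') (t : Fin a' → ℕ) (l s : Fin a' → ℕ → B)
    (Φ : B →ₐ[F] A) : Prop where
  comm : ∀ b, h.e (srt x0 t) * Φ b = Φ b * h.e (srt x0 t)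
  hl : ∀ x r, r < t x → Φ (l x r) * h.e (srt x0 t) = L (off t x + r) * h.e (srt x0 t)
  hs : ∀ x r, r + 1 < t x → Φ (s x r) * h.e (srt x0 t) = T (off t x + r) * h.e (srt x0 t)
  gen : ∀ S : Subalgebra F B, (∀ x, 0 < t x → l x 0 ∈ S) → (∀ x r, r + 1 < t x → s x r ∈ S) →
    ∀ b, b ∈ S
  sys : Sys q' t l s
  ann : ∀ x, 0 < t x → aeval (l x 0) (G x) = 0

theorem exists_CorD (h : HD q' N G P L T) (x0 : Fin a') (t : Fin a' → ℕ) (ht : ∑ y, t y = N)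
    (M : Fin a' → ℕ) (w : ∀ x, Fin (M x) → F) (hG : ∀ x, G x = ∏ j, (X - C (w x j)))
    (j0 : ∀ x, Fin (M x)) :
    ∃ (l s : Fin a' → ℕ → ⨂[F] x, CH F (M x) (t x) (w x) q')
      (Φ : (⨂[F] x, CH F (M x) (t x) (w x) q') →ₐ[F] A), CorD h x0 t l s Φ := by
  have he := h.e_idem (srt x0 t)
  have hL' := fun i => h.e_L (srt x0 t) i
  have hT' := fun x r (hr : r + 1 < t x) => srt_T (x0 := x0) h ht hr
  choose Ψ hΨ0 hΨT using fun x => exists_Psi h x0 ht x (w x) (hG x) (j0 x)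
  have hle : ∀ x, t x ≤ N := fun x => by have := off_le t x; omega
  -- commutation
  have hcc : ∀ z : A, ∀ x, (0 < t x → z * Ψ x (hL _ _ _ _ 0) = Ψ x (hL _ _ _ _ 0) * z) →
      (∀ r, r + 1 < t x → z * Ψ x (hT _ _ _ _ r) = Ψ x (hT _ _ _ _ r) * z) →
      ∀ b, z * Ψ x b = Ψ x b * z := by
    intro z x h1 h2 b
    have := ch_induct ((Subalgebra.centralizer F {z}).comap (Ψ x)) (fun hx => by
      rw [Subalgebra.mem_comap, Subalgebra.mem_centralizer_iff]
      rintro _ rfl; exact h1 hx) (fun i hi => by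
      rw [Subalgebra.mem_comap, Subalgebra.mem_centralizer_iff]
      rintro _ rfl; exact h2 i hi) b
    rw [Subalgebra.mem_comap, Subalgebra.mem_centralizer_iff] at this
    exact this z rfl
  have hdis : ∀ x y, x ≠ y → off t x + t x ≤ off t y ∨ off t y + t y ≤ off t x := by
    intro x y hxy
    rcases lt_or_gt_of_ne hxy with h1 | h1
    · exact Or.inl (off_mono t h1)
    · exact Or.inr (off_mono t h1)
  have hcom : ∀ x y, x ≠ y → ∀ b d, Commute (Ψ x b) (Ψ y d) := by
    intro x y hxy b d
    have hd := hdis x y hxy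
    have ox := off_le t x
    have oy := off_le t y
    refine hcc _ y (fun hy => ?_) (fun r hr => ?_) d
    · refine (hcc _ x (fun hx => ?_) (fun r hr => ?_) b).symm
      · rw [hΨ0 _ hx, hΨ0 _ hy]; exact mix_comm he (hL' _) (hL' _) (h.aff.LL _ _) _ _
      · rw [hΨT _ _ hr, hΨ0 _ hy]
        exact mix_comm he (hL' _) (hT' _ _ hr) (h.aff.TL _ _ (by omega) (by omega) (by omega)).symm _ _
    · refine (hcc _ x (fun hx => ?_) (fun r' hr' => ?_) b).symm
      · rw [hΨ0 _ hx, hΨT _ _ hr]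
        exact mix_comm he (hT' _ _ hr) (hL' _) (h.aff.TL _ _ (by omega) (by omega) (by omega)) _ _
      · rw [hΨT _ _ hr, hΨT _ _ hr']
        refine mix_comm he (hT' _ _ hr) (hT' _ _ hr') ?_ _ _
        rcases hd with hd | hd
        · exact (h.aff.TT _ _ (by omega) (by omega)).symm
        · exact h.aff.TT _ _ (by omega) (by omega)
  obtain ⟨Φ, hΦ⟩ := exists_comb Ψ hcom
  have hea : ∀ x b, h.e (srt x0 t) * Ψ x b = Ψ x b * h.e (srt x0 t) := by
    intro x
    refine hcc _ x (fun hx => ?_) (fun r hr => ?_)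
    · rw [hΨ0 _ hx, e_mix (hL' _)]
    · rw [hΨT _ _ hr, e_mix (hT' _ _ hr)]
  have haff := fun x => (ch_aff (M := M x) (N := t x) (w := w x) h.hq)
  have hann : ∀ x, 0 < t x → aeval (PiTensorProduct.singleAlgHom (R := F)
      (A := fun x => CH F (M x) (t x) (w x) q') x (hL _ _ _ _ 0)) (G x) = 0 := by
    intro x hx
    rw [hG, aeval_algHom_apply, hL0_cyclo hx, map_zero]
  have hannf : ∀ x i, i < t x → aeval (PiTensorProduct.singleAlgHom (R := F)
      (A := fun x => CH F (M x) (t x) (w x) q') x (hL _ _ _ _ i)) (fam q' (G x) N) = 0 := by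
    intro x i hi
    exact ((haff x).map (PiTensorProduct.singleAlgHom (R := F)
      (A := fun x => CH F (M x) (t x) (w x) q') x)).ann h.hq (G x) (hann x) i hi (hle x)
  have hll : ∀ x y i j, PiTensorProduct.singleAlgHom (R := F)
      (A := fun x => CH F (M x) (t x) (w x) q') x (hL (M x) (t x) (w x) q' i) *
      PiTensorProduct.singleAlgHom (R := F)
      (A := fun x => CH F (M x) (t x) (w x) q') y (hL (M y) (t y) (w y) q' j) =
      PiTensorProduct.singleAlgHom (R := F)
      (A := fun x => CH F (M x) (t x) (w x) q') y (hL (M y) (t y) (w y) q' j) *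
      PiTensorProduct.singleAlgHom (R := F)
      (A := fun x => CH F (M x) (t x) (w x) q') x (hL (M x) (t x) (w x) q' i) := by
    intro x y i j
    by_cases hxy : x = y
    · subst hxy; rw [← map_mul, (haff x).LL, map_mul]
    · exact single_comm hxy _ _
  refine ⟨fun x i => PiTensorProduct.singleAlgHom x (hL (M x) (t x) (w x) q' i),
    fun x i => PiTensorProduct.singleAlgHom x (hT (M x) (t x) (w x) q' i), Φ, ⟨?_, ?_, ?_, ?_, ?_, hann⟩⟩
  · intro b
    have := tens_induct ((Subalgebra.centralizer F {h.e (srt x0 t)}).comap Φ) (fun x b => by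
      rw [Subalgebra.mem_comap, Subalgebra.mem_centralizer_iff]
      rintro _ rfl; rw [hΦ]; exact hea x b) b
    rw [Subalgebra.mem_comap, Subalgebra.mem_centralizer_iff] at this
    exact this _ rfl
  · intro x r hr
    rw [hΦ]
    induction r with
    | zero => rw [hΨ0 x hr, mix_e he, add_zero]
    | succ r ih =>
      have ih := ih (by omega)
      have ox := off_le t x
      have e1 : Ψ x (hT _ _ _ _ r) * h.e (srt x0 t) = T (off t x + r) * h.e (srt x0 t) := by
        rw [hΨT x r hr, mix_e he]
      have e2 := hT' x r hr
      have e3 : L (off t x + (r + 1)) = q'⁻¹ • (T (off t x + r) * L (off t x + r) * T (off t x + r)) := by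
        rw [(h.aff.bern _ (by omega)).tlt, smul_smul, inv_mul_cancel₀ h.hq, one_smul, add_assoc]
      rw [hL.eq_2, map_smul, map_mul, map_mul, e3, smul_mul_assoc, smul_mul_assoc, mul_assoc, e1,
        ← e2, ← mul_assoc, mul_assoc _ _ (h.e _), ih, ← hL', ← mul_assoc, e1, mul_assoc _ (h.e _),
        hL', mul_assoc _ _ (T _), mul_assoc _ _ (T _), e2]
      simp only [mul_assoc]
  · intro x r hr
    rw [hΦ, hΨT x r hr, mix_e he]
  · intro S h1 h2 b
    refine tens_induct S (fun x c => ?_) b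
    exact ch_induct (S.comap (PiTensorProduct.singleAlgHom (R := F)
      (A := fun x => CH F (M x) (t x) (w x) q') x)) (fun hx => h1 x hx)
      (fun i hi => h2 x i hi) c
  · refine ⟨fun x => (haff x).map _, hll, fun x y i j hxy => single_comm hxy _ _,
      fun x y i j hxy => single_comm hxy _ _, ?_, ?_⟩
    · intro x y i j hxy hi hj
      obtain ⟨w, hw, h1⟩ := h.pd.winv hxy.symm (hll y x j i) (e := 1) (by rw [hannf y j hj, zero_mul])
        (by rw [hannf x i hi, zero_mul])
      exact isUnit_of_adjoin (hll y x j i) hw (Subalgebra.sub_mem _ (Algebra.subset_adjoin (by simp))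
        (Algebra.subset_adjoin (by simp))) h1
    · intro x y i j hxy hi hj
      obtain ⟨w, hw, h1⟩ := h.pd.winvq h.hq hxy.symm (hll y x j i) (e := 1) (by rw [hannf y j hj, zero_mul])
        (by rw [hannf x i hi, zero_mul])
      exact isUnit_of_adjoin (hll y x j i) hw (Subalgebra.sub_mem _ (Subalgebra.smul_mem _
        (Algebra.subset_adjoin (by simp)) _) (Algebra.subset_adjoin (by simp))) h1

end CorS

section Surj
open Polynomial
variable {F A B : Type} [Field F] [Ring A] [Algebra F A] [Ring B] [Algebra F B]

/-- Elements which slide through `u`. -/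
def slideAlg (Φ : B →ₐ[F] A) (u : A) : Subalgebra F A where
  carrier := {z | ∃ b, z * u = u * Φ b}
  mul_mem' := by
    rintro y z ⟨b, hb⟩ ⟨d, hd⟩
    exact ⟨b * d, by rw [mul_assoc, hd, ← mul_assoc, hb, map_mul, mul_assoc]⟩
  add_mem' := by
    rintro y z ⟨b, hb⟩ ⟨d, hd⟩
    exact ⟨b + d, by rw [add_mul, hd, hb, map_add, mul_add]⟩
  algebraMap_mem' r := ⟨algebraMap F B r, by rw [AlgHom.commutes, Algebra.commutes]⟩

theorem adjoin_pair_comm {s t w z : A} (hst : s * t = t * s) (hw : w ∈ Algebra.adjoin F {s, t})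
    (hz : z ∈ Algebra.adjoin F {s, t}) : w * z = z * w := by
  have hc : ∀ a ∈ ({s, t} : Set A), ∀ b ∈ ({s, t} : Set A), a * b = b * a := by
    rintro a (rfl | rfl) b (rfl | rfl)
    · rfl
    · exact hst
    · exact hst.symm
    · rfl
  letI : CommRing (Algebra.adjoin F {s, t}) := Algebra.adjoinCommRingOfComm F hc
  exact congrArg Subtype.val (mul_comm (⟨w, hw⟩ : Algebra.adjoin F {s, t}) ⟨z, hz⟩)

variable {a' : ℕ} {q' : F} {N : ℕ} {G P : Fin a' → F[X]} {L T : ℕ → A} {h : HD q' N G P L T}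
  {x0 : Fin a'} {t : Fin a' → ℕ} {l s : Fin a' → ℕ → B} {Φ : B →ₐ[F] A}

/-- The span of the intertwiners. -/
def Ksp (h : HD q' N G P L T) (x0 : Fin a') (t : Fin a' → ℕ) (Φ : B →ₐ[F] A) : Submodule F A :=
  Submodule.span F {z | ∃ c u b, IsU N L T x0 t (h.e (srt x0 t)) c u ∧ z = u * Φ b}

theorem Ksp_mem {c : ℕ → Fin a'} {u : A} (hu : IsU N L T x0 t (h.e (srt x0 t)) c u) (b : B) :
    u * Φ b ∈ Ksp h x0 t Φ := Submodule.subset_span ⟨c, u, b, hu, rfl⟩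

theorem CorD.uswap (H : CorD h x0 t l s Φ) {c : ℕ → Fin a'} {u : A}
    (hu : IsU N L T x0 t (h.e (srt x0 t)) c u) {z : A} {b : B}
    (hz : Φ b * h.e (srt x0 t) = z * h.e (srt x0 t))
    (hc : h.e (srt x0 t) * z = z * h.e (srt x0 t)) : u * z = u * Φ b := by
  have h1 := hu.ue h
  rw [← h1, mul_assoc, mul_assoc, hc, H.comm, hz]

theorem CorD.L_slide (H : CorD h x0 t l s Φ) (ht : ∑ y, t y = N) {c : ℕ → Fin a'} {u : A}
    (hu : IsU N L T x0 t (h.e (srt x0 t)) c u) {i : ℕ} (hi : i < N) : L i ∈ slideAlg Φ u := by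
  refine ⟨l (c i) (rk c i), ?_⟩
  rw [hu.slideL h ht i hi]
  exact H.uswap hu (H.hl _ _ ((hu.ty ht).rk_lt hi)) (h.e_L _ _)

theorem CorD.T_mem (H : CorD h x0 t l s Φ) (ht : ∑ y, t y = N) {c : ℕ → Fin a'} {u : A}
    (hu : IsU N L T x0 t (h.e (srt x0 t)) c u) {i : ℕ} (hi : i + 1 < N) (b : B) :
    T i * (u * Φ b) ∈ Ksp h x0 t Φ := by
  have hbe := h.aff.bern i hi
  by_cases hc : c i = c (i + 1)
  · have h1 : rk c i + 1 < t (c i) := by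
      have := (hu.ty ht).rk_lt hi
      rwa [rk_succ c hc, ← hc] at this
    rw [← mul_assoc, hu.slideT h ht c u i hi hc]
    unfold pos
    rw [H.uswap hu (H.hs _ _ h1) (srt_T h ht h1), mul_assoc, ← map_mul]
    exact Ksp_mem hu _
  · obtain ⟨w, hw, h1⟩ := h.inv (show i < N by omega) hi hc
    have hx : L i ∈ Algebra.adjoin F {L i, L (i + 1)} := Algebra.subset_adjoin (by simp)
    have hy : L (i + 1) ∈ Algebra.adjoin F {L i, L (i + 1)} := Algebra.subset_adjoin (by simp)
    have hle : ∀ {c' : ℕ → Fin a'} {u' : A}, IsU N L T x0 t (h.e (srt x0 t)) c' u' →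
        Algebra.adjoin F {L i, L (i + 1)} ≤ slideAlg Φ u' := by
      intro c' u' hu'
      apply Algebra.adjoin_le
      rintro z (rfl | rfl)
      · exact H.L_slide ht hu' (by omega)
      · exact H.L_slide ht hu' hi
    obtain ⟨d, hd⟩ := hle hu hw
    have h2 : (L i - L (i + 1)) * (w * u) = u := by
      rw [← mul_assoc, ← adjoin_pair_comm (h.aff.LL _ _) hw (Subalgebra.sub_mem _ hx hy),
        ← hu.eu h, ← mul_assoc, h1]
    have h3 : T i * (L i - L (i + 1)) = Ph (T i) (L i) - (q' - 1) • L (i + 1) := by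
      unfold Ph; rw [mul_sub, hbe.ty]; abel
    have h4 : ∀ b, Ph (T i) (L i) * (u * Φ b) ∈ Ksp h x0 t Φ := by
      intro b
      rcases lt_or_gt_of_ne hc with hc | hc
      · rw [← mul_assoc]; exact Ksp_mem (hu.step hi hc) b
      · obtain ⟨u', hu', rfl⟩ := hu.desc h.aff ht hi hc
        have h5 : Ph (T i) (L i) * Ph (T i) (L i) ∈ slideAlg Φ u' := by
          rw [hbe.ph_sq]
          exact hle hu' (Subalgebra.mul_mem _ (Subalgebra.sub_mem _ (Subalgebra.smul_mem _ hx _) hy)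
            (Subalgebra.sub_mem _ (Subalgebra.smul_mem _ hy _) hx))
        obtain ⟨g, hg⟩ := h5
        rw [← mul_assoc, ← mul_assoc, hg, mul_assoc, ← map_mul]
        exact Ksp_mem hu' _
    have h5 : T i * (u * Φ b) = Ph (T i) (L i) * (u * Φ (d * b)) -
        (q' - 1) • (L (i + 1) * u * Φ (d * b)) := by
      rw [map_mul, ← mul_assoc u, ← hd]
      conv_lhs => rw [← h2]
      rw [mul_assoc _ (w * u), ← mul_assoc (T i), h3, sub_mul, smul_mul_assoc]
      simp only [mul_assoc]
      rw [← mul_assoc w u, hd]; simp only [mul_assoc]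
    rw [h5]
    obtain ⟨g, hg⟩ := hle hu hy
    refine Submodule.sub_mem _ (h4 _) (Submodule.smul_mem _ _ ?_)
    rw [hg, mul_assoc, ← map_mul]
    exact Ksp_mem hu _

/-- stabilizer of a submodule -/
def stab (K : Submodule F A) : Subalgebra F A where
  carrier := {z | ∀ y ∈ K, z * y ∈ K}
  mul_mem' := fun {a b} ha hb y hy => by rw [mul_assoc]; exact ha _ (hb _ hy)
  add_mem' := fun {a b} ha hb y hy => by rw [add_mul]; exact K.add_mem (ha _ hy) (hb _ hy)
  algebraMap_mem' r y hy := by rw [← Algebra.smul_def]; exact K.smul_mem r hy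

theorem CorD.Ae (H : CorD h x0 t l s Φ) (ht : ∑ y, t y = N)
    (hgen : ∀ S : Subalgebra F A, (0 < N → L 0 ∈ S) → (∀ i, i + 1 < N → T i ∈ S) → ∀ z, z ∈ S)
    (z : A) : z * h.e (srt x0 t) ∈ Ksp h x0 t Φ := by
  have key : ∀ z, (∀ c u b, IsU N L T x0 t (h.e (srt x0 t)) c u → z * (u * Φ b) ∈ Ksp h x0 t Φ) →
      z ∈ stab (Ksp h x0 t Φ) := by
    intro z hz y hy
    refine Submodule.span_induction ?_ ?_ ?_ ?_ hy
    · rintro _ ⟨c, u, b, hu, rfl⟩; exact hz c u b hu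
    · rw [mul_zero]; exact Submodule.zero_mem _
    · intro a b _ _ ha hb; rw [mul_add]; exact Submodule.add_mem _ ha hb
    · intro r a _ ha; rw [mul_smul_comm]; exact Submodule.smul_mem _ _ ha
  have h1 := hgen (stab (Ksp h x0 t Φ)) (fun hN => key _ fun c u b hu => by
    obtain ⟨d, hd⟩ := H.L_slide ht hu hN
    rw [← mul_assoc, hd, mul_assoc, ← map_mul]; exact Ksp_mem hu _)
    (fun i hi => key _ fun c u b hu => H.T_mem ht hu hi b) z
  have h2 := h1 _ (Ksp_mem (Φ := Φ) (IsU.base (N := N) (L := L) (T := T)) 1)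
  rwa [map_one, mul_one] at h2

theorem CorD.corner (H : CorD h x0 t l s Φ) (ht : ∑ y, t y = N)
    (hgen : ∀ S : Subalgebra F A, (0 < N → L 0 ∈ S) → (∀ i, i + 1 < N → T i ∈ S) → ∀ z, z ∈ S)
    (z : A) : ∃ b, h.e (srt x0 t) * z * h.e (srt x0 t) = Φ b * h.e (srt x0 t) := by
  rw [mul_assoc]
  have : ∀ y ∈ Ksp h x0 t Φ, ∃ b, h.e (srt x0 t) * y = Φ b * h.e (srt x0 t) := by
    intro y hy
    refine Submodule.span_induction ?_ ?_ ?_ ?_ hy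
    · rintro _ ⟨c, u, b, hu, rfl⟩
      by_cases hc : ∀ i < N, c i = srt x0 t i
      · have : c = srt x0 t := by
          funext i
          by_cases hi : i < N
          · exact hc i hi
          · rw [hu.tail ht i (by omega), srt_of_ge x0 t (by omega)]
        subst this
        have h1 := IsU.uniq h.aff ht _ _ _ hu IsU.base
        rw [h1]
        exact ⟨b, by rw [← mul_assoc, h.e_idem, H.comm]⟩
      · push Not at hc
        obtain ⟨i, hi, hne⟩ := hc
        exact ⟨0, by rw [← hu.eu h, ← mul_assoc, ← mul_assoc, h.e_orth hi (Ne.symm hne), zero_mul,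
          zero_mul, map_zero, zero_mul]⟩
    · exact ⟨0, by rw [mul_zero, map_zero, zero_mul]⟩
    · rintro a b _ _ ⟨c, hc⟩ ⟨d, hd⟩
      exact ⟨c + d, by rw [mul_add, hc, hd, map_add, add_mul]⟩
    · rintro r a _ ⟨c, hc⟩
      exact ⟨r • c, by rw [mul_smul_comm, hc, map_smul, smul_mul_assoc]⟩
  exact this _ (H.Ae ht hgen z)

theorem srt_ne {t t' : Fin a' → ℕ} (ht : ∑ y, t y = N) (ht' : ∑ y, t' y = N) (hne : t ≠ t')
    {c : ℕ → Fin a'} (hc : IsTy N t c) : ∃ i < N, srt x0 t' i ≠ c i := by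
  by_contra hcon
  push Not at hcon
  apply hne
  funext x
  rw [← hc x, ← cnt_congr hcon x]
  have := srt_isTy x0 t' x
  rwa [ht'] at this

theorem CorD.cross (H : CorD h x0 t l s Φ) (ht : ∑ y, t y = N)
    (hgen : ∀ S : Subalgebra F A, (0 < N → L 0 ∈ S) → (∀ i, i + 1 < N → T i ∈ S) → ∀ z, z ∈ S)
    {t' : Fin a' → ℕ} (ht' : ∑ y, t' y = N) (hne : t ≠ t')
    (z : A) : h.e (srt x0 t') * z * h.e (srt x0 t) = 0 := by
  rw [mul_assoc]
  have : ∀ y ∈ Ksp h x0 t Φ, h.e (srt x0 t') * y = 0 := by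
    intro y hy
    refine Submodule.span_induction ?_ ?_ ?_ ?_ hy
    · rintro _ ⟨c, u, b, hu, rfl⟩
      obtain ⟨i, hi, hne⟩ := srt_ne (x0 := x0) ht ht' hne (hu.ty ht)
      rw [← hu.eu h, ← mul_assoc, ← mul_assoc, h.e_orth hi hne, zero_mul, zero_mul]
    · rw [mul_zero]
    · intro a b _ _ ha hb; rw [mul_add, ha, hb, add_zero]
    · intro r a _ ha; rw [mul_smul_comm, ha, smul_zero]
  exact this _ (H.Ae ht hgen z)

/-- fullness -/
theorem HD.full_mem (h : HD q' N G P L T) (J : Submodule F A)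
    (hJ : ∀ y ∈ J, ∀ a b, a * y * b ∈ J) (ht : ∑ y, t y = N) (he : h.e (srt x0 t) ∈ J) :
    ∀ c, IsTy N t c → (∀ i, N ≤ i → c i = x0) → h.e c ∈ J := by
  intro c
  induction hk : mu N c using Nat.strong_induction_on generalizing c with
  | _ k ih =>
  intro hc h0
  by_cases hs : ∀ i, i + 1 < N → c i ≤ c (i + 1)
  · rw [sorted_eq x0 ht hc h0 hs]; exact he
  · push Not at hs
    obtain ⟨i, hi, hlt⟩ := hs
    have h1 := ih _ (hk ▸ mu_sw hi hlt) (sw i c) rfl (hc.sw hi) (fun j hj => by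
      rw [sw_of _ _ (by omega) (by omega)]; exact h0 j hj)
    obtain ⟨w, hw⟩ := h.invsq hi (ne_of_gt hlt)
    rw [← hw, mul_assoc w, mul_assoc (Ph _ _), h.ph_e hi, ← mul_assoc (Ph _ _), ← mul_assoc w,
      ← mul_assoc w]
    exact hJ _ h1 _ _

theorem cnt_sum (c : ℕ → Fin a') (N : ℕ) : ∑ x, cnt c x N = N := by
  induction N with
  | zero => simp [cnt_zero]
  | succ N ih =>
    simp only [cnt_succ, Finset.sum_add_distrib, ih]
    congr 1
    refine (Finset.sum_eq_single (c N) (fun y _ hy => if_neg (Ne.symm hy)) ?_).trans (if_pos rfl)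
    intro hn; exact absurd (Finset.mem_univ _) hn

theorem HD.full_one (h : HD q' N G P L T) (x0 : Fin a') (J : Submodule F A)
    (hJ : ∀ y ∈ J, ∀ a b, a * y * b ∈ J)
    (he : ∀ t : Fin a' → ℕ, ∑ y, t y = N → h.e (srt x0 t) ∈ J) : (1 : A) ∈ J := by
  rw [← h.e_sum x0]
  refine Submodule.sum_mem _ fun f _ => ?_
  have ht := cnt_sum (xt x0 f) N
  refine h.full_mem J hJ ht (he _ ht) _ (fun x => rfl) (fun i hi => ?_)
  simp [xt, not_lt.2 hi]

end Surj

theorem srt_isTy' {a' N : ℕ} {t : Fin a' → ℕ} (x0 : Fin a') (ht : ∑ y, t y = N) :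
    IsTy N t (srt x0 t) := by
  subst ht; exact srt_isTy x0 t

/-- The sorted word. -/
def sword {a' N : ℕ} {t : Fin a' → ℕ} (x0 : Fin a') (ht : ∑ y, t y = N) : Wd N t :=
  ⟨srt x0 t, srt_isTy' x0 ht⟩

section Inj
open Polynomial
variable {F A B : Type} [Field F] [Ring A] [Algebra F A] [Ring B] [Algebra F B]
variable {a' : ℕ} {q' : F} {N : ℕ} {G P : Fin a' → F[X]} {L T : ℕ → A} {h : HD q' N G P L T}
  {x0 : Fin a'} {t : Fin a' → ℕ} {l s : Fin a' → ℕ → B} {Φ : B →ₐ[F] A}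


/-- `z` acts as left multiplication by `b` at the component `c`. -/
def Acts (ρ : A →ₐ[F] Module.End F (Wd N t → B)) (c : Wd N t) (z : A) (b : B) : Prop :=
  ∀ f, ρ z f c = b * f c

theorem Acts.mul {ρ : A →ₐ[F] Module.End F (Wd N t → B)} {c : Wd N t} {z z' : A} {b b' : B}
    (h1 : Acts ρ c z b) (h2 : Acts ρ c z' b') : Acts ρ c (z * z') (b * b') := by
  intro f
  rw [map_mul, Module.End.mul_apply, h1, h2, mul_assoc]

theorem Acts.add {ρ : A →ₐ[F] Module.End F (Wd N t → B)} {c : Wd N t} {z z' : A} {b b' : B}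
    (h1 : Acts ρ c z b) (h2 : Acts ρ c z' b') : Acts ρ c (z + z') (b + b') := by
  intro f
  rw [map_add, LinearMap.add_apply, Pi.add_apply, h1, h2, add_mul]

theorem Acts.alg (ρ : A →ₐ[F] Module.End F (Wd N t → B)) (c : Wd N t) (r : F) :
    Acts ρ c (algebraMap F A r) (algebraMap F B r) := by
  intro f
  rw [AlgHom.commutes, Module.algebraMap_end_apply, Pi.smul_apply, Algebra.smul_def]

theorem Acts.aeval {ρ : A →ₐ[F] Module.End F (Wd N t → B)} {c : Wd N t} {z : A} {b : B}
    (h1 : Acts ρ c z b) (f : F[X]) : Acts ρ c (Polynomial.aeval z f) (Polynomial.aeval b f) := by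
  induction f using Polynomial.induction_on with
  | C r => rw [aeval_C, aeval_C]; exact Acts.alg ρ c r
  | add f g hf hg => rw [map_add, map_add]; exact hf.add hg
  | monomial i r h =>
    rw [pow_succ, ← mul_assoc, map_mul, map_mul (Polynomial.aeval b), aeval_X, aeval_X]
    exact h.mul h1

theorem rho_L (h : HD q' N G P L T) (hS : Sys q' t l s) {ρ : A →ₐ[F] Module.End F (Wd N t → B)}
    (h0 : 0 < N → ρ (L 0) = Lop N t F l 0)
    (hT : ∀ i, i + 1 < N → ρ (T i) = Top N t q' l s i) (i : ℕ) (hi : i < N) :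
    ρ (L i) = Lop N t F l i := by
  induction i with
  | zero => exact h0 hi
  | succ i ih =>
    have e1 := (h.aff.bern i hi).tlt
    have e2 := ((hS.affOp (N := N)).bern i hi).tlt
    have e3 : q' • ρ (L (i + 1)) = q' • Lop N t F l (i + 1) := by
      rw [← map_smul, ← e1, ← e2, map_mul, map_mul, ih (by omega), hT i hi]
    have := congrArg (fun z => q'⁻¹ • z) e3
    simpa only [smul_smul, inv_mul_cancel₀ h.hq, one_smul] using this

theorem CorD.P_one (H : CorD h x0 t l s Φ) (ht : ∑ y, t y = N) {x : Fin a'} {r : ℕ} (hr : r < t x) :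
    aeval (l x r) (P x) = 1 := by
  have hle : t x ≤ N := by have := off_le t x; omega
  have h1 : aeval (l x r) (fam q' (G x) N) = 0 := (H.sys.aff x).ann h.hq _ (H.ann x) r hr hle
  have h2 := congrArg (aeval (l x r)) h.pd.sum
  rw [map_sum, map_one, Finset.sum_eq_single x (fun y _ hy => aeval_dvd (h.pd.dvd x y (Ne.symm hy)) h1)
    (by simp)] at h2
  exact h2

theorem CorD.acts_e (H : CorD h x0 t l s Φ) (ht : ∑ y, t y = N)
    {ρ : A →ₐ[F] Module.End F (Wd N t → B)}
    (hL : ∀ i, i < N → ρ (L i) = Lop N t F l i) : Acts ρ (sword x0 ht) (h.e (srt x0 t)) 1 := by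
  have hone : Acts ρ (sword x0 ht) 1 1 := by
    have := Acts.alg ρ (sword x0 ht) 1
    rwa [map_one, map_one] at this
  have : ∀ S : Finset ℕ, (∀ i ∈ S, i < N) → Acts ρ (sword x0 ht) (Lev F L h.aff.LL (∏ j ∈ S,
      aeval (MvPolynomial.X j) (P (srt x0 t j)))) 1 := by
    intro S
    induction S using Finset.induction_on with
    | empty => intro _; rw [Finset.prod_empty, map_one]; exact hone
    | insert j S hj ih =>
      intro hS
      have hjN := hS j (Finset.mem_insert_self _ _)
      rw [Finset.prod_insert hj, map_mul, Lev_aeval, ← mul_one (1 : B)]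
      refine Acts.mul ?_ (ih fun i hi => hS i (Finset.mem_insert_of_mem hi))
      have h1 : Acts ρ (sword x0 ht) (L j) (l (srt x0 t j) (rk (srt x0 t) j)) := by
        intro f; rw [hL j hjN]; rfl
      have h2 := h1.aeval (P (srt x0 t j))
      have h3 : rk (srt x0 t) j < t (srt x0 t j) := (sword x0 ht).2.rk_lt hjN
      rwa [H.P_one ht h3] at h2
  exact this (Finset.range N) fun i hi => Finset.mem_range.1 hi

theorem CorD.acts (H : CorD h x0 t l s Φ) (ht : ∑ y, t y = N)
    {ρ : A →ₐ[F] Module.End F (Wd N t → B)} (h0 : 0 < N → ρ (L 0) = Lop N t F l 0)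
    (hT : ∀ i, i + 1 < N → ρ (T i) = Top N t q' l s i) (b : B) :
    Acts ρ (sword x0 ht) (Φ b * h.e (srt x0 t)) b := by
  have hL := rho_L h H.sys h0 hT
  have he := H.acts_e ht hL
  let S : Subalgebra F B :=
    { carrier := {b | Acts ρ (sword x0 ht) (Φ b * h.e (srt x0 t)) b}
      mul_mem' := by
        intro a b ha hb
        have := Acts.mul ha hb
        rw [mul_assoc, ← mul_assoc (h.e _), H.comm, mul_assoc, h.e_idem, ← mul_assoc, ← map_mul] at this
        exact this
      add_mem' := by
        intro a b ha hb
        have := Acts.add ha hb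
        rw [← add_mul, ← map_add] at this
        exact this
      algebraMap_mem' := by
        intro r
        have := (Acts.alg ρ (sword x0 ht) r).mul he
        rw [mul_one, ← AlgHom.commutes Φ] at this
        exact this }
  refine H.gen S (fun x hx => ?_) (fun x r hr => ?_) b
  · change Acts ρ (sword x0 ht) (Φ (l x 0) * h.e (srt x0 t)) (l x 0)
    rw [H.hl x 0 hx, ← mul_one (l x 0)]
    refine Acts.mul ?_ he
    intro f
    have := off_le t x
    rw [hL _ (by omega), Lop_apply]
    change l (srt x0 t (off t x + 0)) (rk (srt x0 t) (off t x + 0)) * _ = _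
    rw [rk_srt x0 t hx, srt_off x0 t hx]
  · change Acts ρ (sword x0 ht) (Φ (s x r) * h.e (srt x0 t)) (s x r)
    rw [H.hs x r hr, ← mul_one (s x r)]
    refine Acts.mul ?_ he
    intro f
    have := off_le t x
    rw [hT _ (by omega), Top_diag]
    · change s (srt x0 t (off t x + r)) (rk (srt x0 t) (off t x + r)) * _ = _
      rw [rk_srt x0 t (by omega), srt_off x0 t (by omega)]
    · change srt x0 t _ = srt x0 t _
      rw [srt_off x0 t (by omega), add_assoc, srt_off x0 t hr]

theorem CorD.inj (H : CorD h x0 t l s Φ) (ht : ∑ y, t y = N)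
    {ρ : A →ₐ[F] Module.End F (Wd N t → B)} (h0 : 0 < N → ρ (L 0) = Lop N t F l 0)
    (hT : ∀ i, i + 1 < N → ρ (T i) = Top N t q' l s i) {b : B}
    (hb : Φ b * h.e (srt x0 t) = 0) : b = 0 := by
  have := H.acts ht h0 hT b (fun _ => 1)
  rw [hb, map_zero, mul_one] at this
  exact this.symm

/-- The representation on the words. -/
theorem exists_rho {M : ℕ} (w : Fin M → F) (G : Fin a' → F[X]) (hG : ∏ x, G x = ∏ j, (X - C (w j)))
    (hS : Sys q' t l s) (hann : ∀ x, 0 < t x → aeval (l x 0) (G x) = 0) :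
    ∃ ρ : CH F M N w q' →ₐ[F] Module.End F (Wd N t → B),
      (0 < N → ρ (hL M N w q' 0) = Lop N t F l 0) ∧
      ∀ i, i + 1 < N → ρ (hT M N w q' i) = Top N t q' l s i := by
  have ha := hS.affOp (N := N)
  refine ch_lift _ _ ?_ (fun i hi => (ha.bern i hi).tt) (fun hN => (ha.bern 0 hN).braid4)
    (fun i hi hN => (ha.TL i 0 hN (by omega) (by omega)).symm) ha.TT ha.br
  intro hN
  have h1 : ∀ (g : F[X]) (f : Wd N t → B) (c : Wd N t),
      aeval (Lop N t F l 0) g f c = aeval (lc l c.1 0) g * f c := by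
    intro g f c
    induction g using Polynomial.induction_on generalizing f with
    | C r => rw [aeval_C, aeval_C, Module.algebraMap_end_apply, Pi.smul_apply, Algebra.smul_def]
    | add g g' hg hg' =>
      rw [map_add, map_add, LinearMap.add_apply, Pi.add_apply, hg, hg', add_mul]
    | monomial i r h =>
      rw [pow_succ, ← mul_assoc, map_mul, map_mul (aeval (lc l c.1 0)), aeval_X, aeval_X,
        Module.End.mul_apply, h, Lop_apply, mul_assoc]
  ext f c
  rw [h1, ← hG]
  have h2 : rk c.1 0 = 0 := cnt_zero _ _
  have h3 : 0 < t (c.1 0) := by have := c.2.rk_lt hN; omega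
  have h4 := aeval_dvd (Finset.dvd_prod_of_mem G (Finset.mem_univ (c.1 0))) (hann _ h3)
  unfold lc
  rw [h2, h4, zero_mul]
  rfl

end Inj

section Assemble
variable {F A : Type} [Field F] [Ring A] [Algebra F A]

theorem assemble {I : Type} [Fintype I] {B : I → Type} [∀ i, Ring (B i)] [∀ i, Algebra F (B i)]
    (Φ : ∀ i, B i →ₐ[F] A) (e : I → A) (hidem : ∀ i, e i * e i = e i)
    (hcomm : ∀ i b, e i * Φ i b = Φ i b * e i)
    (hcross : ∀ i j, i ≠ j → ∀ z, e i * z * e j = 0)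
    (hcorner : ∀ i z, ∃ b, e i * z * e i = Φ i b * e i)
    (hinj : ∀ i b, Φ i b * e i = 0 → b = 0)
    (hfull : ∀ J : Submodule F A, (∀ y ∈ J, ∀ a b, a * y * b ∈ J) → (∀ i, e i ∈ J) → 1 ∈ J) :
    ∃ ψ : (Π i, B i) →ₙₐ[F] A, IsFullCorner ψ := by
  have horth : ∀ i j, i ≠ j → e i * e j = 0 := fun i j hij => by
    have := hcross i j hij 1
    rwa [mul_one] at this
  have hcm : ∀ (b : Π i, B i) j, e j * ∑ i, Φ i (b i) * e i = Φ j (b j) * e j := by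
    intro b j
    rw [Finset.mul_sum, Finset.sum_eq_single j]
    · rw [← mul_assoc, hcomm, mul_assoc, hidem]
    · intro i _ hi
      rw [← hcomm, ← mul_assoc, horth j i (Ne.symm hi), zero_mul]
    · simp
  let ψ : (Π i, B i) →ₙₐ[F] A :=
    { toFun := fun b => ∑ i, Φ i (b i) * e i
      map_smul' := by
        intro c b
        simp only [Pi.smul_apply, map_smul, smul_mul_assoc, Finset.smul_sum, MonoidHom.id_apply]
      map_zero' := by simp
      map_add' := by
        intro b b'
        simp only [Pi.add_apply, map_add, add_mul, Finset.sum_add_distrib]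
      map_mul' := by
        intro b b'
        rw [Finset.sum_mul]
        refine Finset.sum_congr rfl fun i _ => ?_
        rw [mul_assoc, hcm, Pi.mul_apply, map_mul, mul_assoc] }
  have hψ : ∀ b, ψ b = ∑ i, Φ i (b i) * e i := fun b => rfl
  have hψ1 : ψ 1 = ∑ i, e i := by
    rw [hψ]; simp
  refine ⟨ψ, ?_, ?_, ?_⟩
  · intro b b' hb
    funext j
    have h1 := congrArg (fun z => e j * z) hb
    simp only [hψ, hcm] at h1
    have h2 := hinj j (b j - b' j) (by rw [map_sub, sub_mul, h1, sub_self])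
    exact sub_eq_zero.1 h2
  · intro r
    choose b hb using fun i => hcorner i r
    refine ⟨b, ?_⟩
    rw [hψ, hψ1, Finset.sum_mul, Finset.sum_mul]
    refine Finset.sum_congr rfl fun i _ => ?_
    rw [Finset.mul_sum, Finset.sum_eq_single i (fun j _ hj => hcross i j (Ne.symm hj) r) (by simp), hb]
  · have h1 := hfull (Submodule.span F (Set.range fun p : A × A => p.1 * ψ 1 * p.2)) ?_ ?_
    · obtain ⟨c, hc⟩ := Finsupp.mem_span_range_iff_exists_finsupp.1 h1
      refine ⟨c.support, inferInstance, fun i => c i.1 • i.1.1, fun i => i.1.2, ?_⟩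
      refine Eq.trans ?_ hc
      unfold Finsupp.sum
      rw [← Finset.sum_coe_sort c.support (fun i => c i • (i.1 * ψ 1 * i.2))]
      refine Finset.sum_congr rfl fun i _ => ?_
      rw [smul_mul_assoc, smul_mul_assoc]
    · intro y hy a b
      induction hy using Submodule.span_induction with
      | mem y hy =>
        obtain ⟨⟨u, v⟩, rfl⟩ := hy
        refine Submodule.subset_span ⟨(a * u, v * b), ?_⟩
        simp only [mul_assoc]
      | zero => rw [mul_zero, zero_mul]; exact Submodule.zero_mem _
      | add y y' _ _ h1 h2 => rw [mul_add, add_mul]; exact Submodule.add_mem _ h1 h2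
      | smul r y _ h1 =>
        rw [mul_smul_comm, smul_mul_assoc]; exact Submodule.smul_mem _ _ h1
    · intro i
      refine Submodule.subset_span ⟨(e i, e i), ?_⟩
      have := hcm 1 i
      simp only [Pi.one_apply, map_one, one_mul] at this
      simp only [hψ1]
      rw [this, hidem]

end Assemble

theorem tuples_finite (N a' : ℕ) : Finite (Tuples N a') := by
  refine Finite.of_injective (β := Fin a' → Fin (N + 1)) (fun t i => ⟨t.1 i, ?_⟩) ?_
  · have h1 := Finset.single_le_sum (f := t.1) (fun i _ => Nat.zero_le _) (Finset.mem_univ i)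
    have h2 := t.2
    omega
  · intro t t' h
    apply Subtype.ext
    funext i
    exact congrArg Fin.val (congrFun h i)

open Polynomial in
theorem Gp_part {F : Type} [Field F] {M a' : ℕ} (w : Fin M → F) (p' : Fin M → Fin a') (x : Fin a') :
    Gp w p' x = ∏ j, (X - C (partParams F M w a' p' x j)) := by
  unfold Gp partParams
  rw [← Finset.prod_coe_sort]
  exact (Fintype.prod_equiv
    (((Finset.univ.filter (fun j : Fin M => p' j = x)).orderIsoOfFin rfl).toEquiv) _ _ (fun j => rfl)).symm

theorem main_corner {F : Type} [Field F] {M N a' : ℕ} (w : Fin M → F) (q' : F) (p' : Fin M → Fin a')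
    [NeZero M] (hq : q' ≠ 0) (hsurj : Function.Surjective p')
    (hpart : ∀ j l : Fin M, p' j = p' l ↔ ∃ b : ℤ, w j = q' ^ b * w l) :
    ∃ ψ : TargetAlg F M N w q' a' p' →ₙₐ[F] CH F M N w q', IsFullCorner ψ := by
  let x0 : Fin a' := p' 0
  haveI : Nonempty (Fin a') := ⟨x0⟩
  haveI := tuples_finite N a'
  haveI := Fintype.ofFinite (Tuples N a')
  obtain ⟨P, hP⟩ := exists_PD w p' hq hpart N
  have h : HD q' N (Gp w p') P (hL M N w q') (hT M N w q') :=
    ⟨hq, ch_aff hq, hP, fun hN => by rw [Gp_prod]; exact hL0_cyclo hN⟩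
  have hj0 : ∀ x, Nonempty (Fin (partCard M a' p' x)) := by
    intro x
    obtain ⟨j, hj⟩ := hsurj x
    refine ⟨⟨0, Finset.card_pos.2 ⟨j, ?_⟩⟩⟩
    simp [hj]
  choose l s Φ H using fun t : Tuples N a' => exists_CorD h x0 t.1 t.2 (partCard M a' p')
    (partParams F M w a' p') (Gp_part w p') (fun x => (hj0 x).some)
  refine assemble Φ (fun t => h.e (srt x0 t.1)) (fun t => h.e_idem _) (fun t => (H t).comm)
    (fun t t' hne z => ?_) (fun t z => (H t).corner t.2 ch_induct z) (fun t b hb => ?_)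
    (fun J hJ he => h.full_one x0 J hJ fun t ht => he ⟨t, ht⟩)
  · exact (H t').cross t'.2 ch_induct t.2 (fun h' => hne (Subtype.ext h'.symm)) z
  · obtain ⟨ρ, h0, h1⟩ := exists_rho w (Gp w p') (Gp_prod w p') (H t).sys (H t).ann (N := N)
    exact (H t).inj t.2 h0 h1 hb

/-- **Dipper–Mathas.**  If the multiset `{v_1,…,v_m}` is partitioned into
parts `S_1 ⊔ ⋯ ⊔ S_a` according to the `q`-orbit equivalence `v_j ∼ q^b v_l`, then the
category of finite-dimensional right `H_n(v_1,…,v_m;q)`-modules is `k`-linearly equivalent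
to the category of finite-dimensional right modules over
`∏_{n_1+⋯+n_a=n} H_{n_1}(S_1;q) ⊗_k ⋯ ⊗_k H_{n_a}(S_a;q)`. -/
theorem morita_decomposition [NeZero m] [NeZero n] (hq : q ≠ 0)
    (hsurj : Function.Surjective p)
    (hpart : ∀ j l : Fin m, p j = p l ↔ ∃ b : ℤ, v j = q ^ b * v l) :
    ∃ e : FDM k (CH k m n v q) ≌ FDM k (TargetAlg k m n v q a p),
      (∀ (X Y : FDM k (CH k m n v q)) (f g : X ⟶ Y),
        e.functor.map (f + g) = e.functor.map f + e.functor.map g) ∧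
      (∀ (c : k) (X : FDM k (CH k m n v q)),
        e.functor.map (ObjectProperty.homMk (cmul k c X.obj)) =
          ObjectProperty.homMk (cmul k c (e.functor.obj X).obj)) := by
  obtain ⟨ψ, hψ⟩ := main_corner (N := n) v q p hq hsurj hpart
  exact morita_right hψ

end Cyclo
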